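/- Let η ∈ (0,1) be a constant and let p : ℕ → ℝ satisfy 0 < p(n) ≤ 1 − η and log(1/p(n))/log n → 0 as n → ∞. With b(n) := 1/(1 − p(n)) and log_b(np) := log(n·p(n))/log b(n), for every constant ε > 0 the probability that the random graph G_{n,p(n)} satisfies both (1 − ε)·n/log_b(np) ≤ χ_g(G_{n,p(n)}) ≤ (1 + ε)·n/log_b(np) and (2 − ε)·χ(G_{n,p(n)}) ≤ χ_g(G_{n,p(n)}) ≤ (2 + ε)·χ(G_{n,p(n)}) tends to 1 as n → ∞, where χ denotes the ordinary chromatic number. -/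

import Mathlib

open MeasureTheory Filter


abbrev EdgeIdx (n : ℕ) := {e : Sym2 (Fin n) // ¬ e.IsDiag}

noncomputable def bernoulliBool (p : ℝ) : Measure Bool :=
  ENNReal.ofReal p • Measure.dirac true + ENNReal.ofReal (1 - p) • Measure.dirac false

noncomputable def erMeasure (n : ℕ) (p : ℝ) : Measure (EdgeIdx n → Bool) :=
  Measure.pi fun _ => bernoulliBool p

def erGraph (n : ℕ) (ω : EdgeIdx n → Bool) : SimpleGraph (Fin n) where
  Adj u v := u ≠ v ∧ ∀ h : ¬ (s(u, v) : Sym2 (Fin n)).IsDiag, ω ⟨s(u, v), h⟩ = true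
  symm := by
    constructor
    rintro u v ⟨hne, h⟩
    refine ⟨hne.symm, fun hd => ?_⟩
    have hs : (s(v, u) : Sym2 (Fin n)) = s(u, v) := Sym2.eq_swap
    have hd' : ¬ (s(u, v) : Sym2 (Fin n)).IsDiag := by rw [← hs]; exact hd
    exact (congrArg ω (Subtype.ext hs)).trans (h hd')
  loopless := by constructor; rintro u ⟨h, -⟩; exact h rfl

/-- A legal move in the coloring game: color vertex `v` with color `c`. -/
def LegalMove {V : Type*} {k : ℕ} (G : SimpleGraph V)
    (f : V → Option (Fin k)) (v : V) (c : Fin k) : Prop :=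
  f v = none ∧ ∀ u, G.Adj u v → f u ≠ some c

/-- A strategy maps a partial coloring to a move (vertex, color). -/
def Strategy (V : Type*) (k : ℕ) := (V → Option (Fin k)) → V × Fin k

/-- A strategy is legal if it plays a legal move whenever one exists. -/
def Strategy.IsLegal {V : Type*} {k : ℕ} (σ : Strategy V k) (G : SimpleGraph V) : Prop :=
  ∀ f : V → Option (Fin k), (∃ v c, LegalMove G f v c) →
    LegalMove G f (σ f).1 (σ f).2

open Classical in
/-- The play of the coloring game: Maker (using `σM`) moves at even steps,
Breaker (using `σB`) at odd steps; the position freezes once no legal move exists. -/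
noncomputable def play {V : Type*} [DecidableEq V] {k : ℕ} (G : SimpleGraph V)
    (σM σB : Strategy V k) : ℕ → V → Option (Fin k)
  | 0 => fun _ => none
  | t + 1 =>
    let f := play G σM σB t
    if ∃ v c, LegalMove G f v c then
      let m := if t % 2 = 0 then σM f else σB f
      Function.update f m.1 (some m.2)
    else f

/-- Maker wins the coloring game with `k` colors on `G`. -/
def MakerWins {V : Type*} [Fintype V] [DecidableEq V] (G : SimpleGraph V) (k : ℕ) : Prop :=
  ∃ σM : Strategy V k, σM.IsLegal G ∧
    ∀ σB : Strategy V k, σB.IsLegal G →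
      ∀ v : V, play G σM σB (Fintype.card V) v ≠ none

/-- Breaker wins the coloring game with `k` colors on `G`. -/
def BreakerWins {V : Type*} [Fintype V] [DecidableEq V] (G : SimpleGraph V) (k : ℕ) : Prop :=
  ∃ σB : Strategy V k, σB.IsLegal G ∧
    ∀ σM : Strategy V k, σM.IsLegal G →
      ∃ v : V, play G σM σB (Fintype.card V) v = none

/-- The game chromatic number of `G`. -/
noncomputable def gameChromaticNumber {V : Type*} [Fintype V] [DecidableEq V]
    (G : SimpleGraph V) : ℕ :=
  sInf {k | MakerWins G k}


open MeasureTheory Filter Finset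

section FinProb
set_option linter.unusedSectionVars false
set_option linter.unusedVariables false
variable {E : Type*} [Fintype E] [DecidableEq E]

/-- weight of an outcome -/
def wt (p : ℝ) (ω : E → Bool) : ℝ := ∏ e, if ω e = true then p else 1 - p

/-- expectation -/
def Ex (p : ℝ) (f : (E → Bool) → ℝ) : ℝ := ∑ ω, wt p ω * f ω

open Classical in
/-- probability -/
noncomputable def Pr (p : ℝ) (P : (E → Bool) → Prop) : ℝ := Ex p fun ω => if P ω then 1 else 0

lemma wt_nonneg {p : ℝ} (h0 : 0 ≤ p) (h1 : p ≤ 1) (ω : E → Bool) : 0 ≤ wt p ω :=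
  Finset.prod_nonneg fun e _ => by split_ifs <;> linarith

lemma Ex_prod (p : ℝ) (h : E → Bool → ℝ) :
    Ex p (fun ω => ∏ e, h e (ω e)) = ∏ e, (p * h e true + (1 - p) * h e false) := by
  have := Finset.prod_univ_sum (fun _ : E => (Finset.univ : Finset Bool))
    (fun e c => (if c = true then p else 1 - p) * h e c)
  simp only [Fintype.piFinset_univ, Finset.prod_mul_distrib] at this
  unfold Ex wt
  rw [← this]
  simp

lemma Ex_const (p c : ℝ) : Ex p (fun _ : E → Bool => c) = c := by
  have := Ex_prod (E := E) p (fun _ _ => 1)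
  simp only [Finset.prod_const_one, mul_one, add_sub_cancel] at this
  unfold Ex at *
  rw [← Finset.sum_mul]
  simp only [mul_one] at this
  rw [this, one_mul]

lemma Ex_add (p : ℝ) (f g : (E → Bool) → ℝ) : Ex p (fun ω => f ω + g ω) = Ex p f + Ex p g := by
  simp [Ex, mul_add, Finset.sum_add_distrib]

lemma Ex_smul (p c : ℝ) (f : (E → Bool) → ℝ) : Ex p (fun ω => c * f ω) = c * Ex p f := by
  simp only [Ex, Finset.mul_sum]; exact Finset.sum_congr rfl fun _ _ => by ring

lemma Ex_sub (p : ℝ) (f g : (E → Bool) → ℝ) : Ex p (fun ω => f ω - g ω) = Ex p f - Ex p g := by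
  simp [Ex, mul_sub, Finset.sum_sub_distrib]

lemma Ex_sum {ι : Type*} (p : ℝ) (s : Finset ι) (f : ι → (E → Bool) → ℝ) :
    Ex p (fun ω => ∑ i ∈ s, f i ω) = ∑ i ∈ s, Ex p (f i) := by
  simp only [Ex, Finset.mul_sum]; rw [Finset.sum_comm]

lemma Ex_mono {p : ℝ} (h0 : 0 ≤ p) (h1 : p ≤ 1) {f g : (E → Bool) → ℝ} (h : ∀ ω, f ω ≤ g ω) :
    Ex p f ≤ Ex p g :=
  Finset.sum_le_sum fun ω _ => mul_le_mul_of_nonneg_left (h ω) (wt_nonneg h0 h1 ω)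

lemma Ex_nonneg {p : ℝ} (h0 : 0 ≤ p) (h1 : p ≤ 1) {f : (E → Bool) → ℝ} (h : ∀ ω, 0 ≤ f ω) :
    0 ≤ Ex p f :=
  Finset.sum_nonneg fun ω _ => mul_nonneg (wt_nonneg h0 h1 ω) (h ω)

lemma Pr_le_Ex {p : ℝ} (h0 : 0 ≤ p) (h1 : p ≤ 1) {P : (E → Bool) → Prop} {f : (E → Bool) → ℝ}
    (hf : ∀ ω, 0 ≤ f ω) (h : ∀ ω, P ω → 1 ≤ f ω) : Pr p P ≤ Ex p f :=
  Ex_mono h0 h1 fun ω => by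
    split_ifs with hP
    · exact h ω hP
    · exact hf ω

lemma Pr_mono {p : ℝ} (h0 : 0 ≤ p) (h1 : p ≤ 1) {P Q : (E → Bool) → Prop}
    (h : ∀ ω, P ω → Q ω) : Pr p P ≤ Pr p Q :=
  Ex_mono h0 h1 fun ω => by
    by_cases hP : P ω
    · simp [hP, h ω hP]
    · simp only [hP, if_false]; split_ifs <;> norm_num

lemma Pr_nonneg {p : ℝ} (h0 : 0 ≤ p) (h1 : p ≤ 1) (P : (E → Bool) → Prop) : 0 ≤ Pr p P :=
  Ex_nonneg h0 h1 fun ω => by split_ifs <;> norm_num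

lemma Pr_union {ι : Type*} {p : ℝ} (h0 : 0 ≤ p) (h1 : p ≤ 1) (s : Finset ι)
    (P : ι → (E → Bool) → Prop) :
    Pr p (fun ω => ∃ i ∈ s, P i ω) ≤ ∑ i ∈ s, Pr p (P i) := by
  classical
  have e : ∑ i ∈ s, Pr p (P i) = Ex p (fun ω => ∑ i ∈ s, if P i ω then (1:ℝ) else 0) := by
    rw [Ex_sum]; refine Finset.sum_congr rfl fun i _ => ?_
    unfold Pr; congr 1
  rw [e]
  apply Pr_le_Ex h0 h1
  · intro ω; exact Finset.sum_nonneg fun i _ => by split_ifs <;> norm_num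
  · rintro ω ⟨i, hi, hP⟩
    calc (1:ℝ) = if P i ω then 1 else 0 := by simp [hP]
      _ ≤ _ := Finset.single_le_sum (f := fun i => if P i ω then (1:ℝ) else 0)
        (fun i _ => by split_ifs <;> norm_num) hi

lemma Pr_union_const {ι : Type*} {p : ℝ} (h0 : 0 ≤ p) (h1 : p ≤ 1) (s : Finset ι)
    (P : ι → (E → Bool) → Prop) (c : ℝ) (h : ∀ i ∈ s, Pr p (P i) ≤ c) :
    Pr p (fun ω => ∃ i ∈ s, P i ω) ≤ s.card * c :=
  (Pr_union h0 h1 s P).trans (by simpa using Finset.sum_le_card_nsmul s _ c h)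

lemma Pr_or {p : ℝ} (h0 : 0 ≤ p) (h1 : p ≤ 1) (P Q : (E → Bool) → Prop) :
    Pr p (fun ω => P ω ∨ Q ω) ≤ Pr p P + Pr p Q := by
  unfold Pr
  rw [← Ex_add]
  apply Ex_mono h0 h1
  intro ω
  by_cases h1 : P ω <;> by_cases h2 : Q ω <;> simp [h1, h2]

lemma Pr_not (p : ℝ) (P : (E → Bool) → Prop) : Pr p (fun ω => ¬ P ω) = 1 - Pr p P := by
  unfold Pr
  rw [eq_sub_iff_add_eq, ← Ex_add]
  refine Eq.trans ?_ (Ex_const (E := E) p 1)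
  congr 1; funext ω; by_cases h : P ω <;> simp [h]

lemma Pr_all_false (p : ℝ) (F : Finset E) :
    Pr p (fun ω => ∀ e ∈ F, ω e = false) = (1 - p) ^ F.card := by
  have := Ex_prod p (fun e c => if e ∈ F then (if c = false then (1:ℝ) else 0) else 1)
  have h2 : ∀ e, (p * (if e ∈ F then (if true = false then (1:ℝ) else 0) else 1) +
      (1 - p) * (if e ∈ F then (if false = false then (1:ℝ) else 0) else 1))
      = if e ∈ F then 1 - p else 1 := by
    intro e; by_cases h : e ∈ F <;> simp [h]
  rw [Finset.prod_congr rfl (fun e _ => h2 e)] at this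
  rw [Finset.prod_ite_mem, Finset.univ_inter, Finset.prod_const] at this
  rw [← this]
  unfold Pr
  congr 1; funext ω
  rw [Finset.prod_ite_mem, Finset.univ_inter, Finset.prod_boole]
  simp only []
  congr

lemma Ex_mul_indep (p : ℝ) (A : Finset E) {f g : (E → Bool) → ℝ}
    (hf : ∀ x y : E → Bool, (∀ e ∈ A, x e = y e) → f x = f y)
    (hg : ∀ x y : E → Bool, (∀ e, e ∉ A → x e = y e) → g x = g y) :
    Ex p (fun ω => f ω * g ω) = Ex p f * Ex p g := by
  let mix : (E → Bool) × (E → Bool) → (E → Bool) × (E → Bool) := fun x =>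
    (fun e => if e ∈ A then x.1 e else x.2 e, fun e => if e ∈ A then x.2 e else x.1 e)
  have hmm : Function.Involutive mix := by
    intro x; ext e <;> by_cases h : e ∈ A <;> simp [mix, h]
  have hw : ∀ x, wt p (mix x).1 * wt p (mix x).2 = wt p x.1 * wt p x.2 := by
    intro x
    simp only [wt, ← Finset.prod_mul_distrib]
    refine Finset.prod_congr rfl fun e _ => ?_
    by_cases h : e ∈ A <;> simp [mix, h, mul_comm]
  have h1 : Ex p f * Ex p g = ∑ x : (E → Bool) × (E → Bool),
      (wt p x.1 * wt p x.2) * (f x.1 * g x.2) := by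
    rw [Fintype.sum_prod_type]
    simp only [Ex]
    rw [Finset.sum_mul_sum]
    exact Finset.sum_congr rfl fun _ _ => Finset.sum_congr rfl fun _ _ => by ring
  have h2 : Ex p (fun ω => f ω * g ω) * Ex p (fun _ : E → Bool => 1)
      = ∑ x : (E → Bool) × (E → Bool), (wt p x.1 * wt p x.2) * (f x.1 * g x.1) := by
    rw [Fintype.sum_prod_type]
    simp only [Ex]
    rw [Finset.sum_mul_sum]
    exact Finset.sum_congr rfl fun _ _ => Finset.sum_congr rfl fun _ _ => by ring
  rw [Ex_const, mul_one] at h2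
  rw [h1, h2, ← Equiv.sum_comp hmm.toPerm]
  refine Finset.sum_congr rfl fun x _ => ?_
  have e1 : f (mix x).1 = f x.1 := hf _ _ fun e he => by simp [mix, he]
  have e2 : g (mix x).1 = g x.2 := hg _ _ fun e he => by simp [mix, he]
  simp only [Function.Involutive.coe_toPerm]
  rw [hw, e1, e2]

lemma Ex_prod_indep {ι : Type*} (p : ℝ) (s : Finset ι) (B : ι → Finset E)
    (g : ι → (E → Bool) → ℝ) (hd : ∀ i ∈ s, ∀ j ∈ s, i ≠ j → Disjoint (B i) (B j))
    (hg : ∀ i ∈ s, ∀ x y : E → Bool, (∀ e ∈ B i, x e = y e) → g i x = g i y) :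
    Ex p (fun ω => ∏ i ∈ s, g i ω) = ∏ i ∈ s, Ex p (g i) := by
  classical
  induction s using Finset.induction_on with
  | empty => simp [Ex_const]
  | insert a s ha ih =>
    simp only [Finset.prod_insert ha]
    rw [Ex_mul_indep p (B a) (hg a (by simp)), ih]
    · exact fun i hi j hj => hd i (by simp [hi]) j (by simp [hj])
    · exact fun i hi => hg i (by simp [hi])
    · intro x y h
      refine Finset.prod_congr rfl fun i hi => hg i (by simp [hi]) x y fun e he => h e fun he' => ?_
      have : a ≠ i := fun h => ha (h ▸ hi)
      exact Finset.disjoint_left.1 (hd a (by simp) i (by simp [hi]) this) he' he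

/-- Harris inequality -/
lemma Ex_harris {p : ℝ} (h0 : 0 ≤ p) (h1 : p ≤ 1) {f g : (E → Bool) → ℝ} (hf0 : ∀ ω, 0 ≤ f ω)
    (hf1 : ∀ ω, f ω ≤ 1) (hg0 : ∀ ω, 0 ≤ g ω)
    (hf : Antitone f) (hg : Monotone g) : Ex p (fun ω => f ω * g ω) ≤ Ex p f * Ex p g := by
  have := fkg (μ := wt p) (f := fun ω => 1 - f ω) (g := g) (fun ω => wt_nonneg h0 h1 ω)
    (fun ω => sub_nonneg.2 (hf1 ω)) hg0 (fun a b h => sub_le_sub_left (hf h) 1) hg (by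
      intro a b
      simp only [wt, ← Finset.prod_mul_distrib]
      apply le_of_eq
      refine Finset.prod_congr rfl fun e _ => ?_
      cases ha : a e <;> cases hb : b e <;> simp [ha, hb, mul_comm])
  have hc : ∑ a : E → Bool, wt p a = 1 := by simpa [Ex] using Ex_const (E := E) p 1
  have e1 : ∑ a, wt p a * (1 - f a) = 1 - Ex p f := by
    simp only [mul_sub, Finset.sum_sub_distrib, mul_one, hc, Ex]
  have e2 : ∑ a, wt p a * ((1 - f a) * g a) = Ex p g - Ex p (fun ω => f ω * g ω) := by
    simp only [Ex, ← Finset.sum_sub_distrib]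
    exact Finset.sum_congr rfl fun _ _ => by ring
  rw [hc, e1, e2] at this
  have e3 : ∑ a, wt p a * g a = Ex p g := rfl
  rw [e3] at this
  nlinarith

end FinProb

lemma erMeasure_eq (n : ℕ) {p : ℝ} (h0 : 0 ≤ p) (h1 : p ≤ 1) (S : Set (EdgeIdx n → Bool)) :
    erMeasure n p S = ENNReal.ofReal (Pr p fun ω => ω ∈ S) := by
  classical
  have hfin : IsFiniteMeasure (bernoulliBool p) := by
    unfold bernoulliBool; constructor; simp
  have hs : ∀ ω, erMeasure n p {ω} = ENNReal.ofReal (wt p ω) := by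
    intro ω
    rw [erMeasure, Measure.pi_singleton, wt, ENNReal.ofReal_prod_of_nonneg]
    · refine Finset.prod_congr rfl fun e _ => ?_
      cases h : ω e <;> simp [bernoulliBool]
    · intro e _; split_ifs <;> linarith
  have : S = ⋃ ω ∈ (Finset.univ.filter (· ∈ S)), {ω} := by ext; simp
  conv_lhs => rw [this]
  rw [measure_biUnion_finset]
  · simp only [hs]
    rw [← ENNReal.ofReal_sum_of_nonneg fun ω _ => wt_nonneg h0 h1 ω]
    simp [Pr, Ex, Finset.sum_filter]
  · intro a _ b _ hab; simpa using hab
  · intro b _; exact MeasurableSet.singleton b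

open MeasureTheory Filter Finset

set_option linter.unusedSectionVars false
set_option linter.unusedVariables false

section Conc
open scoped Classical

/-- color class -/
noncomputable def cls {V : Type*} [Fintype V] {k : ℕ} (f : V → Option (Fin k)) (i : Fin k) :
    Finset V := univ.filter (fun u => f u = some i)

/-- concentration property -/
def Conc {V : Type*} [Fintype V] (G : SimpleGraph V) (q h : ℝ) : Prop :=
  ∀ k ≤ Fintype.card V, ∀ f : V → Option (Fin k), ∀ I : Finset (Fin k), ∀ X : Finset V,
    (∀ v ∈ X, f v = none) →
    ((X.card : ℝ) * ∑ i ∈ I, q ^ (cls f i).card) / 2 -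
        h * (X.card + (univ.filter fun u => f u ≠ none).card + I.card + 1)
      ≤ ∑ i ∈ I, ((X.filter fun v => LegalMove G f v i).card : ℝ) ∧
    ∑ i ∈ I, ((X.filter fun v => LegalMove G f v i).card : ℝ) ≤
      2 * ((X.card : ℝ) * ∑ i ∈ I, q ^ (cls f i).card) +
        h * (X.card + (univ.filter fun u => f u ≠ none).card + I.card + 1)

variable {n : ℕ}

/-- edge set between v and C -/
noncomputable def blk (v : Fin n) (C : Finset (Fin n)) : Finset (EdgeIdx n) :=
  univ.filter (fun e => ∃ u ∈ C, e.1 = s(u, v))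

lemma not_adj_iff (ω : EdgeIdx n → Bool) {u v : Fin n} (h : u ≠ v) :
    ¬ (erGraph n ω).Adj u v ↔ ∀ e : EdgeIdx n, e.1 = s(u, v) → ω e = false := by
  have hd : ¬ (s(u, v) : Sym2 (Fin n)).IsDiag := by simpa using h
  have : (erGraph n ω).Adj u v ↔ ω ⟨s(u,v), hd⟩ = true := by
    simp only [erGraph]
    exact ⟨fun h => h.2 hd, fun h' => ⟨h, fun _ => h'⟩⟩
  rw [this]
  constructor
  · rintro h' ⟨e, he⟩ rfl
    simpa using h'
  · intro h'
    simp [h' ⟨s(u,v), hd⟩ rfl]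

lemma blk_card (v : Fin n) (C : Finset (Fin n)) (hv : v ∉ C) : (blk v C).card = C.card := by
  symm
  refine Finset.card_bij (fun u hu => ⟨s(u, v), by
    have : u ≠ v := fun h => hv (h ▸ hu)
    simpa using this⟩) ?_ ?_ ?_
  · intro u hu; simp only [blk, mem_filter, mem_univ, true_and]; exact ⟨u, hu, rfl⟩
  · intro a ha b hb h
    simp only [Subtype.mk.injEq, Sym2.eq_iff] at h
    rcases h with h | h
    · exact h.1
    · exact h.1.trans h.2
  · rintro ⟨e, he⟩ h
    simp only [blk, mem_filter, mem_univ, true_and] at h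
    obtain ⟨u, hu, rfl⟩ := h
    exact ⟨u, hu, rfl⟩

lemma nonadj_blk (ω : EdgeIdx n → Bool) (v : Fin n) (C : Finset (Fin n)) (hv : v ∉ C) :
    (∀ u ∈ C, ¬ (erGraph n ω).Adj u v) ↔ ∀ e ∈ blk v C, ω e = false := by
  constructor
  · intro h e he
    simp only [blk, mem_filter, mem_univ, true_and] at he
    obtain ⟨u, hu, he⟩ := he
    exact (not_adj_iff ω (fun h' => hv (by rw [← h']; exact hu))).1 (h u hu) e he
  · intro h u hu
    rw [not_adj_iff ω (fun h' => hv (by rw [← h']; exact hu))]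
    intro e he
    exact h e (by simp only [blk, mem_filter, mem_univ, true_and]; exact ⟨u, hu, he⟩)

lemma legal_blk {k : ℕ} (ω : EdgeIdx n → Bool) (f : Fin n → Option (Fin k)) {v : Fin n}
    (hv : f v = none) (i : Fin k) :
    LegalMove (erGraph n ω) f v i ↔ ∀ e ∈ blk v (cls f i), ω e = false := by
  rw [← nonadj_blk _ _ _ (by simp [cls, hv])]
  simp only [LegalMove, hv, true_and, cls, mem_filter, mem_univ]
  exact ⟨fun h u hu ha => h u ha hu, fun h u ha hu => h u hu ha⟩

/-- exponential moment -/
lemma exp_moment {k : ℕ} {p : ℝ} (f : Fin n → Option (Fin k)) (I : Finset (Fin k))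
    (X : Finset (Fin n)) (hX : ∀ v ∈ X, f v = none) (l : ℝ) :
    Ex p (fun ω => Real.exp (l * ∑ i ∈ I,
      ((X.filter fun v => LegalMove (erGraph n ω) f v i).card : ℝ))) =
    ∏ x ∈ X ×ˢ I, (1 + (Real.exp l - 1) * (1 - p) ^ (cls f x.2).card) := by
  have e1 : ∀ ω, Real.exp (l * ∑ i ∈ I,
      ((X.filter fun v => LegalMove (erGraph n ω) f v i).card : ℝ)) =
      ∏ x ∈ X ×ˢ I, (if (∀ e ∈ blk x.1 (cls f x.2), ω e = false) then Real.exp l else 1) := by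
    intro ω
    rw [Finset.mul_sum, Real.exp_sum, Finset.prod_product_right]
    refine Finset.prod_congr rfl fun i _ => ?_
    rw [Finset.prod_ite, Finset.prod_const, Finset.prod_const_one, mul_one, mul_comm,
      Real.exp_nat_mul]
    congr 2
    exact Finset.filter_congr fun v hv => legal_blk ω f (hX v hv) i
  simp only [e1]
  rw [Ex_prod_indep p (X ×ˢ I) (fun x => blk x.1 (cls f x.2))]
  · refine Finset.prod_congr rfl fun x hx => ?_
    rw [mem_product] at hx
    have h1 := Pr_all_false p (blk x.1 (cls f x.2))
    rw [blk_card _ _ (by simp [cls, hX _ hx.1])] at h1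
    rw [← h1]
    unfold Pr
    rw [← Ex_smul]
    refine Eq.trans ?_ (congrArg (· + _) (Ex_const (E := EdgeIdx n) p 1))
    rw [← Ex_add]
    congr 1; funext ω
    split_ifs <;> simp_all
  · rintro ⟨v, i⟩ h1 ⟨w, j⟩ h2 hne
    rw [mem_product] at h1 h2
    rw [Finset.disjoint_left]
    intro e he he'
    simp only [blk, mem_filter, mem_univ, true_and, cls] at he he'
    obtain ⟨a, ha, he⟩ := he
    obtain ⟨b, hb, he'⟩ := he'
    rw [he, Sym2.eq_iff] at he'
    have hv := hX _ h1.1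
    have hw := hX _ h2.1
    simp only at hv hw
    rcases he' with ⟨rfl, rfl⟩ | ⟨rfl, rfl⟩
    · rw [ha] at hb; exact hne (by simp_all)
    · rw [ha] at hw; cases hw
  · intro x hx a b h
    have : (∀ e ∈ blk x.1 (cls f x.2), a e = false) ↔ (∀ e ∈ blk x.1 (cls f x.2), b e = false) := by
      constructor <;> intro h' e he
      · rw [← h e he]; exact h' e he
      · rw [h e he]; exact h' e he
    simp only [this]

lemma conc_fixed {k : ℕ} {p : ℝ} (h0 : 0 ≤ p) (h1 : p ≤ 1) (f : Fin n → Option (Fin k))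
    (I : Finset (Fin k)) (X : Finset (Fin n)) (hX : ∀ v ∈ X, f v = none) (H : ℝ) :
    Pr p (fun ω => ¬ (((X.card : ℝ) * ∑ i ∈ I, (1 - p) ^ (cls f i).card) / 2 - H
      ≤ ∑ i ∈ I, ((X.filter fun v => LegalMove (erGraph n ω) f v i).card : ℝ) ∧
    ∑ i ∈ I, ((X.filter fun v => LegalMove (erGraph n ω) f v i).card : ℝ) ≤
      2 * ((X.card : ℝ) * ∑ i ∈ I, (1 - p) ^ (cls f i).card) + H)) ≤ 2 * Real.exp (-H) := by
  set m := (X.card : ℝ) * ∑ i ∈ I, (1 - p) ^ (cls f i).card with hm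
  have hms : m = ∑ x ∈ X ×ˢ I, (1 - p) ^ (cls f x.2).card := by
    rw [Finset.sum_product]; simp [hm]
  have hq0 : 0 ≤ 1 - p := by linarith
  have key : ∀ l c : ℝ, Real.exp l - 1 ≤ c →
      Ex p (fun ω => Real.exp (l * ∑ i ∈ I,
      ((X.filter fun v => LegalMove (erGraph n ω) f v i).card : ℝ))) ≤ Real.exp (c * m) := by
    intro l c hc
    rw [exp_moment f I X hX, hms, Finset.mul_sum, Real.exp_sum]
    refine Finset.prod_le_prod ?_ ?_
    · intro x _
      have a1 : (1 - p) ^ (cls f x.2).card ≤ 1 := pow_le_one₀ hq0 (by linarith)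
      have a2 : 0 ≤ (1 - p) ^ (cls f x.2).card := pow_nonneg hq0 _
      nlinarith [Real.exp_pos l]
    · intro x _
      have a2 : 0 ≤ (1 - p) ^ (cls f x.2).card := pow_nonneg hq0 _
      have := Real.add_one_le_exp (c * (1 - p) ^ (cls f x.2).card)
      nlinarith
  have hu := key 1 2 (by linarith [Real.exp_one_lt_d9])
  have hl := key (-1) (-1/2) (by
    have : Real.exp (-1) < 1/2 := by
      rw [Real.exp_neg, inv_lt_comm₀ (Real.exp_pos _) (by norm_num)]
      linarith [Real.exp_one_gt_d9]
    linarith)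
  refine (Pr_mono h0 h1 (Q := fun ω => (∑ i ∈ I,
      ((X.filter fun v => LegalMove (erGraph n ω) f v i).card : ℝ) < m / 2 - H) ∨
      (2 * m + H < ∑ i ∈ I, ((X.filter fun v => LegalMove (erGraph n ω) f v i).card : ℝ))) ?_).trans
    ((Pr_or h0 h1 _ _).trans ?_)
  · intro ω h
    rw [not_and_or, not_le, not_le] at h
    exact h
  · have b1 : Pr p (fun ω => (∑ i ∈ I,
      ((X.filter fun v => LegalMove (erGraph n ω) f v i).card : ℝ) < m / 2 - H)) ≤ Real.exp (-H) := by
      refine (Pr_le_Ex h0 h1 (f := fun ω => Real.exp (m / 2 - H) * Real.exp (-1 * ∑ i ∈ I,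
      ((X.filter fun v => LegalMove (erGraph n ω) f v i).card : ℝ))) (fun ω => by positivity) ?_).trans ?_
      · intro ω h
        rw [← Real.exp_add]
        apply Real.one_le_exp; linarith
      · rw [Ex_smul]
        refine (mul_le_mul_of_nonneg_left hl (Real.exp_pos _).le).trans (le_of_eq ?_)
        rw [← Real.exp_add]; congr 1; ring
    have b2 : Pr p (fun ω => (2 * m + H < ∑ i ∈ I,
      ((X.filter fun v => LegalMove (erGraph n ω) f v i).card : ℝ))) ≤ Real.exp (-H) := by
      refine (Pr_le_Ex h0 h1 (f := fun ω => Real.exp (- (2 * m) - H) * Real.exp (1 * ∑ i ∈ I,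
      ((X.filter fun v => LegalMove (erGraph n ω) f v i).card : ℝ))) (fun ω => by positivity) ?_).trans ?_
      · intro ω h
        rw [← Real.exp_add]
        apply Real.one_le_exp; linarith
      · rw [Ex_smul]
        refine (mul_le_mul_of_nonneg_left hu (Real.exp_pos _).le).trans (le_of_eq ?_)
        rw [← Real.exp_add]; congr 1; ring
    linarith

lemma sum_fun_pow (k : ℕ) (y : ℝ) :
    ∑ f : Fin n → Option (Fin k), y ^ (univ.filter fun u => f u ≠ none).card = (1 + k * y) ^ n := by
  have := Finset.prod_univ_sum (fun _ : Fin n => (Finset.univ : Finset (Option (Fin k))))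
    (fun _ c => if c ≠ none then y else 1)
  simp only [Fintype.piFinset_univ, Fintype.sum_option] at this
  simp only [ne_eq, not_true_eq_false, if_false, reduceCtorEq, not_false_eq_true, if_true,
    sum_const, card_univ, Fintype.card_fin, prod_const, nsmul_eq_mul] at this
  rw [this]
  refine Finset.sum_congr rfl fun f _ => ?_
  rw [Finset.prod_ite]; simp

lemma sum_set_pow {α : Type*} [Fintype α] (y : ℝ) :
    ∑ I : Finset α, y ^ I.card = (1 + y) ^ Fintype.card α := by
  have := Finset.sum_pow_mul_eq_add_pow y 1 (univ : Finset α)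
  simp only [one_pow, mul_one, powerset_univ] at this
  rw [this, add_comm, card_univ]

lemma conc_prob {p : ℝ} (h0 : 0 ≤ p) (h1 : p ≤ 1) (hn : 1 ≤ n) :
    Pr p (fun ω => ¬ Conc (erGraph n ω) (1 - p) (3 * Real.log n)) ≤
      (n + 1) * (2 * Real.exp 3) / n ^ 3 := by
  set h := 3 * Real.log n with hh
  set y := Real.exp (-h) with hy
  have hnpos : (0:ℝ) < n := by exact_mod_cast hn
  have hn1 : (1:ℝ) ≤ n := by exact_mod_cast hn
  have hyn : y = 1 / n ^ 3 := by
    rw [hy, hh, Real.exp_neg, one_div, show (3:ℝ) = ((3:ℕ):ℝ) by norm_num, Real.exp_nat_mul,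
      Real.exp_log hnpos]
  have y0 : 0 < y := Real.exp_pos _
  have step : Pr p (fun ω => ¬ Conc (erGraph n ω) (1 - p) h) ≤
      ∑ k ∈ range (n+1), ∑ f : Fin n → Option (Fin k), ∑ I : Finset (Fin k),
        ∑ X : Finset (Fin n), 2 * (y ^ X.card * y ^ (univ.filter fun u => f u ≠ none).card *
          y ^ I.card * y) := by
    refine le_trans (Pr_mono h0 h1 (Q := fun ω => ∃ k ∈ range (n+1),
      ∃ f ∈ (univ : Finset (Fin n → Option (Fin k))), ∃ I ∈ (univ : Finset (Finset (Fin k))),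
      ∃ X ∈ (univ : Finset (Finset (Fin n))), (∀ v ∈ X, f v = none) ∧
      ¬ (((X.card : ℝ) * ∑ i ∈ I, (1 - p) ^ (cls f i).card) / 2 -
        h * (X.card + (univ.filter fun u => f u ≠ none).card + I.card + 1)
      ≤ ∑ i ∈ I, ((X.filter fun v => LegalMove (erGraph n ω) f v i).card : ℝ) ∧
    ∑ i ∈ I, ((X.filter fun v => LegalMove (erGraph n ω) f v i).card : ℝ) ≤
      2 * ((X.card : ℝ) * ∑ i ∈ I, (1 - p) ^ (cls f i).card) +
        h * (X.card + (univ.filter fun u => f u ≠ none).card + I.card + 1))) ?_) ?_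
    · intro ω hω
      unfold Conc at hω
      push Not at hω
      obtain ⟨k, hk, f, I, X, hX, hω⟩ := hω
      refine ⟨k, ?_, f, mem_univ _, I, mem_univ _, X, mem_univ _, hX, ?_⟩
      · simp at hk; simp; omega
      · intro hc; exact absurd hc.2 (not_le.2 (hω hc.1))
    · refine (Pr_union h0 h1 _ _).trans (Finset.sum_le_sum fun k _ => ?_)
      refine (Pr_union h0 h1 _ _).trans (Finset.sum_le_sum fun f _ => ?_)
      refine (Pr_union h0 h1 _ _).trans (Finset.sum_le_sum fun I _ => ?_)
      refine (Pr_union h0 h1 _ _).trans (Finset.sum_le_sum fun X _ => ?_)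
      by_cases hX : ∀ v ∈ X, f v = none
      · refine (Pr_mono h0 h1 ?_).trans ((conc_fixed h0 h1 f I X hX
          (h * (X.card + (univ.filter fun u => f u ≠ none).card + I.card + 1))).trans (le_of_eq ?_))
        · exact fun ω h => h.2
        · congr 1
          rw [hy, ← Real.exp_nat_mul, ← Real.exp_nat_mul, ← Real.exp_nat_mul, ← Real.exp_add,
            ← Real.exp_add, ← Real.exp_add]
          congr 1; ring
      · refine (Pr_mono h0 h1 (Q := fun _ => False) ?_).trans ?_
        · exact fun ω h => hX h.1
        · unfold Pr; simp only [if_false]; rw [Ex_const]; positivity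
  refine step.trans ?_
  have inner : ∀ k ∈ range (n+1), (∑ f : Fin n → Option (Fin k), ∑ I : Finset (Fin k),
        ∑ X : Finset (Fin n), 2 * (y ^ X.card * y ^ (univ.filter fun u => f u ≠ none).card *
          y ^ I.card * y)) ≤ 2 * Real.exp 3 / n ^ 3 := by
    intro k hk
    have hk' : (k:ℝ) ≤ n := by exact_mod_cast Nat.lt_succ_iff.1 (mem_range.1 hk)
    have e : (∑ f : Fin n → Option (Fin k), ∑ I : Finset (Fin k),
        ∑ X : Finset (Fin n), 2 * (y ^ X.card * y ^ (univ.filter fun u => f u ≠ none).card *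
          y ^ I.card * y)) = 2 * y * ((1 + y) ^ n * (1 + k * y) ^ n * (1 + y) ^ k) := by
      have s1 := sum_fun_pow (n := n) k y
      have s2 := sum_set_pow (α := Fin n) y
      have s3 := sum_set_pow (α := Fin k) y
      rw [Fintype.card_fin] at s2 s3
      rw [← s1, ← s2, ← s3]
      simp only [Finset.mul_sum, Finset.sum_mul]
      rw [Finset.sum_comm]
      refine Finset.sum_congr rfl fun a _ => Finset.sum_congr rfl fun b _ =>
        Finset.sum_congr rfl fun c _ => ?_
      ring
    rw [e]
    have g1 : (1 + y) ^ n ≤ Real.exp 1 := by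
      calc (1 + y) ^ n ≤ (Real.exp y) ^ n := by
            gcongr; linarith [Real.add_one_le_exp y]
        _ = Real.exp (n * y) := by rw [Real.exp_nat_mul]
        _ ≤ _ := by
          apply Real.exp_le_exp.2; rw [hyn, mul_one_div, div_le_one (by positivity)]
          nlinarith [pow_le_pow_right₀ hn1 (show 1 ≤ 3 by norm_num)]
    have g2 : (1 + y) ^ k ≤ Real.exp 1 := le_trans (pow_le_pow_right₀ (by linarith)
      (by exact_mod_cast hk')) g1
    have g3 : (1 + k * y) ^ n ≤ Real.exp 1 := by
      calc (1 + k * y) ^ n ≤ (Real.exp (k * y)) ^ n := by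
            gcongr; linarith [Real.add_one_le_exp (k * y)]
        _ = Real.exp (n * (k * y)) := (Real.exp_nat_mul _ _).symm
        _ ≤ _ := by
          apply Real.exp_le_exp.2; rw [hyn, mul_one_div, mul_div_assoc', div_le_one (by positivity)]
          nlinarith [pow_le_pow_right₀ hn1 (show 2 ≤ 3 by norm_num)]
    have e3 : Real.exp 3 = Real.exp 1 * Real.exp 1 * Real.exp 1 := by
      rw [← Real.exp_add, ← Real.exp_add]; norm_num
    rw [e3, hyn]
    rw [hyn] at g1 g2 g3
    calc _ ≤ 2 * (1 / (n:ℝ)^3) * (Real.exp 1 * Real.exp 1 * Real.exp 1) := by gcongr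
      _ = _ := by ring
  refine (Finset.sum_le_sum inner).trans (le_of_eq ?_)
  simp; ring

/-- restricted version -/
lemma Conc.restr {V : Type*} [Fintype V] {G : SimpleGraph V} {q h : ℝ} (hc : Conc G q h)
    {k : ℕ} (hk : k ≤ Fintype.card V) (f : V → Option (Fin k)) (I : Finset (Fin k)) (X : Finset V)
    (hX : ∀ v ∈ X, f v = none) :
    ((X.card : ℝ) * ∑ i ∈ I, q ^ (cls f i).card) / 2 -
        h * (X.card + (∑ i ∈ I, (cls f i).card : ℕ) + I.card + 1)
      ≤ ∑ i ∈ I, ((X.filter fun v => LegalMove G f v i).card : ℝ) ∧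
    ∑ i ∈ I, ((X.filter fun v => LegalMove G f v i).card : ℝ) ≤
      2 * ((X.card : ℝ) * ∑ i ∈ I, q ^ (cls f i).card) +
        h * (X.card + (∑ i ∈ I, (cls f i).card : ℕ) + I.card + 1) := by
  let g : V → Option (Fin k) := fun u => if ∃ i ∈ I, f u = some i then f u else none
  have hg : ∀ i ∈ I, ∀ u, g u = some i ↔ f u = some i := by
    intro i hi u
    simp only [g]
    constructor
    · intro h; split_ifs at h; exact h
    · intro h; rw [if_pos ⟨i, hi, h⟩]; exact h
  have hcl : ∀ i ∈ I, cls g i = cls f i := by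
    intro i hi; unfold cls; exact Finset.filter_congr fun u _ => hg i hi u
  have hgX : ∀ v ∈ X, g v = none := by
    intro v hv; simp [g, hX v hv]
  have hL : ∀ i ∈ I, (X.filter fun v => LegalMove G g v i) = X.filter fun v => LegalMove G f v i := by
    intro i hi
    refine Finset.filter_congr fun v hv => ?_
    simp only [LegalMove, hX v hv, hgX v hv, true_and, ne_eq, hg i hi]
  have hcard : (univ.filter fun u => g u ≠ none).card = ∑ i ∈ I, (cls f i).card := by
    rw [← Finset.card_biUnion]
    · congr 1; ext u
      simp only [mem_filter, mem_univ, true_and, mem_biUnion, cls, g]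
      constructor
      · intro h
        by_contra hc
        exact h (if_neg (by simpa using hc))
      · rintro ⟨i, hi, hu⟩
        rw [if_pos ⟨i, hi, hu⟩, hu]; simp
    · intro a _ b _ hab
      rw [Function.onFun, Finset.disjoint_left]
      intro u h1 h2
      simp only [cls, mem_filter, mem_univ, true_and] at h1 h2
      rw [h1] at h2; exact hab (by simpa using h2)
  have := hc k hk g I X hgX
  rw [hcard] at this
  rw [Finset.sum_congr rfl (fun i hi => by rw [hcl i hi] : ∀ i ∈ I, q ^ (cls g i).card = q ^ (cls f i).card),
    Finset.sum_congr rfl (fun i hi => by rw [hL i hi] : ∀ i ∈ I,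
      ((X.filter fun v => LegalMove G g v i).card : ℝ) = ((X.filter fun v => LegalMove G f v i).card : ℝ))] at this
  exact this

end Conc

open MeasureTheory Filter Finset

set_option linter.unusedSectionVars false
set_option linter.unusedVariables false

section Props
open scoped Classical

def AlphaLT {V : Type*} (G : SimpleGraph V) (s : ℕ) : Prop :=
  ∀ S : Finset V, S.card = s → ¬ G.IsIndepSet (S : Set V)

def PropA1 {V : Type*} (G : SimpleGraph V) (t z M : ℕ) : Prop :=
  ∀ C : Finset V, C.card = t → ∀ I : Fin M → Finset V, (∀ a, (I a).card = z) →
    (∀ a b, a ≠ b → Disjoint (I a) (I b)) → (∀ a, Disjoint (I a) C) →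
    (∀ a, ∀ u ∈ C, ∀ w ∈ I a, ¬ G.Adj u w) → ∃ a, ¬ G.IsIndepSet (I a : Set V)

def PropA2 {V : Type*} (G : SimpleGraph V) (p : ℝ) (t a b K : ℕ) : Prop :=
  ∀ C U W : Finset V, C.card = t → a ≤ U.card → U.card ≤ b → W.card = K → Disjoint C U →
    Disjoint W C → Disjoint W U → (∀ w ∈ W, ∀ u ∈ C, ¬ G.Adj u w) →
    ∃ w ∈ W, p * U.card / 10 < ((U.filter fun u => G.Adj u w).card : ℝ)

variable {n : ℕ}

noncomputable def insE (S : Finset (Fin n)) : Finset (EdgeIdx n) :=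
  univ.filter (fun e => ∀ x ∈ e.1, x ∈ S)

lemma insE_card (S : Finset (Fin n)) : (insE S).card = S.card.choose 2 := by
  rw [← Sym2.card_image_offDiag, ← Finset.card_map (Function.Embedding.subtype _)]
  congr 1
  ext e
  simp only [insE, Finset.mem_map, mem_filter, mem_univ, true_and, Function.Embedding.subtype_apply,
    Subtype.exists, exists_and_left, exists_prop, exists_eq_right_right, mem_image, mem_offDiag,
    Prod.exists]
  induction e with
  | _ a b =>
    simp only [Sym2.mem_iff, forall_eq_or_imp, forall_eq, Sym2.mk_isDiag_iff]
    constructor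
    · rintro ⟨⟨h1, h2⟩, h3⟩; exact ⟨a, b, ⟨h1, h2, h3⟩, rfl⟩
    · rintro ⟨x, y, ⟨h1, h2, h3⟩, h⟩
      rcases Sym2.eq_iff.1 h with ⟨rfl, rfl⟩ | ⟨rfl, rfl⟩
      · exact ⟨⟨h1, h2⟩, h3⟩
      · exact ⟨⟨h2, h1⟩, Ne.symm h3⟩

lemma indep_insE (ω : EdgeIdx n → Bool) (S : Finset (Fin n)) :
    (erGraph n ω).IsIndepSet (S : Set (Fin n)) ↔ ∀ e ∈ insE S, ω e = false := by
  constructor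
  · rintro h ⟨e, he⟩ hes
    simp only [insE, mem_filter, mem_univ, true_and] at hes
    induction e with
    | _ a b =>
      have hab : a ≠ b := by simpa using he
      have := h (hes a (by simp)) (hes b (by simp)) hab
      exact (not_adj_iff ω hab).1 this _ rfl
  · intro h a ha b hb hab
    rw [not_adj_iff ω hab]
    intro e he
    refine h e ?_
    simp only [insE, mem_filter, mem_univ, true_and, he, Sym2.mem_iff]
    rintro x (rfl | rfl)
    · exact ha
    · exact hb

lemma alpha_prob {p : ℝ} (h0 : 0 ≤ p) (h1 : p ≤ 1) (s : ℕ) :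
    Pr p (fun ω => ¬ AlphaLT (erGraph n ω) s) ≤ (n:ℝ) ^ s * (1 - p) ^ (s.choose 2) := by
  refine (Pr_mono h0 h1 (Q := fun ω => ∃ S ∈ powersetCard s (univ : Finset (Fin n)),
    ∀ e ∈ insE S, ω e = false) ?_).trans ?_
  · intro ω h
    unfold AlphaLT at h; push Not at h
    obtain ⟨S, hS, h⟩ := h
    exact ⟨S, by simp [mem_powersetCard, hS], (indep_insE ω S).1 h⟩
  · refine (Pr_union_const h0 h1 _ _ ((1 - p) ^ (s.choose 2)) ?_).trans ?_
    · intro S hS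
      rw [Pr_all_false, insE_card, (mem_powersetCard.1 hS).2]
    · rw [card_powersetCard, card_univ, Fintype.card_fin]
      have : (0:ℝ) ≤ (1-p) ^ (s.choose 2) := pow_nonneg (by linarith) _
      gcongr
      exact_mod_cast Nat.choose_le_pow n s

lemma blk_disj {C : Finset (Fin n)} {v w : Fin n} (hv : v ∉ C) (h : v ≠ w) :
    Disjoint (blk v C) (blk w C) := by
  rw [Finset.disjoint_left]
  intro e he he'
  simp only [blk, mem_filter, mem_univ, true_and] at he he'
  obtain ⟨a, ha, he⟩ := he
  obtain ⟨b, hb, he'⟩ := he'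
  rw [he, Sym2.eq_iff] at he'
  rcases he' with ⟨rfl, rfl⟩ | ⟨rfl, rfl⟩
  · exact h rfl
  · exact hv hb

lemma A1_prob {p : ℝ} (h0 : 0 ≤ p) (h1 : p ≤ 1) (t z M : ℕ) :
    Pr p (fun ω => ¬ PropA1 (erGraph n ω) t z M) ≤
      (n:ℝ) ^ t * ((n:ℝ) ^ z * (1 - p) ^ (z * t + z.choose 2)) ^ M := by
  let F : Finset (Fin n) → Finset (Fin n) → Finset (EdgeIdx n) := fun C I =>
    I.biUnion (fun w => blk w C) ∪ insE I
  have hmem : ∀ C I e, e ∈ F C I → (∃ x ∈ e.1, x ∈ I) ∧ ∀ x ∈ e.1, x ∈ C ∨ x ∈ I := by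
    rintro C I ⟨e, hd⟩ he
    simp only [F, mem_union, mem_biUnion, blk, insE, mem_filter, mem_univ, true_and] at he
    rcases he with ⟨w, hw, u, hu, rfl⟩ | he
    · refine ⟨⟨w, by simp, hw⟩, ?_⟩
      intro x hx
      rcases Sym2.mem_iff.1 hx with rfl | rfl
      · exact Or.inl hu
      · exact Or.inr hw
    · refine ⟨?_, fun x hx => Or.inr (he x hx)⟩
      induction e with
      | _ a b => exact ⟨a, by simp, he a (by simp)⟩
  have hFc : ∀ C I : Finset (Fin n), Disjoint I C → (F C I).card = I.card * C.card + I.card.choose 2 := by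
    intro C I hd
    simp only [F]
    rw [card_union_of_disjoint, insE_card, card_biUnion]
    · congr 1
      rw [Finset.sum_const_nat]
      intro w hw; exact blk_card _ _ (Finset.disjoint_left.1 hd hw)
    · intro v hv w hw hvw; exact blk_disj (Finset.disjoint_left.1 hd hv) hvw
    · rw [Finset.disjoint_left]
      intro e he he'
      simp only [mem_biUnion, blk, insE, mem_filter, mem_univ, true_and] at he he'
      obtain ⟨w, hw, u, hu, he⟩ := he
      exact Finset.disjoint_left.1 hd (he' u (by simp [he])) hu
  have hq : 0 ≤ 1 - p := by linarith
  refine (Pr_mono h0 h1 (Q := fun ω => ∃ x ∈ ((powersetCard t (univ : Finset (Fin n))) ×ˢ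
    (Fintype.piFinset fun _ : Fin M => powersetCard z (univ : Finset (Fin n)))),
    ((∀ a b, a ≠ b → Disjoint (x.2 a) (x.2 b)) ∧ (∀ a, Disjoint (x.2 a) x.1)) ∧
    ∀ e ∈ univ.biUnion (fun a => F x.1 (x.2 a)), ω e = false) ?_).trans ?_
  · intro ω h
    unfold PropA1 at h; push Not at h
    obtain ⟨C, hC, I, hI, hd, hdC, hadj, hind⟩ := h
    refine ⟨(C, I), by simp [mem_powersetCard, hC, hI], ⟨hd, hdC⟩, ?_⟩
    intro e he
    simp only [F, mem_biUnion, mem_univ, true_and, mem_union] at he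
    obtain ⟨a, ⟨w, hw, he⟩ | he⟩ := he
    · exact (nonadj_blk ω w C (Finset.disjoint_left.1 (hdC a) hw)).1
        (fun u hu => hadj a u hu w hw) e he
    · exact (indep_insE ω _).1 (hind a) e he
  · refine (Pr_union_const h0 h1 _ _ (((1 - p) ^ (z * t + z.choose 2)) ^ M) ?_).trans ?_
    · rintro ⟨C, I⟩ hx
      rw [mem_product, Fintype.mem_piFinset] at hx
      simp only [mem_powersetCard, subset_univ, true_and] at hx
      by_cases hd : ((∀ a b, a ≠ b → Disjoint (I a) (I b)) ∧ (∀ a, Disjoint (I a) C))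
      · refine (Pr_mono h0 h1 (fun ω h => h.2)).trans ?_
        rw [Pr_all_false, card_biUnion]
        · simp only [hFc _ _ (hd.2 _), hx.1, hx.2]
          rw [← pow_mul]; simp [mul_comm]
        · intro a _ b _ hab
          rw [Function.onFun, Finset.disjoint_left]
          intro e he he'
          obtain ⟨⟨x, hx, hxa⟩, -⟩ := hmem _ _ _ he
          rcases (hmem _ _ _ he').2 x hx with h | h
          · exact Finset.disjoint_left.1 (hd.2 a) hxa h
          · exact Finset.disjoint_left.1 (hd.1 a b hab) hxa h
      · refine (Pr_mono h0 h1 (Q := fun _ => False) (fun ω h => hd h.1)).trans ?_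
        unfold Pr; simp only [if_false]; rw [Ex_const]; positivity
    · rw [card_product, Fintype.card_piFinset]
      simp only [card_powersetCard, card_univ, Fintype.card_fin, prod_const]
      push_cast
      rw [mul_pow, ← mul_assoc]
      have e1 : (n.choose t : ℝ) ≤ (n:ℝ) ^ t := by exact_mod_cast Nat.choose_le_pow n t
      have e2 : (n.choose z : ℝ) ≤ (n:ℝ) ^ z := by exact_mod_cast Nat.choose_le_pow n z
      gcongr

lemma A2_fixed {p : ℝ} (h0 : 0 ≤ p) (h1 : p ≤ 1) (C U W : Finset (Fin n)) (hCU : Disjoint C U)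
    (hWC : Disjoint W C) (hWU : Disjoint W U) :
    Pr p (fun ω => (∀ w ∈ W, ∀ u ∈ C, ¬ (erGraph n ω).Adj u w) ∧
      ∀ w ∈ W, ((U.filter fun u => (erGraph n ω).Adj u w).card : ℝ) ≤ p * U.card / 10) ≤
    ((1 - p) ^ C.card * Real.exp (- (p * U.card / 2))) ^ W.card := by
  have hq : 0 ≤ 1 - p := by linarith
  let g : Fin n × Fin n → (EdgeIdx n → Bool) → ℝ := fun x ω =>
    if x.2 ∈ C then (if (∀ e ∈ blk x.1 {x.2}, ω e = false) then 1 else 0)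
    else (if (∀ e ∈ blk x.1 {x.2}, ω e = false) then 1 else Real.exp (-2))
  have hg0 : ∀ x ω, 0 ≤ g x ω := by
    intro x ω; simp only [g]; split_ifs <;> positivity
  have hne : ∀ x ∈ W ×ˢ (C ∪ U), x.1 ≠ x.2 := by
    rintro ⟨a, b⟩ hx h
    simp only [mem_product, mem_union] at hx h
    subst h
    rcases hx.2 with h | h
    · exact Finset.disjoint_left.1 hWC hx.1 h
    · exact Finset.disjoint_left.1 hWU hx.1 h
  have hiff : ∀ x ∈ W ×ˢ (C ∪ U), ∀ ω, (∀ e ∈ blk x.1 {x.2}, ω e = false) ↔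
      ¬ (erGraph n ω).Adj x.2 x.1 := by
    intro x hx ω
    rw [← nonadj_blk ω x.1 {x.2} (by simpa using hne x hx)]
    simp
  have hE : Ex p (fun ω => ∏ x ∈ W ×ˢ (C ∪ U), g x ω) =
      ∏ x ∈ W ×ˢ (C ∪ U), Ex p (g x) := by
    apply Ex_prod_indep p _ (fun x => blk x.1 {x.2})
    · rintro ⟨a, b⟩ hx ⟨c, d⟩ hy hxy
      rw [Finset.disjoint_left]
      intro e he he'
      simp only [blk, mem_filter, mem_univ, true_and, mem_singleton, exists_eq_left] at he he'
      rw [he, Sym2.eq_iff] at he'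
      rcases he' with ⟨rfl, rfl⟩ | ⟨rfl, rfl⟩
      · exact hxy rfl
      · simp only [mem_product, mem_union] at hx hy
        rcases hy.2 with h | h
        · exact Finset.disjoint_left.1 hWC hx.1 h
        · exact Finset.disjoint_left.1 hWU hx.1 h
    · intro x hx a b h
      have : (∀ e ∈ blk x.1 {x.2}, a e = false) ↔ (∀ e ∈ blk x.1 {x.2}, b e = false) := by
        constructor <;> intro h' e he
        · rw [← h e he]; exact h' e he
        · rw [h e he]; exact h' e he
      simp only [g, this]
  have hP : ∀ x ∈ W ×ˢ (C ∪ U), Pr p (fun ω => ∀ e ∈ blk x.1 {x.2}, ω e = false) = 1 - p := by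
    intro x hx
    rw [Pr_all_false, blk_card _ _ (by simpa using hne x hx)]; simp
  have hEg : ∀ x ∈ W ×ˢ (C ∪ U), Ex p (g x) ≤ if x.2 ∈ C then 1 - p else
      Real.exp (-(p * (7/10))) := by
    intro x hx
    split_ifs with hc
    · rw [← hP x hx]; simp only [g, hc, if_true]; unfold Pr; refine le_of_eq ?_; congr 1; funext ω; simp only []; congr
    · have : Ex p (g x) = (1 - Real.exp (-2)) * (1 - p) + Real.exp (-2) := by
        rw [← hP x hx]
        unfold Pr
        rw [← Ex_smul]
        refine Eq.trans ?_ (congrArg (_ + ·) (Ex_const (E := EdgeIdx n) p (Real.exp (-2))))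
        rw [← Ex_add]
        congr 1; funext ω
        simp only [g, hc, if_false]
        split_ifs <;> simp
      rw [this]
      have h2 : Real.exp (-2) ≤ 3/10 := by
        rw [Real.exp_neg, inv_le_comm₀ (Real.exp_pos _) (by norm_num)]
        have : Real.exp 2 = Real.exp 1 * Real.exp 1 := by rw [← Real.exp_add]; norm_num
        rw [this]; nlinarith [Real.exp_one_gt_d9]
      have := Real.add_one_le_exp (-(p * (7/10)))
      nlinarith
  have hEle : Ex p (fun ω => ∏ x ∈ W ×ˢ (C ∪ U), g x ω) ≤
      ((1 - p) ^ C.card * Real.exp (-(p * (7/10))) ^ U.card) ^ W.card := by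
    rw [hE]
    refine (Finset.prod_le_prod (fun x hx => Ex_nonneg h0 h1 (hg0 x)) hEg).trans (le_of_eq ?_)
    rw [Finset.prod_product]
    rw [← prod_const (s := W)]
    refine prod_congr rfl fun w _ => ?_
    rw [prod_union hCU]
    congr 1
    · rw [← prod_const]; exact prod_congr rfl fun x hx => by simp [hx]
    · rw [← prod_const]
      exact prod_congr rfl fun x hx => by simp [Finset.disjoint_right.1 hCU hx]
  refine (Pr_le_Ex h0 h1 (f := fun ω => Real.exp (p * U.card / 5) ^ W.card *
    ∏ x ∈ W ×ˢ (C ∪ U), g x ω) ?_ ?_).trans ?_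
  · intro ω; exact mul_nonneg (by positivity) (prod_nonneg fun x _ => hg0 x ω)
  · rintro ω ⟨hC, hU⟩
    rw [Finset.prod_product, ← prod_const, ← prod_mul_distrib]
    have : ∀ w ∈ W, 1 ≤ Real.exp (p * U.card / 5) * ∏ y ∈ C ∪ U, g (w, y) ω := by
      intro w hw
      rw [prod_union hCU]
      have e1 : ∏ y ∈ C, g (w, y) ω = 1 := by
        apply prod_eq_one
        intro y hy
        have := (hiff (w, y) (by simp [hw, hy]) ω).2 (hC w hw y hy)
        simp only [g, hy, if_true]
        rw [if_pos this]
      have e2 : ∏ y ∈ U, g (w, y) ω =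
          Real.exp (-2) ^ (U.filter fun u => (erGraph n ω).Adj u w).card := by
        rw [← prod_const, prod_filter]
        refine prod_congr rfl fun y hy => ?_
        have := (hiff (w, y) (by simp [hw, hy]) ω)
        simp only [g, Finset.disjoint_right.1 hCU hy, if_false]
        simp only [this]
        split_ifs <;> simp_all
      rw [e1, e2, one_mul, ← Real.exp_nat_mul, ← Real.exp_add]
      apply Real.one_le_exp
      have := hU w hw
      linarith
    calc (1:ℝ) = ∏ w ∈ W, 1 := by simp
      _ ≤ _ := prod_le_prod (fun _ _ => zero_le_one) this
  · rw [Ex_smul]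
    refine (mul_le_mul_of_nonneg_left hEle (by positivity)).trans (le_of_eq ?_)
    rw [← mul_pow]
    congr 1
    rw [← mul_assoc, mul_comm (Real.exp _), mul_assoc, ← Real.exp_nat_mul, ← Real.exp_add]
    congr 2; ring

lemma A2_prob {p : ℝ} (h0 : 0 ≤ p) (h1 : p ≤ 1) (hn : 1 ≤ n) (t a b K : ℕ) :
    Pr p (fun ω => ¬ PropA2 (erGraph n ω) p t a b K) ≤
      (b + 1) * (n:ℝ) ^ (t + b) * ((n:ℝ) * ((1 - p) ^ t * Real.exp (- (p * a / 2)))) ^ K := by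
  have hn1 : (1:ℝ) ≤ n := by exact_mod_cast hn
  have hq : 0 ≤ 1 - p := by linarith
  refine (Pr_mono h0 h1 (Q := fun ω => ∃ m ∈ range (b + 1), ∃ x ∈ (powersetCard t (univ : Finset (Fin n)))
    ×ˢ (powersetCard m (univ : Finset (Fin n))) ×ˢ (powersetCard K (univ : Finset (Fin n))),
    (a ≤ m ∧ Disjoint x.1 x.2.1 ∧ Disjoint x.2.2 x.1 ∧ Disjoint x.2.2 x.2.1) ∧
    (∀ w ∈ x.2.2, ∀ u ∈ x.1, ¬ (erGraph n ω).Adj u w) ∧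
      ∀ w ∈ x.2.2, ((x.2.1.filter fun u => (erGraph n ω).Adj u w).card : ℝ) ≤ p * x.2.1.card / 10) ?_).trans ?_
  · intro ω h
    unfold PropA2 at h; push Not at h
    obtain ⟨C, U, W, h1, h2, h3, h4, h5, h6, h7, h8, h9⟩ := h
    exact ⟨U.card, by simp; omega, (C, U, W), by simp [mem_powersetCard, h1, h4], ⟨h2, h5, h6, h7⟩, h8, h9⟩
  · refine (Pr_union_const h0 h1 _ _ ((n:ℝ) ^ (t + b) * ((n:ℝ) * ((1 - p) ^ t * Real.exp (- (p * a / 2)))) ^ K) ?_).trans ?_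
    · intro m hm
      have hmb : m ≤ b := by simpa [Nat.lt_succ_iff] using hm
      refine (Pr_union_const h0 h1 _ _ (((1 - p) ^ t * Real.exp (- (p * a / 2))) ^ K) ?_).trans ?_
      · rintro ⟨C, U, W⟩ hx
        simp only [mem_product, mem_powersetCard, subset_univ, true_and] at hx
        obtain ⟨hC, hU, hW⟩ := hx
        by_cases hd : a ≤ m ∧ Disjoint C U ∧ Disjoint W C ∧ Disjoint W U
        · refine (Pr_mono h0 h1 (fun ω h => h.2)).trans ((A2_fixed h0 h1 C U W hd.2.1 hd.2.2.1 hd.2.2.2).trans ?_)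
          rw [hC, hU, hW]
          have : (a:ℝ) ≤ m := by exact_mod_cast hd.1
          gcongr
        · refine (Pr_mono h0 h1 (Q := fun _ => False) (fun ω h => hd h.1)).trans ?_
          unfold Pr; simp only [if_false]; rw [Ex_const]; positivity
      · rw [card_product, card_product]
        simp only [card_powersetCard, card_univ, Fintype.card_fin]
        push_cast
        have e1 : (n.choose t : ℝ) ≤ (n:ℝ) ^ t := by exact_mod_cast Nat.choose_le_pow n t
        have e2 : (n.choose m : ℝ) ≤ (n:ℝ) ^ b := le_trans (by exact_mod_cast Nat.choose_le_pow n m)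
          (pow_le_pow_right₀ hn1 hmb)
        have e3 : (n.choose K : ℝ) ≤ (n:ℝ) ^ K := by exact_mod_cast Nat.choose_le_pow n K
        rw [mul_pow (n:ℝ), pow_add, ← mul_assoc, ← mul_assoc]
        gcongr
    · rw [card_range]; push_cast; rw [mul_assoc]

end Props

open MeasureTheory Filter Finset

set_option linter.unusedSectionVars false
set_option linter.unusedVariables false

section Janson
open scoped Classical
variable {E : Type*} [Fintype E] [DecidableEq E]

noncomputable def ind (D : Finset E) (ω : E → Bool) : ℝ := if ∀ e ∈ D, ω e = false then 1 else 0

lemma ind_nonneg (D : Finset E) (ω) : 0 ≤ ind D ω := by unfold ind; split_ifs <;> norm_num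
lemma ind_le (D : Finset E) (ω) : ind D ω ≤ 1 := by unfold ind; split_ifs <;> norm_num
lemma ind_mul (D F : Finset E) (ω) : ind D ω * ind F ω = ind (D ∪ F) ω := by
  unfold ind
  by_cases h1 : ∀ e ∈ D, ω e = false <;> by_cases h2 : ∀ e ∈ F, ω e = false
  · rw [if_pos h1, if_pos h2, if_pos, mul_one]
    intro e he; rcases mem_union.1 he with h | h
    · exact h1 e h
    · exact h2 e h
  · rw [if_neg h2, mul_zero, if_neg]; exact fun h => h2 fun e he => h e (mem_union_right _ he)
  · rw [if_neg h1, zero_mul, if_neg]; exact fun h => h1 fun e he => h e (mem_union_left _ he)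
  · rw [if_neg h1, zero_mul, if_neg]; exact fun h => h1 fun e he => h e (mem_union_left _ he)

lemma Ex_ind (p : ℝ) (D : Finset E) : Ex p (ind D) = (1 - p) ^ D.card := by
  rw [← Pr_all_false]; unfold Pr ind; congr 1; funext ω; simp only []; congr

lemma ind_anti (D : Finset E) : Antitone (ind D) := by
  intro a b hab
  unfold ind
  by_cases h : ∀ e ∈ D, b e = false
  · rw [if_pos h, if_pos]
    intro e he; have := hab e; rw [h e he] at this; exact le_bot_iff.1 this
  · rw [if_neg h]; split_ifs <;> norm_num

lemma ind_dep (D : Finset E) (x y : E → Bool) (h : ∀ e ∈ D, x e = y e) : ind D x = ind D y := by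
  unfold ind
  have : (∀ e ∈ D, x e = false) ↔ (∀ e ∈ D, y e = false) := by
    constructor <;> intro h' e he
    · rw [← h e he]; exact h' e he
    · rw [h e he]; exact h' e he
  simp only [this]

lemma one_sub_sum_le {ι : Type*} (s : Finset ι) (f : ι → ℝ) (h0 : ∀ i ∈ s, 0 ≤ f i)
    (h1 : ∀ i ∈ s, f i ≤ 1) : 1 - ∑ i ∈ s, f i ≤ ∏ i ∈ s, (1 - f i) ∧ ∏ i ∈ s, (1 - f i) ≤ 1 ∧
    0 ≤ ∏ i ∈ s, (1 - f i) := by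
  induction s using Finset.induction_on with
  | empty => simp
  | insert a s ha ih =>
    obtain ⟨i1, i2, i3⟩ := ih (fun i hi => h0 i (by simp [hi])) (fun i hi => h1 i (by simp [hi]))
    rw [sum_insert ha, prod_insert ha]
    have a0 := h0 a (by simp)
    have a1 := h1 a (by simp)
    refine ⟨?_, ?_, ?_⟩ <;> nlinarith

lemma janson_aux {ι : Type*} {p x : ℝ} (h0 : 0 ≤ p) (h1 : p ≤ 1) (x0 : 0 ≤ x) (x1 : x ≤ 1)
    (s : Finset ι) (D : ι → Finset E) :
    Ex p (fun ω => ∏ i ∈ s, (1 - x * ind (D i) ω)) ≤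
      Real.exp (-(x * ∑ i ∈ s, (1 - p) ^ (D i).card) + x ^ 2 *
        ∑ i ∈ s, ∑ j ∈ s.filter (fun j => ¬ Disjoint (D j) (D i)), (1 - p) ^ (D j ∪ D i).card) := by
  have hq : 0 ≤ 1 - p := by linarith
  have xi0 : ∀ D ω, 0 ≤ x * ind (E := E) D ω := fun D ω => mul_nonneg x0 (ind_nonneg _ _)
  have xi1 : ∀ D ω, x * ind (E := E) D ω ≤ 1 := fun D ω => by
    nlinarith [ind_le D ω, ind_nonneg D ω]
  induction s using Finset.induction_on with
  | empty => simp [Ex_const]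
  | insert a s ha ih =>
    set N := s.filter (fun j => ¬ Disjoint (D j) (D a)) with hN
    set R := s.filter (fun j => Disjoint (D j) (D a)) with hR
    let A : (E → Bool) → ℝ := fun ω => ∏ i ∈ R, (1 - x * ind (D i) ω)
    let Z : (E → Bool) → ℝ := fun ω => ∏ i ∈ s, (1 - x * ind (D i) ω)
    have hA0 : ∀ ω, 0 ≤ A ω := fun ω =>
      (one_sub_sum_le R (fun i => x * ind (D i) ω) (fun _ _ => xi0 _ _) (fun _ _ => xi1 _ _)).2.2
    have hZA : ∀ ω, Z ω = A ω * ∏ i ∈ N, (1 - x * ind (D i) ω) := fun ω => by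
      simp only [Z, A, hN, hR]; rw [prod_filter_mul_prod_filter_not]
    have hZ0 : ∀ ω, 0 ≤ Z ω := fun ω =>
      (one_sub_sum_le s (fun i => x * ind (D i) ω) (fun _ _ => xi0 _ _) (fun _ _ => xi1 _ _)).2.2
    have hB := fun ω => one_sub_sum_le N (fun i => x * ind (D i) ω) (fun _ _ => xi0 _ _) (fun _ _ => xi1 _ _)
    have hZleA : Ex p Z ≤ Ex p A := Ex_mono h0 h1 fun ω => by
      rw [hZA]; nlinarith [hA0 ω, (hB ω).2.1]
    have hEA0 : 0 ≤ Ex p A := Ex_nonneg h0 h1 hA0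
    have hEZ0 : 0 ≤ Ex p Z := Ex_nonneg h0 h1 hZ0
    have hAmono : Monotone A := by
      intro u v huv
      refine prod_le_prod (fun i _ => by linarith [xi1 (D i) u]) fun i _ => ?_
      have := ind_anti (D i) huv
      nlinarith
    have i1 : Ex p (fun ω => ind (D a) ω * A ω) = (1 - p) ^ (D a).card * Ex p A := by
      rw [← Ex_ind]
      apply Ex_mul_indep p (D a) (ind_dep _)
      intro u v huv
      refine prod_congr rfl fun i hi => ?_
      rw [ind_dep (D i) u v]
      intro e he
      exact huv e (Finset.disjoint_left.1 (mem_filter.1 hi).2 he)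
    have i2 : ∀ j, Ex p (fun ω => ind (D j ∪ D a) ω * A ω) ≤ (1 - p) ^ (D j ∪ D a).card * Ex p A := by
      intro j
      rw [← Ex_ind]
      exact Ex_harris h0 h1 (ind_nonneg _) (ind_le _) hA0 (ind_anti _) hAmono
    set Da := ∑ j ∈ N, (1 - p) ^ (D j ∪ D a).card with hDa
    have i3 : Ex p A * ((1 - p) ^ (D a).card - x * Da) ≤ Ex p (fun ω => ind (D a) ω * Z ω) := by
      have : Ex p (fun ω => ind (D a) ω * A ω - x * ∑ j ∈ N, ind (D j ∪ D a) ω * A ω) ≤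
          Ex p (fun ω => ind (D a) ω * Z ω) := Ex_mono h0 h1 fun ω => by
        have hb := (hB ω).1
        have hia := ind_nonneg (D a) ω
        have e : x * ∑ j ∈ N, ind (D j ∪ D a) ω * A ω =
            (ind (D a) ω * A ω) * ∑ j ∈ N, x * ind (D j) ω := by
          rw [mul_sum, mul_sum]
          refine sum_congr rfl fun j _ => ?_
          rw [← ind_mul]; ring
        rw [e, hZA]
        nlinarith [mul_nonneg hia (hA0 ω)]
      refine le_trans ?_ this
      rw [Ex_sub, Ex_smul, Ex_sum, i1, mul_sub, mul_comm (Ex p A)]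
      have : ∑ j ∈ N, Ex p (fun ω => ind (D j ∪ D a) ω * A ω) ≤ Da * Ex p A := by
        rw [hDa, sum_mul]; exact sum_le_sum fun j _ => i2 j
      nlinarith
    have hDa0 : 0 ≤ Da := sum_nonneg fun j _ => pow_nonneg hq _
    have e1 : Ex p (fun ω => ∏ i ∈ insert a s, (1 - x * ind (D i) ω)) =
        Ex p Z - x * Ex p (fun ω => ind (D a) ω * Z ω) := by
      rw [← Ex_smul, ← Ex_sub]; congr 1; funext ω
      rw [prod_insert ha]; simp only [Z]; ring
    have i4 : Ex p (fun ω => ∏ i ∈ insert a s, (1 - x * ind (D i) ω)) ≤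
        Ex p Z * Real.exp (- (x * (1 - p) ^ (D a).card) + x ^ 2 * Da) := by
      rw [e1]
      have hexp := Real.add_one_le_exp (- (x * (1 - p) ^ (D a).card) + x ^ 2 * Da)
      by_cases hs : 0 ≤ (1 - p) ^ (D a).card - x * Da
      · have : Ex p Z * ((1 - p) ^ (D a).card - x * Da) ≤ Ex p (fun ω => ind (D a) ω * Z ω) :=
          le_trans (mul_le_mul_of_nonneg_right hZleA hs) i3
        nlinarith [mul_le_mul_of_nonneg_left hexp hEZ0, mul_le_mul_of_nonneg_left this x0]
      · have h3 : 0 ≤ Ex p (fun ω => ind (D a) ω * Z ω) :=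
          Ex_nonneg h0 h1 fun ω => mul_nonneg (ind_nonneg _ _) (hZ0 ω)
        have h4 : 1 ≤ Real.exp (- (x * (1 - p) ^ (D a).card) + x ^ 2 * Da) := by
          apply Real.one_le_exp; push Not at hs; nlinarith
        nlinarith [mul_nonneg x0 h3]
    refine i4.trans ((mul_le_mul_of_nonneg_right ih (Real.exp_pos _).le).trans ?_)
    rw [← Real.exp_add]
    apply Real.exp_le_exp.2
    rw [sum_insert ha, sum_insert ha]
    have g1 : Da ≤ ∑ j ∈ (insert a s).filter (fun j => ¬ Disjoint (D j) (D a)), (1 - p) ^ (D j ∪ D a).card :=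
      sum_le_sum_of_subset_of_nonneg (filter_subset_filter _ (subset_insert _ _))
        fun _ _ _ => pow_nonneg hq _
    have g2 : ∑ i ∈ s, ∑ j ∈ s.filter (fun j => ¬ Disjoint (D j) (D i)), (1 - p) ^ (D j ∪ D i).card ≤
      ∑ i ∈ s, ∑ j ∈ (insert a s).filter (fun j => ¬ Disjoint (D j) (D i)), (1 - p) ^ (D j ∪ D i).card :=
      sum_le_sum fun i _ => sum_le_sum_of_subset_of_nonneg (filter_subset_filter _ (subset_insert _ _))
        fun _ _ _ => pow_nonneg hq _
    nlinarith [sq_nonneg x]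

lemma janson {ι : Type*} {p Dl : ℝ} (h0 : 0 ≤ p) (h1 : p ≤ 1)
    (s : Finset ι) (D : ι → Finset E) (hDl0 : 0 < Dl)
    (hμ : ∑ i ∈ s, (1 - p) ^ (D i).card ≤ 2 * Dl)
    (hDl : ∑ i ∈ s, ∑ j ∈ s.filter (fun j => ¬ Disjoint (D j) (D i)), (1 - p) ^ (D j ∪ D i).card ≤ Dl) :
    Pr p (fun ω => ∀ i ∈ s, ¬ ∀ e ∈ D i, ω e = false) ≤
      Real.exp (-((∑ i ∈ s, (1 - p) ^ (D i).card) ^ 2 / (4 * Dl))) := by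
  set μ := ∑ i ∈ s, (1 - p) ^ (D i).card with hμd
  have hq : 0 ≤ 1 - p := by linarith
  have μ0 : 0 ≤ μ := sum_nonneg fun _ _ => pow_nonneg hq _
  have x0 : 0 ≤ μ / (2 * Dl) := by positivity
  have x1 : μ / (2 * Dl) ≤ 1 := by rw [div_le_one (by positivity)]; exact hμ
  have xi0 : ∀ D ω, 0 ≤ μ / (2 * Dl) * ind (E := E) D ω := fun D ω => mul_nonneg x0 (ind_nonneg _ _)
  have xi1 : ∀ D ω, μ / (2 * Dl) * ind (E := E) D ω ≤ 1 := fun D ω => by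
    nlinarith [ind_le D ω, ind_nonneg D ω]
  refine (Pr_le_Ex h0 h1 (f := fun ω => ∏ i ∈ s, (1 - μ / (2 * Dl) * ind (D i) ω)) ?_ ?_).trans
    ((janson_aux h0 h1 x0 x1 s D).trans ?_)
  · exact fun ω => (one_sub_sum_le s (fun i => μ / (2 * Dl) * ind (D i) ω) (fun _ _ => xi0 _ _) (fun _ _ => xi1 _ _)).2.2
  · intro ω h
    apply le_of_eq; symm
    apply prod_eq_one
    intro i hi
    have := h i hi
    unfold ind; rw [if_neg this]; ring
  · apply Real.exp_le_exp.2
    rw [← hμd]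
    have := mul_le_mul_of_nonneg_left hDl (sq_nonneg (μ / (2 * Dl)))
    have e : -(μ / (2 * Dl) * μ) + (μ / (2 * Dl)) ^ 2 * Dl = -(μ ^ 2 / (4 * Dl)) := by
      field_simp; ring
    linarith

end Janson

section IndepSets
open scoped Classical
variable {n : ℕ}

lemma choose_ratio (r : ℕ) : ∀ m s : ℕ, r ≤ s → s ≤ m →
    ((m - r).choose (s - r) : ℝ) * m ^ r ≤ m.choose s * s ^ r := by
  induction r with
  | zero => intro m s _ _; simp
  | succ r ih =>
    intro m s hr hs
    have h1 := ih m s (by omega) hs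
    obtain ⟨b, rfl⟩ : ∃ b, s = b + (r + 1) := ⟨s - (r+1), by omega⟩
    obtain ⟨a, rfl⟩ : ∃ a, m = a + (r + 1) := ⟨m - (r+1), by omega⟩
    have e1 : a + (r + 1) - r = a + 1 := by omega
    have e2 : b + (r + 1) - r = b + 1 := by omega
    have e3 : a + (r + 1) - (r+1) = a := by omega
    have e4 : b + (r + 1) - (r+1) = b := by omega
    rw [e1, e2] at h1
    rw [e3, e4]
    have h2 : (a + 1 : ℝ) * a.choose b = (a+1).choose (b+1) * (b+1) := by
      exact_mod_cast Nat.add_one_mul_choose_eq a b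
    have hab : (b:ℝ) ≤ a := by exact_mod_cast (by omega : b ≤ a)
    push_cast at h1 ⊢
    set X := ((a+1).choose (b+1) : ℝ)
    set Y := (a.choose b : ℝ)
    have Y0 : 0 ≤ Y := Nat.cast_nonneg _
    have X0 : 0 ≤ X := Nat.cast_nonneg _
    have key : Y * (a + (r + 1)) ≤ X * (b + (r + 1)) := by
      have hXY : Y ≤ X := by
        have : a.choose b ≤ (a+1).choose (b+1) := by rw [Nat.choose_succ_succ]; omega
        simp only [X, Y]; exact_mod_cast this
      nlinarith [Nat.cast_nonneg (α := ℝ) r]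
    have m0 : (0:ℝ) ≤ (a + (r+1)) ^ r := by positivity
    calc Y * ((a:ℝ) + (r + 1)) ^ (r + 1) = (Y * (a + (r + 1))) * (a + (r+1)) ^ r := by ring
      _ ≤ (X * (b + (r + 1))) * (a + (r+1)) ^ r := by gcongr
      _ = (X * (a + (r+1)) ^ r) * (b + (r + 1)) := by ring
      _ ≤ ((a + (r + 1)).choose (b + (r + 1)) * (b + (r+1)) ^ r) * (b + (r + 1)) := by gcongr
      _ = _ := by ring

lemma card_super (T R : Finset (Fin n)) (s : ℕ) (hR : R ⊆ T) :
    ((powersetCard s T).filter (fun S => R ⊆ S)).card ≤ (T.card - R.card).choose (s - R.card) := by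
  rw [← card_sdiff_of_subset hR, ← card_powersetCard]
  refine card_le_card_of_injOn (fun S => S \ R) ?_ ?_
  · intro S hS
    have hS := mem_filter.1 (mem_coe.1 hS)
    rw [mem_powersetCard] at hS
    refine mem_coe.2 (mem_powersetCard.2 ?_)
    exact ⟨sdiff_subset_sdiff hS.1.1 le_rfl, by rw [card_sdiff_of_subset hS.2, hS.1.2]⟩
  · intro S hS S' hS' h
    have hS := mem_filter.1 (mem_coe.1 hS)
    have hS' := mem_filter.1 (mem_coe.1 hS')
    simp only at h
    rw [← sdiff_union_of_subset hS.2, h, sdiff_union_of_subset hS'.2]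

noncomputable def Phi (q : ℝ) (m s : ℕ) : ℝ :=
  ∑ i ∈ (range (s+1)).filter (2 ≤ ·), ((s:ℝ)^2 / m) ^ i * (q ^ (i.choose 2))⁻¹

lemma pair_sum {q : ℝ} (hq : 0 < q) (T S : Finset (Fin n)) (m s : ℕ) (hT : T.card = m)
    (hS : S ∈ powersetCard s T) (hm : 1 ≤ m) :
    ∑ S' ∈ (powersetCard s T).filter (fun S' => 2 ≤ (S' ∩ S).card), (q ^ ((S' ∩ S).card.choose 2))⁻¹ ≤
      (m.choose s : ℝ) * Phi q m s := by
  obtain ⟨hST, hSc⟩ := mem_powersetCard.1 hS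
  have hsm : s ≤ m := by rw [← hSc, ← hT]; exact card_le_card hST
  let g : ℕ → ℝ := fun r => if 2 ≤ r then (q ^ (r.choose 2))⁻¹ else 0
  have g0 : ∀ r, 0 ≤ g r := fun r => by simp only [g]; split_ifs <;> positivity
  have hm0 : (0:ℝ) < m := by exact_mod_cast hm
  calc ∑ S' ∈ (powersetCard s T).filter (fun S' => 2 ≤ (S' ∩ S).card), (q ^ ((S' ∩ S).card.choose 2))⁻¹
      = ∑ S' ∈ powersetCard s T, g (S' ∩ S).card := by rw [sum_filter]
    _ ≤ ∑ S' ∈ powersetCard s T, ∑ R ∈ S.powerset, if R ⊆ S' then g R.card else 0 := by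
        refine sum_le_sum fun S' _ => ?_
        have := single_le_sum (f := fun R => if R ⊆ S' then g R.card else 0) (s := S.powerset)
          (fun R _ => by split_ifs; exacts [g0 _, le_rfl]) (mem_powerset.2 (inter_subset_right : S' ∩ S ⊆ S))
        simpa using this
    _ = ∑ R ∈ S.powerset, ((powersetCard s T).filter (fun S' => R ⊆ S')).card * g R.card := by
        rw [sum_comm]
        refine sum_congr rfl fun R _ => ?_
        rw [← sum_filter, sum_const, nsmul_eq_mul]
    _ ≤ ∑ R ∈ S.powerset, (m.choose s * (s:ℝ) ^ R.card / m ^ R.card) * g R.card := by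
        refine sum_le_sum fun R hR => mul_le_mul_of_nonneg_right ?_ (g0 _)
        have hRS := mem_powerset.1 hR
        rw [le_div_iff₀ (by positivity)]
        have h1 : ((((powersetCard s T).filter (fun S' => R ⊆ S')).card : ℕ) : ℝ) ≤
          ((m - R.card).choose (s - R.card) : ℝ) := by
          have := card_super T R s (hRS.trans hST); rw [hT] at this; exact_mod_cast this
        exact (mul_le_mul_of_nonneg_right h1 (by positivity)).trans
          (choose_ratio R.card m s (by rw [← hSc]; exact card_le_card hRS) hsm)
    _ = ∑ i ∈ range (s+1), s.choose i • ((m.choose s * (s:ℝ) ^ i / m ^ i) * g i) := by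
        rw [sum_powerset_apply_card (fun i => (m.choose s * (s:ℝ) ^ i / m ^ i) * g i), hSc]
    _ ≤ ∑ i ∈ range (s+1), (m.choose s : ℝ) * ((((s:ℝ)^2 / m) ^ i) * g i) := by
        refine sum_le_sum fun i _ => ?_
        rw [nsmul_eq_mul]
        have : (s.choose i : ℝ) ≤ (s:ℝ) ^ i := by exact_mod_cast Nat.choose_le_pow s i
        calc (s.choose i : ℝ) * ((m.choose s * (s:ℝ) ^ i / m ^ i) * g i)
            ≤ (s:ℝ) ^ i * ((m.choose s * (s:ℝ) ^ i / m ^ i) * g i) := by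
              have := g0 i
              gcongr
          _ = _ := by rw [div_pow]; ring
    _ = _ := by
        rw [← mul_sum, Phi, sum_filter]
        congr 1
        refine sum_congr rfl fun i _ => ?_
        simp only [g]; split_ifs <;> simp

def PropD {V : Type*} (G : SimpleGraph V) (m s : ℕ) : Prop :=
  ∀ T : Finset V, T.card = m → ∃ S ⊆ T, S.card = s ∧ G.IsIndepSet (S : Set V)

lemma D_prob {p : ℝ} (h0 : 0 ≤ p) (h1 : p < 1) (m s : ℕ) (hs2 : 2 ≤ s) (hsm : s ≤ m) :
    Pr p (fun ω => ¬ PropD (erGraph n ω) m s) ≤ (2:ℝ) ^ n * Real.exp (-(1 / (4 * Phi (1-p) m s))) := by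
  have hq : 0 < 1 - p := by linarith
  refine (Pr_mono h0 h1.le (Q := fun ω => ∃ T ∈ powersetCard m (univ : Finset (Fin n)),
    ∀ S ∈ powersetCard s T, ¬ ∀ e ∈ insE S, ω e = false) ?_).trans ?_
  · intro ω h
    unfold PropD at h; push Not at h
    obtain ⟨T, hT, h⟩ := h
    refine ⟨T, by simp [mem_powersetCard, hT], fun S hS hc => ?_⟩
    obtain ⟨h2, h3⟩ := mem_powersetCard.1 hS
    exact h S h2 h3 ((indep_insE ω S).2 hc)
  · refine (Pr_union_const h0 h1.le _ _ (Real.exp (-(1 / (4 * Phi (1-p) m s)))) ?_).trans ?_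
    · intro T hT
      have hTc := (mem_powersetCard.1 hT).2
      set q := 1 - p with hqd
      set N := (m.choose s : ℝ) with hN
      have hN0 : 0 < N := by rw [hN]; exact_mod_cast Nat.choose_pos hsm
      have hμ : ∑ S ∈ powersetCard s T, q ^ (insE S).card = N * q ^ (s.choose 2) := by
        rw [sum_congr rfl (fun S hS => by rw [insE_card, (mem_powersetCard.1 hS).2] :
          ∀ S ∈ powersetCard s T, q ^ (insE S).card = q ^ (s.choose 2))]
        rw [sum_const, card_powersetCard, hTc, nsmul_eq_mul]
      have hm1 : 1 ≤ m := by omega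
      have hΦ : 0 < Phi q m s := by
        have hm0 : (0:ℝ) < m := by exact_mod_cast hm1
        have hs0 : (0:ℝ) < s := by exact_mod_cast (by omega : 0 < s)
        unfold Phi
        apply sum_pos
        · intro i _; positivity
        · exact ⟨2, by simp; omega⟩
      have hinter : ∀ S S' : Finset (Fin n), insE S' ∩ insE S = insE (S' ∩ S) := by
        intro S S'; ext e
        simp only [insE, mem_inter, mem_filter, mem_univ, true_and]
        exact ⟨fun h x hx => ⟨h.1 x hx, h.2 x hx⟩, fun h => ⟨fun x hx => (h x hx).1, fun x hx => (h x hx).2⟩⟩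
      have hdis : ∀ S S' : Finset (Fin n), ¬ Disjoint (insE S') (insE S) ↔ 2 ≤ (S' ∩ S).card := by
        intro S S'
        rw [Finset.disjoint_iff_inter_eq_empty, hinter, ← card_eq_zero, insE_card, Nat.choose_eq_zero_iff]
        omega
      have hΔ : ∑ S ∈ powersetCard s T, ∑ S' ∈ (powersetCard s T).filter
          (fun S' => ¬ Disjoint (insE S') (insE S)), q ^ (insE S' ∪ insE S).card ≤
          (N * q ^ (s.choose 2)) ^ 2 * Phi q m s := by
        have : ∀ S ∈ powersetCard s T, ∑ S' ∈ (powersetCard s T).filter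
          (fun S' => ¬ Disjoint (insE S') (insE S)), q ^ (insE S' ∪ insE S).card ≤
            q ^ (s.choose 2) * q ^ (s.choose 2) * (N * Phi q m s) := by
          intro S hS
          refine le_trans (le_of_eq ?_) (mul_le_mul_of_nonneg_left
            (pair_sum hq T S m s hTc hS hm1) (by positivity))
          rw [mul_sum]
          refine sum_congr (filter_congr fun S' _ => hdis S S') fun S' hS' => ?_
          have hc := card_union_add_card_inter (insE S') (insE S)
          rw [hinter, insE_card, insE_card, insE_card, (mem_powersetCard.1 hS).2,
            (mem_powersetCard.1 (mem_filter.1 hS').1).2] at hc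
          rw [← pow_add, ← hc, pow_add]
          field_simp
        refine (sum_le_sum this).trans (le_of_eq ?_)
        rw [sum_const, card_powersetCard, hTc, nsmul_eq_mul]; ring
      have hDl0 : 0 < (N * q ^ (s.choose 2)) ^ 2 * Phi q m s := by positivity
      have := janson h0 h1.le (powersetCard s T) insE hDl0 ?_ ?_
      · refine this.trans (le_of_eq ?_)
        rw [← hqd, hμ]
        congr 2
        field_simp
      · rw [← hqd]
        have hle : ∑ S ∈ powersetCard s T, q ^ (insE S).card ≤ ∑ S ∈ powersetCard s T,
          ∑ S' ∈ (powersetCard s T).filter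
          (fun S' => ¬ Disjoint (insE S') (insE S)), q ^ (insE S' ∪ insE S).card := by
          refine sum_le_sum fun S hS => ?_
          have := single_le_sum (f := fun S' => q ^ (insE S' ∪ insE S).card)
            (s := (powersetCard s T).filter (fun S' => ¬ Disjoint (insE S') (insE S)))
            (fun _ _ => by positivity) (a := S) (by
              rw [mem_filter, hdis, inter_self, (mem_powersetCard.1 hS).2]; exact ⟨hS, hs2⟩)
          simpa using this
        linarith
      · exact hΔ
    · gcongr
      rw [card_powersetCard, card_univ, Fintype.card_fin]
      exact_mod_cast Nat.choose_le_two_pow n m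

lemma D_color {V : Type*} [Fintype V] (G : SimpleGraph V) (m s : ℕ) (hs : 1 ≤ s) (hsm : s ≤ m)
    (hD : PropD G m s) (N : ℕ) : ∀ T : Finset V, T.card = N →
    ∃ c : V → ℕ, (∀ u ∈ T, c u < N / s + m) ∧ ∀ u ∈ T, ∀ v ∈ T, G.Adj u v → c u ≠ c v := by
  induction N using Nat.strong_induction_on with
  | _ N ih =>
    intro T hT
    by_cases hlt : N < m
    · refine ⟨fun u => if h : u ∈ T then (T.equivFin ⟨u, h⟩ : ℕ) else 0, ?_, ?_⟩
      · intro u hu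
        simp only [hu, dif_pos]
        have := (T.equivFin ⟨u, hu⟩).2
        have h3 : 0 ≤ N / s := Nat.zero_le _
        generalize N / s = y at *
        omega
      · intro u hu v hv hadj h
        simp only [hu, hv, dif_pos] at h
        have := T.equivFin.injective (Fin.ext h)
        simp only [Subtype.mk.injEq] at this
        exact G.ne_of_adj hadj this
    · obtain ⟨T', hT', hc'⟩ := exists_subset_card_eq (show m ≤ T.card by omega)
      obtain ⟨S, hST', hSc, hSi⟩ := hD T' hc'
      have hST := hST'.trans hT'
      obtain ⟨c, h1, h2⟩ := ih (N - s) (by omega) (T \ S) (by rw [card_sdiff_of_subset hST, hT, hSc])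
      have hdiv : N / s = (N - s) / s + 1 := by
        rw [← Nat.add_div_right _ (by omega)]; congr 1; omega
      refine ⟨fun u => if u ∈ S then (N - s) / s + m else c u, ?_, ?_⟩
      · intro u hu
        by_cases h : u ∈ S
        · simp only [h, if_true]; omega
        · simp only [h, if_false]
          have := h1 u (mem_sdiff.2 ⟨hu, h⟩); omega
      · intro u hu v hv hadj
        by_cases hu' : u ∈ S <;> by_cases hv' : v ∈ S
        · exact absurd hadj (hSi hu' hv' (G.ne_of_adj hadj))
        · simp only [hu', hv', if_true, if_false]
          have := h1 v (mem_sdiff.2 ⟨hv, hv'⟩); omega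
        · simp only [hu', hv', if_true, if_false]
          have := h1 u (mem_sdiff.2 ⟨hu, hu'⟩); omega
        · simp only [hu', hv', if_false]
          exact h2 u (mem_sdiff.2 ⟨hu, hu'⟩) v (mem_sdiff.2 ⟨hv, hv'⟩) hadj

lemma D_chrom {V : Type*} [Fintype V] (G : SimpleGraph V) (m s : ℕ) (hs : 1 ≤ s) (hsm : s ≤ m)
    (hD : PropD G m s) : G.chromaticNumber.toNat ≤ Fintype.card V / s + m := by
  obtain ⟨c, h1, h2⟩ := D_color G m s hs hsm hD _ univ rfl
  rw [card_univ] at h1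
  have : G.Colorable (Fintype.card V / s + m) :=
    ⟨SimpleGraph.Coloring.mk (fun u => ⟨c u, h1 u (mem_univ _)⟩) (by
      intro u v hadj h
      exact h2 u (mem_univ _) v (mem_univ _) hadj (by simpa using h))⟩
  exact ENat.toNat_le_of_le_natCast this.chromaticNumber_le

lemma alpha_chrom {V : Type*} [Fintype V] (G : SimpleGraph V) (s : ℕ) (hα : AlphaLT G s) :
    Fintype.card V ≤ G.chromaticNumber.toNat * s := by
  have hcol : G.Colorable G.chromaticNumber.toNat := by
    have hne : G.chromaticNumber ≠ ⊤ := SimpleGraph.chromaticNumber_ne_top_iff_exists.2 ⟨_, G.colorable_of_fintype⟩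
    exact SimpleGraph.chromaticNumber_le_iff_colorable.1 (by rw [ENat.natCast_toNat hne])
  obtain ⟨C⟩ := hcol
  by_contra hlt
  push Not at hlt
  have : Fintype.card (Fin G.chromaticNumber.toNat) * s < Fintype.card V := by simpa using hlt
  obtain ⟨c, hc⟩ := Fintype.exists_lt_card_fiber_of_mul_lt_card C this
  obtain ⟨S, hS, hSc⟩ := exists_subset_card_eq hc.le
  refine hα S hSc ?_
  intro u hu v hv huv hadj
  have e1 := (mem_filter.1 (hS hu)).2
  have e2 := (mem_filter.1 (hS hv)).2
  exact C.valid hadj (e1.trans e2.symm)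

end IndepSets

open MeasureTheory Filter Finset

set_option linter.unusedSectionVars false
set_option linter.unusedVariables false

section RunSec
open scoped Classical
variable {V : Type*} [Fintype V] {k : ℕ}

structure Run (G : SimpleGraph V) (f : ℕ → V → Option (Fin k)) (mv : ℕ → V × Fin k) (T : ℕ) : Prop where
  zero : ∀ v, f 0 v = none
  legal : ∀ t < T, LegalMove G (f t) (mv t).1 (mv t).2
  step : ∀ t < T, f (t+1) = Function.update (f t) (mv t).1 (some (mv t).2)

variable {G : SimpleGraph V} {f : ℕ → V → Option (Fin k)} {mv : ℕ → V × Fin k} {T : ℕ}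

namespace Run

lemma step_eq (R : Run G f mv T) {t : ℕ} (ht : t < T) (v : V) :
    f (t+1) v = if v = (mv t).1 then some (mv t).2 else f t v := by
  rw [R.step t ht, Function.update_apply]

lemma mono (R : Run G f mv T) {s t : ℕ} (hst : s ≤ t) (ht : t ≤ T) {v : V} {c : Fin k}
    (h : f s v = some c) : f t v = some c := by
  induction t, hst using Nat.le_induction with
  | base => exact h
  | succ t hst ih =>
    have ih := ih (by omega)
    rw [R.step_eq (by omega)]
    split_ifs with hv
    · subst hv; rw [(R.legal t (by omega)).1] at ih; cases ih
    · exact ih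

lemma none_of (R : Run G f mv T) {s t : ℕ} (hst : s ≤ t) (ht : t ≤ T) {v : V}
    (h : f t v = none) : f s v = none := by
  cases hs : f s v with
  | none => rfl
  | some c => rw [R.mono hst ht hs] at h; cases h

lemma legal_anti (R : Run G f mv T) {s t : ℕ} (hst : s ≤ t) (ht : t ≤ T) {v : V} {c : Fin k}
    (h : LegalMove G (f t) v c) : LegalMove G (f s) v c :=
  ⟨R.none_of hst ht h.1, fun u hu hc => h.2 u hu (R.mono hst ht hc)⟩

lemma card_dom (R : Run G f mv T) {t : ℕ} (ht : t ≤ T) :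
    (univ.filter fun u => f t u ≠ none).card = t := by
  induction t with
  | zero => simp [R.zero]
  | succ t ih =>
    have hl := (R.legal t (by omega)).1
    have : (univ.filter fun u => f (t+1) u ≠ none) =
        insert (mv t).1 (univ.filter fun u => f t u ≠ none) := by
      ext u
      simp only [mem_filter, mem_univ, true_and, mem_insert, R.step_eq (show t < T by omega) u]
      by_cases hu : u = (mv t).1 <;> simp [hu]
    rw [this, card_insert_of_notMem (by simp [hl]), ih (by omega)]

lemma proper (R : Run G f mv T) {t : ℕ} (ht : t ≤ T) : ∀ u v c, G.Adj u v → f t u = some c →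
    f t v ≠ some c := by
  induction t with
  | zero => intro u v c _ h; rw [R.zero] at h; cases h
  | succ t ih =>
    intro u v c hadj h1 h2
    have hl := (R.legal t (by omega)).2
    rw [R.step_eq (by omega)] at h1 h2
    split_ifs at h1 h2 with hu hv hv
    · exact G.ne_of_adj hadj (hu.trans hv.symm)
    · rw [hu] at hadj
      refine hl v hadj.symm ?_
      rw [h2]; exact h1.symm
    · rw [hv] at hadj
      refine hl u hadj ?_
      rw [h1]; exact h2.symm
    · exact ih (by omega) u v c hadj h1 h2

lemma indep (R : Run G f mv T) {t : ℕ} (ht : t ≤ T) (i : Fin k) :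
    G.IsIndepSet (cls (f t) i : Set V) := by
  intro u hu v hv _ hadj
  simp only [cls, coe_filter, mem_univ, true_and, Set.mem_ofPred_eq] at hu hv
  exact R.proper ht u v i hadj hu hv

lemma cls_mono (R : Run G f mv T) {s t : ℕ} (hst : s ≤ t) (ht : t ≤ T) (i : Fin k) :
    cls (f s) i ⊆ cls (f t) i := by
  intro u hu
  simp only [cls, mem_filter, mem_univ, true_and] at hu ⊢
  exact R.mono hst ht hu

lemma cls_step (R : Run G f mv T) {t : ℕ} (ht : t < T) (i : Fin k) :
    cls (f (t+1)) i = if i = (mv t).2 then insert (mv t).1 (cls (f t) i) else cls (f t) i := by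
  have hl := (R.legal t ht).1
  ext u
  simp only [cls, mem_filter, mem_univ, true_and, R.step_eq ht u]
  by_cases hu : u = (mv t).1
  · subst hu
    by_cases hi : i = (mv t).2
    · simp [hi]
    · simp [hi, hl, Ne.symm hi]
  · by_cases hi : i = (mv t).2 <;> simp [hu, hi]

lemma cls_card_step (R : Run G f mv T) {t : ℕ} (ht : t < T) (i : Fin k) :
    (cls (f (t+1)) i).card = (cls (f t) i).card + if i = (mv t).2 then 1 else 0 := by
  rw [R.cls_step ht]
  split_ifs with hi
  · rw [card_insert_of_notMem]
    simp [cls, (R.legal t ht).1]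
  · rfl

lemma cls_lt (R : Run G f mv T) {s : ℕ} (hα : AlphaLT G s) {t : ℕ} (ht : t ≤ T) (i : Fin k) :
    (cls (f t) i).card < s := by
  by_contra hc
  push Not at hc
  obtain ⟨S, hS, hSc⟩ := exists_subset_card_eq hc
  exact hα S hSc ((R.indep ht i).mono (by exact_mod_cast hS))

lemma sum_cls (R : Run G f mv T) {t : ℕ} (ht : t ≤ T) : ∑ i, (cls (f t) i).card = t := by
  refine Eq.trans ?_ (R.card_dom ht)
  rw [← card_biUnion]
  · congr 1; ext u
    simp only [mem_biUnion, mem_univ, true_and, cls, mem_filter]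
    rw [Option.ne_none_iff_exists']
  · intro a _ b _ hab
    rw [Function.onFun, Finset.disjoint_left]
    intro u h1 h2
    simp only [cls, mem_filter, mem_univ, true_and] at h1 h2
    rw [h1] at h2; exact hab (by simpa using h2)

end Run

/-- live color -/
def live (G : SimpleGraph V) (g : V → Option (Fin k)) (i : Fin k) : Prop := ∃ v, LegalMove G g v i

noncomputable def lev (G : SimpleGraph V) (g : V → Option (Fin k)) : ℕ :=
  sInf {c | ∃ i, live G g i ∧ (cls g i).card = c}

noncomputable def potV (Q h : ℕ) (g : V → Option (Fin k)) : ℕ := ∑ i, (h + Q - (cls g i).card)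

noncomputable def levY (G : SimpleGraph V) (h : ℕ) (g : V → Option (Fin k)) : Finset (Fin k) :=
  univ.filter fun i => live G g i ∧ (cls g i).card = h

lemma lev_le {g : V → Option (Fin k)} {i : Fin k} (h : live G g i) : lev G g ≤ (cls g i).card :=
  Nat.sInf_le ⟨i, h, rfl⟩

lemma lev_mem {g : V → Option (Fin k)} (h : ∃ i, live G g i) :
    ∃ i, live G g i ∧ (cls g i).card = lev G g := by
  obtain ⟨i, hi⟩ := h
  exact Nat.sInf_mem (s := {c | ∃ i, live G g i ∧ (cls g i).card = c}) ⟨_, i, hi, rfl⟩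

lemma balance (R : Run G f mv T)
    (hbal : ∀ t < T, t % 4 = 2 → ∀ i, live G (f t) i →
      (cls (f t) (mv t).2).card ≤ (cls (f t) i).card) (Q : ℕ) (hQ : 4 ≤ Q) :
    ∀ t < T, (1 - 4 / (Q:ℝ)) ^ (lev G (f t)) * (k * (Q - 4 : ℝ)) ≤
      (potV Q (lev G (f t)) (f t) : ℝ) - 4 * (levY G (lev G (f t)) (f t)).card + ((t+1) % 4 : ℕ) := by
  have hQ0 : (0:ℝ) < Q := by exact_mod_cast (by omega : 0 < Q)
  have hQ4 : (4:ℝ) ≤ Q := by exact_mod_cast hQ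
  have hb0 : 0 ≤ 1 - 4 / (Q:ℝ) := by rw [sub_nonneg, div_le_one hQ0]; exact hQ4
  have hb1 : 1 - 4 / (Q:ℝ) ≤ 1 := by have : 0 ≤ 4 / (Q:ℝ) := by positivity
                                     linarith
  intro t
  induction t with
  | zero =>
    intro hT
    have hc : ∀ i : Fin k, (cls (f 0) i).card = 0 := by
      intro i; simp [cls, R.zero]
    have hl0 : lev G (f 0) = 0 := by
      have := lev_le (G := G) (g := f 0) (i := (mv 0).2) ⟨_, R.legal 0 hT⟩
      rw [hc] at this; omega
    rw [hl0]
    have h1 : potV Q 0 (f 0) = k * Q := by simp [potV, hc]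
    have h2 : ((levY G 0 (f 0)).card : ℝ) ≤ k := by
      have := card_le_univ (levY G 0 (f 0)); rw [Fintype.card_fin] at this; exact_mod_cast this
    rw [h1]; push_cast; norm_num
    linarith
  | succ t ih =>
    intro ht1
    have ht : t < T := by omega
    have ih := ih ht
    set l := lev G (f t) with hl
    have hlc : live G (f t) (mv t).2 := ⟨_, R.legal t ht⟩
    have hV : potV Q l (f t) ≤ potV Q l (f (t+1)) + 1 := by
      unfold potV
      rw [← add_sum_erase _ _ (mem_univ (mv t).2), ← add_sum_erase (a := (mv t).2) univ
        (fun i => l + Q - (cls (f (t+1)) i).card) (mem_univ _)]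
      have : ∑ x ∈ univ.erase (mv t).2, (l + Q - (cls (f t) x).card) =
          ∑ x ∈ univ.erase (mv t).2, (l + Q - (cls (f (t+1)) x).card) := by
        refine sum_congr rfl fun x hx => ?_
        rw [R.cls_card_step ht, if_neg (ne_of_mem_erase hx), add_zero]
      rw [this]
      have := R.cls_card_step ht (mv t).2
      rw [if_pos rfl] at this
      rw [this]; omega
    have hYsub : levY G l (f (t+1)) ⊆ (levY G l (f t)).erase (mv t).2 := by
      intro i hi
      simp only [levY, mem_filter, mem_univ, true_and, mem_erase] at hi ⊢
      obtain ⟨⟨v, hv⟩, h2⟩ := hi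
      have hstep := R.cls_card_step ht i
      have hli : live G (f t) i := ⟨v, R.legal_anti (by omega) (by omega) hv⟩
      have := lev_le hli
      have hne : i ≠ (mv t).2 := by
        intro h; rw [if_pos h] at hstep; omega
      rw [if_neg hne] at hstep
      exact ⟨hne, hli, by omega⟩
    have hE : (potV Q l (f t) : ℝ) - 4 * (levY G l (f t)).card + ((t+1) % 4 : ℕ) ≤
        (potV Q l (f (t+1)) : ℝ) - 4 * (levY G l (f (t+1))).card + ((t+1+1) % 4 : ℕ) := by
      have hV' : (potV Q l (f t) : ℝ) ≤ potV Q l (f (t+1)) + 1 := by exact_mod_cast hV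
      by_cases hb : t % 4 = 2
      · have hmem : (mv t).2 ∈ levY G l (f t) := by
          simp only [levY, mem_filter, mem_univ, true_and]
          refine ⟨hlc, le_antisymm ?_ (lev_le hlc)⟩
          obtain ⟨i, hi, hi'⟩ := lev_mem (G := G) (g := f t) ⟨_, hlc⟩
          rw [hl, ← hi']; exact hbal t ht hb i hi
        have hY := card_le_card hYsub
        rw [card_erase_of_mem hmem] at hY
        have hpos := card_pos.2 ⟨_, hmem⟩
        have hY' : ((levY G l (f (t+1))).card : ℝ) + 1 ≤ (levY G l (f t)).card := by
          exact_mod_cast (by omega : (levY G l (f (t+1))).card + 1 ≤ (levY G l (f t)).card)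
        have r1 : (t + 1) % 4 = 3 := by omega
        have r2 : (t + 1 + 1) % 4 = 0 := by omega
        rw [r1, r2]; push_cast; linarith
      · have hY : ((levY G l (f (t+1))).card : ℝ) ≤ (levY G l (f t)).card := by
          exact_mod_cast (card_le_card (hYsub.trans (erase_subset _ _)))
        have r1 : (((t+1+1) % 4 : ℕ):ℝ) = ((t+1) % 4 : ℕ) + 1 := by
          exact_mod_cast (by omega : (t+1+1) % 4 = (t+1) % 4 + 1)
        rw [r1]; linarith
    have hlive1 : ∃ i, live G (f (t+1)) i := ⟨_, _, R.legal (t+1) ht1⟩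
    have hll : l ≤ lev G (f (t+1)) := by
      obtain ⟨i, ⟨v, hv⟩, hi'⟩ := lev_mem hlive1
      rw [← hi']
      exact (lev_le (⟨v, R.legal_anti (by omega) (by omega) hv⟩ : live G (f t) i)).trans
        (card_le_card (R.cls_mono (by omega) (by omega) i))
    rcases hll.eq_or_lt with heq | hlt
    · rw [← heq]; exact ih.trans hE
    · have hY0 : levY G l (f (t+1)) = ∅ := by
        rw [← not_nonempty_iff_eq_empty]
        rintro ⟨i, hi⟩
        simp only [levY, mem_filter, mem_univ, true_and] at hi
        have := lev_le hi.1
        omega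
      rw [hY0, card_empty] at hE
      set l' := lev G (f (t+1)) with hl'
      have hVm : (potV Q l (f (t+1)) : ℝ) ≤ potV Q l' (f (t+1)) := by
        have : potV Q l (f (t+1)) ≤ potV Q l' (f (t+1)) := sum_le_sum fun i _ => by omega
        exact_mod_cast this
      have hYV : (Q:ℝ) * (levY G l' (f (t+1))).card ≤ potV Q l' (f (t+1)) := by
        have : Q * (levY G l' (f (t+1))).card ≤ potV Q l' (f (t+1)) := by
          unfold potV
          calc Q * (levY G l' (f (t+1))).card = ∑ i ∈ levY G l' (f (t+1)), Q := by simp [mul_comm]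
            _ ≤ ∑ i ∈ levY G l' (f (t+1)), (l' + Q - (cls (f (t+1)) i).card) := by
                refine sum_le_sum fun i hi => ?_
                simp only [levY, mem_filter, mem_univ, true_and] at hi
                omega
            _ ≤ _ := sum_le_sum_of_subset (subset_univ _)
        exact_mod_cast this
      have h4 : 4 * ((levY G l' (f (t+1))).card : ℝ) ≤ 4 / Q * potV Q l' (f (t+1)) := by
        rw [div_mul_eq_mul_div, le_div_iff₀ hQ0]; linarith
      have hpow : (1 - 4 / (Q:ℝ)) ^ l' ≤ (1 - 4 / (Q:ℝ)) * (1 - 4 / (Q:ℝ)) ^ l := by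
        rw [← pow_succ']; exact pow_le_pow_of_le_one hb0 hb1 (by omega)
      have hk0 : 0 ≤ (k:ℝ) * (Q - 4) := mul_nonneg (Nat.cast_nonneg _) (by linarith)
      have hr : (0:ℝ) ≤ ((t+1+1) % 4 : ℕ) := Nat.cast_nonneg _
      set r := (((t+1+1) % 4 : ℕ) : ℝ)
      set b := 1 - 4 / (Q:ℝ) with hb
      have h5 : b ^ l * (k * (Q - 4 : ℝ)) ≤ potV Q l (f (t+1)) + r := by
        refine (ih.trans hE).trans (le_of_eq ?_); push_cast; ring
      calc b ^ l' * (k * (Q - 4 : ℝ)) ≤ b * b ^ l * (k * (Q - 4 : ℝ)) := by gcongr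
        _ = b * (b ^ l * (k * (Q - 4 : ℝ))) := by ring
        _ ≤ b * (potV Q l (f (t+1)) + r) := by gcongr
        _ ≤ b * potV Q l' (f (t+1)) + r := by nlinarith
        _ ≤ _ := by
          have : b * (potV Q l' (f (t+1)) : ℝ) = potV Q l' (f (t+1)) - 4 / Q * potV Q l' (f (t+1)) := by
            rw [hb]; ring
          rw [this]; linarith

end RunSec

open MeasureTheory Filter Finset

set_option linter.unusedSectionVars false
set_option linter.unusedVariables false

section MakerSec
open scoped Classical
variable {V : Type*} [Fintype V] {k : ℕ}

noncomputable def av (G : SimpleGraph V) (g : V → Option (Fin k)) (v : V) : Finset (Fin k) :=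
  univ.filter fun i => LegalMove G g v i

variable {G : SimpleGraph V} {f : ℕ → V → Option (Fin k)} {mv : ℕ → V × Fin k} {T : ℕ}

lemma mem_av {g : V → Option (Fin k)} {v : V} {i : Fin k} : i ∈ av G g v ↔ LegalMove G g v i := by
  simp [av]

lemma av_count (g : V → Option (Fin k)) (X : Finset V) (I : Finset (Fin k)) :
    ∑ x ∈ X, (((av G g x) ∩ I).card : ℝ) = ∑ i ∈ I, ((X.filter fun v => LegalMove G g v i).card : ℝ) := by
  have h1 : ∀ x, (((av G g x) ∩ I).card : ℝ) = ∑ i ∈ I, if LegalMove G g x i then (1:ℝ) else 0 := by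
    intro x
    rw [← sum_filter, sum_const, nsmul_eq_mul, mul_one]
    congr 2
    ext i; simp [av, and_comm]
  have h2 : ∀ i, ((X.filter fun v => LegalMove G g v i).card : ℝ) =
      ∑ x ∈ X, if LegalMove G g x i then (1:ℝ) else 0 := by
    intro i
    rw [← sum_filter, sum_const, nsmul_eq_mul, mul_one]
  simp_rw [h1, h2]
  exact sum_comm

lemma harm_rec (J : ℕ) (Λ : ℝ) (hΛ : 0 ≤ Λ) (S Q H : ℕ → ℝ) (hS : S 0 = 0) (hQ0 : Q 0 = 0)
    (h1 : ∀ l < J, (l + 1 : ℝ) * S (l+1) ≤ (l + 2) * (S l + H l))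
    (h2 : ∀ l < J, H l ≤ Q (l+1) - Q l)
    (h3 : ∀ l ≤ J, Q l ≤ l * Λ) :
    S J / (J + 1) ≤ Λ * (2 + Real.log J) := by
  have key : ∀ l ≤ J, S l / (l + 1) ≤ Q l / l + Λ * ∑ r ∈ range l, ((r + 1 : ℕ) : ℝ)⁻¹ := by
    intro l
    induction l with
    | zero => intro _; simp [hS]
    | succ l ih =>
      intro hl
      have ih := ih (by omega)
      have a1 := h1 l (by omega)
      have a2 := h2 l (by omega)
      have a3 := h3 l (by omega)
      have hp : (0:ℝ) < l + 1 := by positivity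
      have b1 : S (l+1) / ((l+1:ℕ) + 1) ≤ (S l + H l) / (l + 1) := by
        rw [div_le_div_iff₀ (by positivity) hp]; push_cast; nlinarith
      have b2 : Q l / l ≤ Q l / (l+1) + Λ * ((l+1:ℕ):ℝ)⁻¹ := by
        rcases Nat.eq_zero_or_pos l with h0 | h0
        · subst h0; simp [hQ0, hΛ]
        · have hlp : (0:ℝ) < l := by exact_mod_cast h0
          push_cast
          rw [← div_eq_mul_inv, ← add_div, div_le_div_iff₀ hlp hp]
          nlinarith
      have b3 : H l / (l+1) ≤ Q (l+1) / (l+1) - Q l / (l+1) := by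
        rw [← sub_div]; gcongr
      rw [sum_range_succ, mul_add]
      rw [add_div] at b1
      push_cast at *
      linarith
  have h := key J le_rfl
  have hh := harmonic_le_one_add_log J
  have e : ((harmonic J : ℚ) : ℝ) = ∑ r ∈ range J, ((r + 1 : ℕ) : ℝ)⁻¹ := by
    simp [harmonic]
  rw [e] at hh
  have h4 : Q J / J ≤ Λ := by
    rcases Nat.eq_zero_or_pos J with h0 | h0
    · subst h0; simpa using hΛ
    · have hlp : (0:ℝ) < J := by exact_mod_cast h0
      rw [div_le_iff₀ hlp]; have := h3 J le_rfl; linarith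
  have h5 := mul_le_mul_of_nonneg_left hh hΛ
  linarith

lemma av_anti (R : Run G f mv T) {s t : ℕ} (hst : s ≤ t) (ht : t ≤ T) (v : V) :
    av G (f t) v ⊆ av G (f s) v := by
  intro i hi
  rw [mem_av] at hi ⊢
  exact R.legal_anti hst ht hi

lemma lost_used (R : Run G f mv T) {s t : ℕ} (hst : s ≤ t) (ht : t ≤ T) {v : V} (hv : f t v = none)
    {i : Fin k} (h1 : i ∈ av G (f s) v) (h2 : i ∉ av G (f t) v) :
    ∃ r, s ≤ r ∧ r < t ∧ (mv r).2 = i := by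
  by_contra hc
  push Not at hc
  apply h2
  clear h2
  induction t, hst using Nat.le_induction with
  | base => exact h1
  | succ t hst ih =>
    have ih := ih (by omega) (R.none_of (by omega) ht hv) (fun r a b => hc r a (by omega))
    rw [mem_av] at ih ⊢
    refine ⟨hv, fun u hu hcol => ?_⟩
    rw [R.step_eq (by omega)] at hcol
    split_ifs at hcol with hu'
    · exact hc t (by omega) (by omega) (by simpa using hcol)
    · exact ih.2 u hu hcol

theorem maker_core (R : Run G f mv T) {q h : ℝ} (hq0 : 0 < q) (hq1 : q ≤ 1) (hh : 0 ≤ h)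
    (hc : Conc G q h) (hk : k ≤ Fintype.card V) {s : ℕ} (hα : AlphaLT G s)
    (hdan : ∀ t < T, t % 4 = 0 → ∀ v, f t v = none →
      (av G (f t) (mv t).1).card ≤ (av G (f t) v).card)
    (vs : V) (hvs : f T vs = none) (hvs' : av G (f T) vs = ∅)
    (J : ℕ) (hJ : 4 * J ≤ T) (hJ1 : 1 ≤ J) :
    ∃ t < T, (∑ i, q ^ (cls (f t) i).card) / 2 ≤
      h * (Fintype.card V + k + J + 2) / (J + 1) +
        (8 * J * q ^ (lev G (f t)) + h * (6 + 4 * s)) * (2 + Real.log J) := by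
  set D := (T + 3) / 4 with hD
  set τ : ℕ → ℕ := fun l => min T (4 * (D - l)) with hτ
  have τ0 : τ 0 = T := by simp only [hτ]; omega
  have τs : ∀ l < J, τ (l+1) < τ l ∧ τ (l+1) % 4 = 0 ∧ τ (l+1) < T := by
    intro l hl; simp only [hτ]; omega
  have τT : ∀ l, τ l ≤ T := fun l => min_le_left _ _
  have τm : ∀ l l', l ≤ l' → τ l' ≤ τ l := by intro l l' h; simp only [hτ]; omega
  have τd : ∀ l, T - τ l ≤ 4 * l := by intro l; simp only [hτ]; omega
  set u : ℕ → V := fun l => (mv (τ l)).1 with hu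
  set X : ℕ → Finset V := fun l => Nat.rec {vs} (fun l Y => insert (u (l+1)) Y) l with hX
  have X0 : X 0 = {vs} := rfl
  have Xs : ∀ l, X (l+1) = insert (u (l+1)) (X l) := fun l => rfl
  have Xnone : ∀ l ≤ J, ∀ x ∈ X l, f (τ l) x = none := by
    intro l
    induction l with
    | zero => intro _ x hx; rw [X0, mem_singleton] at hx; rw [hx, τ0]; exact hvs
    | succ l ih =>
      intro hl x hx
      rw [Xs, mem_insert] at hx
      rcases hx with rfl | hx
      · exact (R.legal _ (τs l (by omega)).2.2).1
      · exact R.none_of (τs l (by omega)).1.le (τT _) (ih (by omega) x hx)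
  have Xnew : ∀ l < J, u (l+1) ∉ X l := by
    intro l hl hmem
    have h1 := Xnone l hl.le _ hmem
    have h2 : f (τ (l+1) + 1) (u (l+1)) = some (mv (τ (l+1))).2 := by
      rw [R.step_eq (τs l hl).2.2]; simp [hu]
    rw [R.mono (τs l hl).1 (τT _) h2] at h1
    cases h1
  have Xcard : ∀ l ≤ J, (X l).card = l + 1 := by
    intro l
    induction l with
    | zero => intro _; simp [X0]
    | succ l ih =>
      intro hl
      rw [Xs, card_insert_of_notMem (Xnew l (by omega)), ih (by omega)]
  set I : ℕ → Finset (Fin k) := fun l => (Ico (τ l) T).image fun t => (mv t).2 with hI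
  have Icard : ∀ l, (I l).card ≤ 4 * l := by
    intro l; refine card_image_le.trans ?_; rw [Nat.card_Ico]; exact τd l
  have Imono : ∀ l, I l ⊆ I (l+1) := by
    intro l; exact image_subset_image (Ico_subset_Ico_left (τm l (l+1) (by omega)))
  set ℓ := lev G (f (τ J)) with hℓ
  set Λ : ℝ := 8 * J * q ^ ℓ + h * (6 + 4 * s) with hΛd
  have hΛ : 0 ≤ Λ := by positivity
  set S : ℕ → ℝ := fun l => ∑ x ∈ X l, ((av G (f (τ l)) x).card : ℝ) with hSd
  set Q : ℕ → ℝ := fun l => match l with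
    | 0 => 0
    | l+1 => ∑ x ∈ X l, (((av G (f (τ (l+1))) x) ∩ I (l+1)).card : ℝ) with hQd
  set H : ℕ → ℝ := fun l => ∑ x ∈ X l, (((av G (f (τ (l+1))) x).card : ℝ) - (av G (f (τ l)) x).card) with hHd
  have hS0 : S 0 = 0 := by simp [hSd, X0, τ0, hvs']
  have hrec : S J / (J + 1) ≤ Λ * (2 + Real.log J) := by
    refine harm_rec J Λ hΛ S Q H hS0 rfl ?_ ?_ ?_
    · intro l hl
      have e1 : S l + H l = ∑ x ∈ X l, ((av G (f (τ (l+1))) x).card : ℝ) := by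
        simp only [hSd, hHd]; rw [← sum_add_distrib]; refine sum_congr rfl fun x _ => by ring
      have e2 : S (l+1) = (av G (f (τ (l+1))) (u (l+1))).card + (S l + H l) := by
        rw [e1]; simp only [hSd]; rw [Xs, sum_insert (Xnew l hl)]
      have e3 : (l + 1 : ℝ) * (av G (f (τ (l+1))) (u (l+1))).card ≤ S l + H l := by
        rw [e1]
        have : ∑ x ∈ X l, ((av G (f (τ (l+1))) (u (l+1))).card : ℝ) ≤
            ∑ x ∈ X l, ((av G (f (τ (l+1))) x).card : ℝ) := by
          refine sum_le_sum fun x hx => ?_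
          exact_mod_cast hdan _ (τs l hl).2.2 (τs l hl).2.1 x
            (R.none_of (τs l hl).1.le (τT _) (Xnone l hl.le x hx))
        rw [sum_const, Xcard l hl.le, nsmul_eq_mul] at this
        push_cast at this; exact this
      rw [e2]; linarith
    · intro l hl
      have hstep : ∀ x ∈ X l, (((av G (f (τ (l+1))) x).card : ℝ) - (av G (f (τ l)) x).card) +
          ((av G (f (τ l)) x ∩ I l).card : ℝ) ≤ ((av G (f (τ (l+1))) x) ∩ I (l+1)).card := by
        intro x hx
        have hsub := av_anti R (τs l hl).1.le (τT l) x
        have h1 : (av G (f (τ (l+1))) x \ av G (f (τ l)) x) ∪ (av G (f (τ l)) x ∩ I l) ⊆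
            (av G (f (τ (l+1))) x) ∩ I (l+1) := by
          intro i hi
          rw [mem_union, Finset.mem_sdiff, mem_inter] at hi
          rw [mem_inter]
          rcases hi with ⟨h1, h2⟩ | ⟨h1, h2⟩
          · refine ⟨h1, ?_⟩
            obtain ⟨r, hr1, hr2, hr3⟩ := lost_used R (τs l hl).1.le (τT l) (Xnone l hl.le x hx) h1 h2
            exact mem_image.2 ⟨r, mem_Ico.2 ⟨hr1, lt_of_lt_of_le hr2 (τT l)⟩, hr3⟩
          · exact ⟨hsub h1, Imono l h2⟩
        have h2 := card_le_card h1
        rw [card_union_of_disjoint] at h2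
        · have h3 := card_sdiff_add_card_eq_card hsub
          have h3' : ((av G (f (τ (l+1))) x \ av G (f (τ l)) x).card : ℝ) + (av G (f (τ l)) x).card
            = (av G (f (τ (l+1))) x).card := by exact_mod_cast h3
          have h2' : ((av G (f (τ (l+1))) x \ av G (f (τ l)) x).card : ℝ) +
            (av G (f (τ l)) x ∩ I l).card ≤ ((av G (f (τ (l+1))) x) ∩ I (l+1)).card := by
            exact_mod_cast h2
          linarith
        · rw [Finset.disjoint_left]; intro i hi hi'
          exact (Finset.mem_sdiff.1 hi).2 (mem_inter.1 hi').1
      have hsum := sum_le_sum hstep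
      rw [sum_add_distrib] at hsum
      have hQl : Q l ≤ ∑ x ∈ X l, ((av G (f (τ l)) x ∩ I l).card : ℝ) := by
        cases l with
        | zero => exact sum_nonneg fun _ _ => Nat.cast_nonneg _
        | succ l =>
          simp only [hQd]
          exact sum_le_sum_of_subset_of_nonneg (by rw [Xs]; exact subset_insert _ _)
            fun _ _ _ => Nat.cast_nonneg _
      have e : Q (l+1) = ∑ x ∈ X l, (((av G (f (τ (l+1))) x) ∩ I (l+1)).card : ℝ) := rfl
      rw [e]; simp only [hHd]; linarith
    · intro l hl
      cases l with
      | zero => simp [hQd]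
      | succ l =>
        have e : Q (l+1) = ∑ x ∈ X l, (((av G (f (τ (l+1))) x) ∩ I (l+1)).card : ℝ) := rfl
        rw [e, av_count]
        have hXn : ∀ x ∈ X l, f (τ (l+1)) x = none := fun x hx =>
          R.none_of (τs l hl).1.le (τT _) (Xnone l (by omega) x hx)
        refine ((hc.restr hk (f (τ (l+1))) (I (l+1)) (X l) hXn).2).trans ?_
        rw [Xcard l (by omega)]
        have hlev : ∀ i ∈ I (l+1), ℓ ≤ (cls (f (τ (l+1))) i).card := by
          intro i hi
          obtain ⟨r, hr, rfl⟩ := mem_image.1 hi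
          rw [mem_Ico] at hr
          have h1 : τ J ≤ τ (l+1) := τm _ _ hl
          refine (lev_le (G := G) (g := f (τ J)) (i := (mv r).2) ⟨(mv r).1,
            R.legal_anti (h1.trans hr.1) hr.2.le (R.legal r hr.2)⟩).trans ?_
          exact card_le_card (R.cls_mono h1 (τT _) _)
        have b1 : ∑ i ∈ I (l+1), q ^ (cls (f (τ (l+1))) i).card ≤ 4 * (l+1) * q ^ ℓ := by
          calc _ ≤ ∑ i ∈ I (l+1), q ^ ℓ :=
                sum_le_sum fun i hi => pow_le_pow_of_le_one hq0.le hq1 (hlev i hi)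
            _ = (I (l+1)).card * q ^ ℓ := by simp
            _ ≤ _ := by
              have : ((I (l+1)).card : ℝ) ≤ 4 * (l+1) := by exact_mod_cast Icard (l+1)
              gcongr
        have b2 : ((∑ i ∈ I (l+1), (cls (f (τ (l+1))) i).card : ℕ) : ℝ) ≤ 4 * (l+1) * s := by
          have : ∑ i ∈ I (l+1), (cls (f (τ (l+1))) i).card ≤ 4 * (l+1) * s := by
            calc _ ≤ ∑ i ∈ I (l+1), s := sum_le_sum fun i _ => (R.cls_lt hα (τT _) i).le
              _ = (I (l+1)).card * s := by simp
              _ ≤ _ := Nat.mul_le_mul_right _ (Icard _)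
          exact_mod_cast this
        have b3 : ((I (l+1)).card : ℝ) ≤ 4 * (l+1) := by exact_mod_cast Icard (l+1)
        have hlJ : (l + 1 : ℝ) ≤ J := by exact_mod_cast hl
        have hl0 : (0:ℝ) ≤ l := Nat.cast_nonneg _
        push_cast at b2 ⊢
        have c1 : 2 * ((l + 1 : ℝ) * ∑ i ∈ I (l+1), q ^ (cls (f (τ (l+1))) i).card) ≤
            (l+1) * (8 * J * q ^ ℓ) := by
          calc _ ≤ 2 * ((l + 1 : ℝ) * (4 * (l+1) * q ^ ℓ)) := by gcongr
            _ = (l+1) * (8 * (l+1) * q ^ ℓ) := by ring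
            _ ≤ _ := by gcongr
        have c2 : h * ((l + 1 : ℝ) + ∑ i ∈ I (l+1), ((cls (f (τ (l+1))) i).card:ℝ) + (I (l+1)).card + 1)
            ≤ (l+1) * (h * (6 + 4 * s)) := by
          calc _ ≤ h * ((l+1:ℝ) + 4 * (l+1) * s + 4 * (l+1) + (l+1)) := by
                gcongr; linarith
            _ = _ := by ring
        rw [hΛd, mul_add]; linarith
  have hτJ : τ J < T := by
    obtain ⟨l, rfl⟩ : ∃ l, J = l + 1 := ⟨J - 1, by omega⟩
    exact (τs l (by omega)).2.2
  refine ⟨τ J, hτJ, ?_⟩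
  have hlow := (hc.restr hk (f (τ J)) univ (X J) (Xnone J le_rfl)).1
  rw [← av_count, R.sum_cls (τT J), Xcard J le_rfl] at hlow
  simp only [inter_univ, card_univ, Fintype.card_fin] at hlow
  have hn : ((τ J : ℕ) : ℝ) ≤ Fintype.card V := by
    have : τ J ≤ Fintype.card V := by
      rw [← R.card_dom (τT J)]; exact card_le_univ _
    exact_mod_cast this
  set μ := ∑ i, q ^ (cls (f (τ J)) i).card with hμ
  have hJp : (0:ℝ) < J + 1 := by positivity
  have h1 : (J+1) * μ / 2 ≤ S J + h * (Fintype.card V + k + J + 2) := by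
    have : h * (((J + 1 : ℕ):ℝ) + (τ J : ℕ) + k + 1) ≤ h * (Fintype.card V + k + J + 2) := by
      push_cast; exact mul_le_mul_of_nonneg_left (by linarith) hh
    push_cast at hlow this
    linarith
  have h2 : μ / 2 ≤ S J / (J+1) + h * (Fintype.card V + k + J + 2) / (J+1) := by
    rw [← add_div, le_div_iff₀ hJp]; linarith
  linarith

end MakerSec

open MeasureTheory Filter Finset

set_option linter.unusedSectionVars false
set_option linter.unusedVariables false

section MakerWinSec
variable {V : Type*} [Fintype V] [DecidableEq V] {k : ℕ}

noncomputable def playMv (G : SimpleGraph V) (σM σB : Strategy V k) (t : ℕ) : V × Fin k :=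
  if t % 2 = 0 then σM (play G σM σB t) else σB (play G σM σB t)

lemma play_run (G : SimpleGraph V) (σM σB : Strategy V k) (hM : σM.IsLegal G) (hB : σB.IsLegal G)
    (T : ℕ) (hT : ∀ t < T, ∃ v c, LegalMove G (play G σM σB t) v c) :
    Run G (play G σM σB) (playMv G σM σB) T := by
  refine ⟨fun v => rfl, fun t ht => ?_, fun t ht => ?_⟩
  · unfold playMv
    split_ifs
    · exact hM _ (hT t ht)
    · exact hB _ (hT t ht)
  · rw [play]
    simp only [if_pos (hT t ht)]
    unfold playMv
    congr
    exact Subsingleton.elim _ _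

lemma play_T (G : SimpleGraph V) (σM σB : Strategy V k) (hM : σM.IsLegal G) (hB : σB.IsLegal G)
    (T : ℕ) (hTn : T ≤ Fintype.card V)
    (hT : ∀ t < T, ¬ ∃ v, play G σM σB t v = none ∧ ∀ c, ¬ LegalMove G (play G σM σB t) v c) :
    ∀ t < T, ∃ v c, LegalMove G (play G σM σB t) v c := by
  intro t
  induction t using Nat.strong_induction_on with
  | _ t ih =>
    intro ht
    have R := play_run G σM σB hM hB t (fun s hs => ih s hs (by omega))
    have hcd := R.card_dom le_rfl
    obtain ⟨v, hv⟩ : ∃ v, play G σM σB t v = none := by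
      by_contra hc
      push Not at hc
      have : (univ.filter fun u => play G σM σB t u ≠ none) = univ := by
        rw [filter_true_of_mem]; exact fun u _ => hc u
      have h2 : (univ.filter fun u => play G σM σB t u ≠ none).card = Fintype.card V := by
        rw [this]; exact card_univ
      have h3 : (univ.filter fun u => play G σM σB t u ≠ none).card = t := by convert hcd
      omega
    have := hT t ht
    push Not at this
    obtain ⟨c, hc⟩ := this v hv
    exact ⟨v, c, hc⟩

open scoped Classical in
lemma play_lose (G : SimpleGraph V) (σM σB : Strategy V k) (hM : σM.IsLegal G) (hB : σB.IsLegal G)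
    (v : V) (hv : play G σM σB (Fintype.card V) v = none) :
    ∃ T, Run G (play G σM σB) (playMv G σM σB) T ∧
      (∃ v, play G σM σB T v = none ∧ av G (play G σM σB T) v = ∅) ∧
      ∀ t < T, ∀ v, play G σM σB t v = none → ∃ c, LegalMove G (play G σM σB t) v c := by
  have hex : ∃ T, T ≤ Fintype.card V ∧
      ∃ v, play G σM σB T v = none ∧ ∀ c, ¬ LegalMove G (play G σM σB T) v c := by
    by_contra hc
    push Not at hc
    have R := play_run G σM σB hM hB _ (play_T G σM σB hM hB (Fintype.card V) le_rfl (by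
      rintro t ht ⟨v, h1, h2⟩
      obtain ⟨c, hc⟩ := hc t ht.le v h1
      exact h2 c hc))
    have hcd := R.card_dom le_rfl
    have h2 : (univ.filter fun u => play G σM σB (Fintype.card V) u ≠ none) = univ :=
      eq_univ_of_card _ hcd
    have := mem_univ v
    rw [← h2] at this
    exact (mem_filter.1 this).2 hv
  obtain ⟨hT1, hT2⟩ := Nat.find_spec hex
  have hmin : ∀ t < Nat.find hex,
      ¬ ∃ v, play G σM σB t v = none ∧ ∀ c, ¬ LegalMove G (play G σM σB t) v c := by
    intro t ht h
    exact Nat.find_min hex ht ⟨by omega, h⟩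
  refine ⟨Nat.find hex, play_run G σM σB hM hB _ (play_T G σM σB hM hB _ hT1 hmin), ?_, ?_⟩
  · obtain ⟨v, h1, h2⟩ := hT2
    refine ⟨v, h1, ?_⟩
    ext i; simp [av, h2 i]
  · intro t ht v hv
    have := hmin t ht
    push Not at this
    exact this v hv

lemma sum_pow_ge (q : ℝ) (hq0 : 0 < q) (hq1 : q ≤ 1) (hk : 0 < k) (c : Fin k → ℕ) (n : ℕ)
    (hc : ∑ i, c i ≤ n) : (k:ℝ) * q ^ ((n:ℝ) / k) ≤ ∑ i, q ^ (c i) := by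
  have hkp : (0:ℝ) < k := by exact_mod_cast hk
  set m : ℝ := (n:ℝ) / k with hm
  have hl : Real.log q ≤ 0 := Real.log_nonpos hq0.le hq1
  have hqm : 0 < q ^ m := Real.rpow_pos_of_pos hq0 _
  have key : ∀ i, q ^ m * (1 + ((c i : ℝ) - m) * Real.log q) ≤ q ^ (c i) := by
    intro i
    have e : (q:ℝ) ^ (c i) = q ^ m * Real.exp (((c i : ℝ) - m) * Real.log q) := by
      rw [← Real.rpow_natCast, Real.rpow_def_of_pos hq0, Real.rpow_def_of_pos hq0, ← Real.exp_add]
      congr 1; ring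
    rw [e]
    have := Real.add_one_le_exp (((c i : ℝ) - m) * Real.log q)
    gcongr; linarith
  refine le_trans ?_ (sum_le_sum fun i _ => key i)
  rw [← mul_sum, sum_add_distrib, ← sum_mul, sum_sub_distrib]
  simp only [sum_const, card_univ, Fintype.card_fin, nsmul_eq_mul, mul_one]
  have h1 : (∑ i, (c i : ℝ)) - k * m ≤ 0 := by
    rw [hm, mul_div_cancel₀ _ hkp.ne']
    have : ((∑ i, c i : ℕ) : ℝ) ≤ n := by exact_mod_cast hc
    push_cast at this; linarith
  have h2 := mul_nonneg_of_nonpos_of_nonpos h1 hl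
  nlinarith

open scoped Classical in
theorem maker_wins (G : SimpleGraph V) (k : ℕ) {q h : ℝ} (hq0 : 0 < q) (hq1 : q ≤ 1) (hh : 0 ≤ h)
    (hc : Conc G q h) (hk : k ≤ Fintype.card V) {s : ℕ} (hα : AlphaLT G s)
    (J Q : ℕ) (hJ1 : 1 ≤ J) (hJk : 4 * J ≤ k) (hQ : 4 ≤ Q)
    (hnum : ∀ l < s, ∀ μ : ℝ, (k:ℝ) * q ^ ((Fintype.card V : ℝ) / k) ≤ μ →
      ((1 - 4 / (Q:ℝ)) ^ s * (k * (Q - 4 : ℝ)) - 3) / (l + Q) * q ^ (l + Q) ≤ μ →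
      h * (Fintype.card V + k + J + 2) / (J + 1) +
        (8 * J * q ^ l + h * (6 + 4 * s)) * (2 + Real.log J) < μ / 2) :
    MakerWins G k := by
  have hkp : 0 < k := by omega
  have hV : 0 < Fintype.card V := by omega
  obtain ⟨v0⟩ : Nonempty V := Fintype.card_pos_iff.1 hV
  have hstrat : ∀ g : V → Option (Fin k), ∃ m : V × Fin k, (∃ v c, LegalMove G g v c) →
      LegalMove G g m.1 m.2 ∧
      ((univ.filter fun u => g u ≠ none).card % 4 = 0 → ∀ v, (∃ c, LegalMove G g v c) →
        (av G g m.1).card ≤ (av G g v).card) ∧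
      ((univ.filter fun u => g u ≠ none).card % 4 = 2 → ∀ i, live G g i →
        (cls g m.2).card ≤ (cls g i).card) := by
    intro g
    by_cases hex : ∃ v c, LegalMove G g v c
    · by_cases h0 : (univ.filter fun u => g u ≠ none).card % 4 = 0
      · obtain ⟨v, hv, hmin⟩ := exists_min_image (univ.filter fun v => ∃ c, LegalMove G g v c)
          (fun v => (av G g v).card) (by obtain ⟨v, hv⟩ := hex; exact ⟨v, by simpa using hv⟩)
        obtain ⟨c, hc⟩ := (mem_filter.1 hv).2
        refine ⟨(v, c), fun _ => ⟨hc, fun _ w hw => hmin w (by simpa using hw), fun h => by omega⟩⟩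
      · obtain ⟨i, hi, hmin⟩ := exists_min_image (univ.filter fun i => live G g i)
          (fun i => (cls g i).card) (by
            obtain ⟨v, c, hv⟩ := hex
            exact ⟨c, mem_filter.2 ⟨mem_univ _, v, hv⟩⟩)
        obtain ⟨v, hv⟩ := (mem_filter.1 hi).2
        exact ⟨(v, i), fun _ => ⟨hv, fun h => absurd h h0,
          fun _ j hj => hmin j (mem_filter.2 ⟨mem_univ _, hj⟩)⟩⟩
    · exact ⟨(v0, ⟨0, hkp⟩), fun h => absurd h hex⟩
  choose σ hσ using hstrat
  refine ⟨σ, fun g hg => (hσ g hg).1, fun σB hB v hv => ?_⟩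
  have hM : Strategy.IsLegal (σ : Strategy V k) G := fun g hg => (hσ g hg).1
  obtain ⟨T, R, ⟨vs, hvs, hvs'⟩, hall⟩ := play_lose G σ σB hM hB v hv
  set f := play G σ σB with hf
  have hTk : k ≤ T := by
    rw [← R.card_dom le_rfl]
    have : ∀ i : Fin k, ∃ u, f T u = some i := by
      intro i
      by_contra hcon
      push Not at hcon
      have : i ∈ av G (f T) vs := mem_av.2 ⟨hvs, fun u _ => hcon u⟩
      rw [hvs'] at this; simp at this
    choose w hw using this
    calc k = (univ : Finset (Fin k)).card := by simp
      _ = (univ.image w).card := by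
        rw [card_image_of_injective]
        intro a b hab
        have h1 := hw a; rw [hab, hw b] at h1
        simpa using h1.symm
      _ ≤ _ := by
        refine card_le_card fun u hu => ?_
        obtain ⟨i, _, rfl⟩ := mem_image.1 hu
        simp [hw i]
  have hmv : ∀ t < T, t % 2 = 0 → playMv G σ σB t = σ (f t) := by
    intro t _ h; simp [playMv, h, hf]
  have hleg : ∀ t < T, ∃ v c, LegalMove G (f t) v c := fun t ht => ⟨_, _, R.legal t ht⟩
  have hdan : ∀ t < T, t % 4 = 0 → ∀ v, f t v = none →
      (av G (f t) (playMv G σ σB t).1).card ≤ (av G (f t) v).card := by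
    intro t ht h4 v hv
    rw [hmv t ht (by omega)]
    refine (hσ (f t) (hleg t ht)).2.1 ?_ v (hall t ht v hv)
    rw [R.card_dom ht.le]; exact h4
  have hbal : ∀ t < T, t % 4 = 2 → ∀ i, live G (f t) i →
      (cls (f t) (playMv G σ σB t).2).card ≤ (cls (f t) i).card := by
    intro t ht h4 i hi
    rw [hmv t ht (by omega)]
    refine (hσ (f t) (hleg t ht)).2.2 ?_ i hi
    rw [R.card_dom ht.le]; exact h4
  obtain ⟨t, ht, hmain⟩ := maker_core R hq0 hq1 hh hc hk hα hdan vs hvs hvs' J (by omega) hJ1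
  have hB4 := balance R hbal Q hQ t ht
  set l := lev G (f t) with hl
  have hls : l < s := by
    refine lt_of_le_of_lt (lev_le (i := (playMv G σ σB t).2) ⟨_, R.legal t ht⟩) (R.cls_lt hα ht.le _)
  refine absurd hmain (not_le.2 (hnum l hls _ ?_ ?_))
  · refine sum_pow_ge q hq0 hq1 hkp _ _ ?_
    rw [R.sum_cls ht.le]
    calc t = _ := (R.card_dom ht.le).symm
      _ ≤ _ := card_le_univ _
  · set N := (univ.filter fun i => (cls (f t) i).card < l + Q) with hN
    have hQ0 : (0:ℝ) < Q := by exact_mod_cast (by omega : 0 < Q)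
    have hQ4 : (4:ℝ) ≤ Q := by exact_mod_cast hQ
    have hb0 : 0 ≤ 1 - 4 / (Q:ℝ) := by rw [sub_nonneg, div_le_one hQ0]; exact hQ4
    have hb1 : 1 - 4 / (Q:ℝ) ≤ 1 := by
      have : 0 ≤ 4 / (Q:ℝ) := by positivity
      linarith
    have hpot : (potV Q l (f t) : ℝ) ≤ N.card * (l + Q) := by
      have : potV Q l (f t) ≤ N.card * (l + Q) := by
        unfold potV
        calc _ = ∑ i ∈ N, (l + Q - (cls (f t) i).card) := by
              rw [hN, sum_filter]
              refine sum_congr rfl fun i _ => ?_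
              split_ifs <;> omega
          _ ≤ ∑ i ∈ N, (l + Q) := sum_le_sum fun i _ => by omega
          _ = _ := by simp
      exact_mod_cast this
    have hpw : (1 - 4 / (Q:ℝ)) ^ s * (k * (Q - 4 : ℝ)) ≤ (1 - 4 / (Q:ℝ)) ^ l * (k * (Q - 4 : ℝ)) := by
      refine mul_le_mul_of_nonneg_right (pow_le_pow_of_le_one hb0 hb1 hls.le) ?_
      exact mul_nonneg (Nat.cast_nonneg _) (by linarith)
    have h3 : (((t+1) % 4 : ℕ) : ℝ) ≤ 3 := by exact_mod_cast (by omega : (t+1) % 4 ≤ 3)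
    have hY : (0:ℝ) ≤ 4 * (levY G l (f t)).card := by positivity
    have hlQ : (0:ℝ) < l + Q := by positivity
    have hqq : 0 ≤ q ^ (l + Q) := by positivity
    calc _ ≤ (N.card : ℝ) * q ^ (l + Q) := by
          refine mul_le_mul_of_nonneg_right ?_ hqq
          rw [div_le_iff₀ hlQ]; linarith
      _ = ∑ i ∈ N, q ^ (l + Q) := by simp
      _ ≤ ∑ i ∈ N, q ^ (cls (f t) i).card := sum_le_sum fun i hi =>
          pow_le_pow_of_le_one hq0.le hq1 (mem_filter.1 hi).2.le
      _ ≤ _ := sum_le_sum_of_subset_of_nonneg (subset_univ _) fun _ _ _ => by positivity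

end MakerWinSec

open MeasureTheory Filter Finset

set_option linter.unusedSectionVars false
set_option linter.unusedVariables false

section BreakerSec
open scoped Classical
variable {V : Type*} [Fintype V] {k : ℕ} {G : SimpleGraph V}

lemma exists_U (G : SimpleGraph V) {t z M : ℕ} (h : PropA1 G t z M) (C : Finset V) (hC : C.card = t) :
    ∃ U : Finset V, U.card ≤ M * z ∧ Disjoint U C ∧ (∀ u ∈ C, ∀ w ∈ U, ¬ G.Adj u w) ∧
      ∀ I : Finset V, Disjoint I C → (∀ u ∈ C, ∀ w ∈ I, ¬ G.Adj u w) → G.IsIndepSet (I : Set V) →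
        (I \ U).card < z := by
  set P : ℕ → Prop := fun m => ∃ I : Fin m → Finset V, (∀ a, (I a).card = z) ∧
    (∀ a b, a ≠ b → Disjoint (I a) (I b)) ∧ (∀ a, Disjoint (I a) C) ∧
    (∀ a, ∀ u ∈ C, ∀ w ∈ I a, ¬ G.Adj u w) ∧ ∀ a, G.IsIndepSet (I a : Set V) with hP
  have hM : ¬ P M := by
    rintro ⟨I, h1, h2, h3, h4, h5⟩
    obtain ⟨a, ha⟩ := h C hC I h1 h2 h3 h4
    exact ha (h5 a)
  have h0 : P 0 := ⟨Fin.elim0, fun a => a.elim0, fun a => a.elim0, fun a => a.elim0,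
    fun a => a.elim0, fun a => a.elim0⟩
  obtain ⟨m, hmM, hPm, hPm1⟩ : ∃ m < M, P m ∧ ¬ P (m+1) := by
    by_contra hc
    push Not at hc
    have : ∀ m ≤ M, P m := by
      intro m
      induction m with
      | zero => intro _; exact h0
      | succ m ih => intro hm; exact hc m (by omega) (ih (by omega))
    exact hM (this M le_rfl)
  obtain ⟨I, h1, h2, h3, h4, h5⟩ := hPm
  refine ⟨univ.biUnion I, ?_, ?_, ?_, ?_⟩
  · refine card_biUnion_le.trans ?_
    simp only [h1, sum_const, card_univ, Fintype.card_fin, smul_eq_mul]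
    exact Nat.mul_le_mul_right _ hmM.le
  · rw [disjoint_biUnion_left]; exact fun a _ => h3 a
  · intro u hu w hw
    obtain ⟨a, _, ha⟩ := mem_biUnion.1 hw
    exact h4 a u hu w ha
  · intro S hS1 hS2 hS3
    by_contra hc
    push Not at hc
    obtain ⟨S', hS', hcard⟩ := exists_subset_card_eq hc
    have hSS : S' ⊆ S := hS'.trans sdiff_subset
    have hdis : ∀ a, Disjoint (I a) S' := by
      intro a
      rw [Finset.disjoint_left]
      intro x hx hx'
      exact (Finset.mem_sdiff.1 (hS' hx')).2 (mem_biUnion.2 ⟨a, mem_univ _, hx⟩)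
    apply hPm1
    refine ⟨Fin.snoc I S', ?_, ?_, ?_, ?_, ?_⟩
    · intro a
      refine Fin.lastCases ?_ (fun i => ?_) a
      · simpa using hcard
      · simpa using h1 i
    · intro a b
      refine Fin.lastCases ?_ (fun i => ?_) a
      · refine Fin.lastCases ?_ (fun i' => ?_) b
        · intro h; exact absurd rfl h
        · intro _; simpa using (hdis i').symm
      · refine Fin.lastCases ?_ (fun i' => ?_) b
        · intro _; simpa using (hdis i)
        · intro hne
          simpa using h2 i i' (fun h => hne (by rw [h]))
    · intro a
      refine Fin.lastCases ?_ (fun i => ?_) a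
      · simpa using disjoint_of_subset_left hSS hS1
      · simpa using h3 i
    · intro a
      refine Fin.lastCases ?_ (fun i => ?_) a
      · simpa using fun u hu w hw => hS2 u hu w (hSS hw)
      · simpa using h4 i
    · intro a
      refine Fin.lastCases ?_ (fun i => ?_) a
      · simpa using hS3.mono (by exact_mod_cast hSS)
      · simpa using h5 i

/-- available vertices for a color -/
noncomputable def avV (G : SimpleGraph V) (g : V → Option (Fin k)) (i : Fin k) : Finset V :=
  univ.filter fun v => LegalMove G g v i

lemma mem_avV {g : V → Option (Fin k)} {i : Fin k} {v : V} :
    v ∈ avV G g i ↔ LegalMove G g v i := by simp [avV]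

variable {f : ℕ → V → Option (Fin k)} {mv : ℕ → V × Fin k} {T : ℕ}

lemma avV_anti (R : Run G f mv T) {s t : ℕ} (hst : s ≤ t) (ht : t ≤ T) (i : Fin k) :
    avV G (f t) i ⊆ avV G (f s) i := by
  intro v hv
  rw [mem_avV] at hv ⊢
  exact R.legal_anti hst ht hv

lemma clsav_anti (R : Run G f mv T) {s t : ℕ} (hst : s ≤ t) (ht : t ≤ T) (i : Fin k) :
    cls (f t) i ∪ avV G (f t) i ⊆ cls (f s) i ∪ avV G (f s) i := by
  induction t, hst using Nat.le_induction with
  | base => exact subset_rfl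
  | succ t hst ih =>
    refine Subset.trans ?_ (ih (by omega))
    refine union_subset ?_ ((avV_anti R (by omega) ht i).trans subset_union_right)
    rw [R.cls_step (by omega)]
    split_ifs with h
    · refine insert_subset ?_ subset_union_left
      refine mem_union_right _ ?_
      rw [mem_avV, h]; exact R.legal t (by omega)
    · exact subset_union_left

lemma cls_nonadj (R : Run G f mv T) {τ t : ℕ} (hst : τ ≤ t) (ht : t ≤ T) (i : Fin k) :
    Disjoint (cls (f t) i \ cls (f τ) i) (cls (f τ) i) ∧
    ∀ u ∈ cls (f τ) i, ∀ w ∈ cls (f t) i \ cls (f τ) i, ¬ G.Adj u w := by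
  refine ⟨sdiff_disjoint, fun u hu w hw hadj => ?_⟩
  have hu' := R.cls_mono hst ht i hu
  have hw' := (Finset.mem_sdiff.1 hw).1
  simp only [cls, mem_filter, mem_univ, true_and] at hu' hw'
  exact R.proper ht u w i hadj hu' hw'

lemma avV_nonadj (R : Run G f mv T) {τ t : ℕ} (hst : τ ≤ t) (ht : t ≤ T) (i : Fin k) {w : V}
    (hw : w ∈ avV G (f t) i) : w ∉ cls (f τ) i ∧ ∀ u ∈ cls (f τ) i, ¬ G.Adj u w := by
  rw [mem_avV] at hw
  refine ⟨fun h => ?_, fun u hu hadj => ?_⟩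
  · simp only [cls, mem_filter, mem_univ, true_and] at h
    have h1 := hw.1; rw [R.mono hst ht h] at h1; cases h1
  · simp only [cls, mem_filter, mem_univ, true_and] at hu
    exact hw.2 u hadj (R.mono hst ht hu)

lemma reach_size (R : Run G f mv T) (i : Fin k) (t0 : ℕ) {t : ℕ} (ht : t ≤ T)
    (h : t0 ≤ (cls (f t) i).card) : ∃ τ ≤ t, (cls (f τ) i).card = t0 := by
  induction t with
  | zero =>
    refine ⟨0, le_rfl, ?_⟩
    have : (cls (f 0) i).card = 0 := by simp [cls, R.zero]
    omega
  | succ t ih =>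
    by_cases h' : t0 ≤ (cls (f t) i).card
    · obtain ⟨τ, h1, h2⟩ := ih (by omega) h'
      exact ⟨τ, by omega, h2⟩
    · refine ⟨t+1, le_rfl, ?_⟩
      have := R.cls_card_step (show t < T by omega) i
      split_ifs at this <;> omega

/-- invariant -/
def BInv (G : SimpleGraph V) (f : ℕ → V → Option (Fin k)) (Uf : Finset V → Finset V)
    (β : ℝ) (t0 a b r K t : ℕ) (i : Fin k) : Prop :=
  (cls (f t) i).card ≤ t0 ∨
  (∃ t' ≤ t, (cls (f t') i).card ≤ t0 + 2 * r + 1 ∧ (avV G (f t') i).card ≤ K + b) ∨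
  (∃ τ ≤ t, (cls (f τ) i).card = t0 ∧ a < (Uf (cls (f τ) i) ∩ avV G (f t) i).card ∧
    ((Uf (cls (f τ) i) ∩ avV G (f t) i).card : ℝ) ≤ b * β ^ (((cls (f t) i).card - t0) / 2)) ∨
  (∃ τ ≤ t, (cls (f τ) i).card = t0 ∧
    (Uf (cls (f τ) i) ∩ (cls (f t) i ∪ avV G (f t) i)).card ≤ a + 2 * r + 2)

theorem BInv_all (R : Run G f mv T) {p : ℝ} (hp0 : 0 ≤ p) (hp1 : p ≤ 1)
    (Uf : Finset V → Finset V) {t0 a b r K : ℕ}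
    (hU1 : ∀ C : Finset V, C.card = t0 → (Uf C).card ≤ b)
    (hU2 : ∀ C : Finset V, C.card = t0 → Disjoint (Uf C) C)
    (hA2 : PropA2 G p t0 a b K)
    (hr : b * (1 - p / 10) ^ r ≤ a)
    (hB1 : ∀ t, t % 2 = 0 → t + 1 < T → live G (f (t+1)) (mv t).2 → (mv (t+1)).2 = (mv t).2)
    (hB2 : ∀ t < T, t % 2 = 1 → ∀ τ ≤ t, (cls (f τ) (mv t).2).card = t0 →
      (∃ w, LegalMove G (f t) w (mv t).2 ∧
        p * (Uf (cls (f τ) (mv t).2) ∩ avV G (f t) (mv t).2).card / 10 <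
        (((Uf (cls (f τ) (mv t).2) ∩ avV G (f t) (mv t).2).filter fun u => G.Adj u w).card : ℝ)) →
        p * (Uf (cls (f τ) (mv t).2) ∩ avV G (f t) (mv t).2).card / 10 <
        (((Uf (cls (f τ) (mv t).2) ∩ avV G (f t) (mv t).2).filter fun u => G.Adj u (mv t).1).card : ℝ))
    (i : Fin k) : ∀ m, 2 * m ≤ T → BInv G f Uf (1 - p / 10) t0 a b r K (2 * m) i := by
  set β := 1 - p / 10 with hβ
  have β0 : 0 ≤ β := by rw [hβ]; linarith
  have β1 : β ≤ 1 := by rw [hβ]; linarith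
  intro m
  induction m with
  | zero => intro _; left; simp [cls, R.zero]
  | succ m ih =>
    intro hm
    have ih := ih (by omega)
    set t := 2 * m with ht
    have e2 : 2 * (m + 1) = t + 2 := by omega
    rw [e2] at hm ⊢
    -- size bound in states a and c
    have main : (cls (f t) i).card ≤ t0 + 2 * r →
        (∀ τ ≤ t, (cls (f τ) i).card = t0 →
          ((Uf (cls (f τ) i) ∩ avV G (f t) i).card : ℝ) ≤ b * β ^ (((cls (f t) i).card - t0) / 2)) →
        BInv G f Uf β t0 a b r K (t+2) i := by
      intro hs hφ
      by_cases hs2 : (cls (f (t+2)) i).card ≤ t0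
      · left; exact hs2
      push Not at hs2
      have st1 := R.cls_card_step (show t < T by omega) i
      have st2 := R.cls_card_step (show t + 1 < T by omega) i
      rw [show t + 1 + 1 = t + 2 by omega] at st2
      obtain ⟨τ, hτ, hτc⟩ := reach_size R i t0 hm hs2.le
      set U := Uf (cls (f τ) i) with hU
      by_cases hsm : (U ∩ avV G (f (t+2)) i).card ≤ a
      · right; right; right
        refine ⟨τ, hτ, hτc, ?_⟩
        rw [← hU, inter_union_distrib_left]
        refine (card_union_le _ _).trans ?_
        have hsub : cls (f τ) i ⊆ cls (f (t+2)) i := R.cls_mono hτ hm i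
        have h1 : (U ∩ cls (f (t+2)) i).card ≤ (cls (f (t+2)) i \ cls (f τ) i).card := by
          refine card_le_card fun x hx => ?_
          rw [mem_inter] at hx
          exact Finset.mem_sdiff.2 ⟨hx.2, Finset.disjoint_left.1 (hU2 _ hτc) hx.1⟩
        have h2 := card_sdiff_add_card_eq_card hsub
        have h3 : (cls (f (t+2)) i).card ≤ (cls (f t) i).card + 2 := by
          split_ifs at st1 st2 <;> omega
        omega
      push Not at hsm
      have hlive : live G (f (t+2)) i := by
        obtain ⟨v, hv⟩ := card_pos.1 (by omega : 0 < (U ∩ avV G (f (t+2)) i).card)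
        exact ⟨v, mem_avV.1 (mem_inter.1 hv).2⟩
      have hlive1 : live G (f (t+1)) i := by
        obtain ⟨v, hv⟩ := hlive
        exact ⟨v, R.legal_anti (by omega) hm hv⟩
      have hcd : i = (mv t).2 → i = (mv (t+1)).2 := by
        intro h
        rw [hB1 t (by omega) (by omega) (h ▸ hlive1)]; exact h
      have anti1 : U ∩ avV G (f (t+1)) i ⊆ U ∩ avV G (f t) i :=
        inter_subset_inter_left (avV_anti R (by omega) (by omega) i)
      have anti2 : U ∩ avV G (f (t+2)) i ⊆ U ∩ avV G (f (t+1)) i :=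
        inter_subset_inter_left (avV_anti R (by omega) (by omega) i)
      by_cases hd : i = (mv (t+1)).2
      · -- breaker move in color i
        rw [if_pos hd] at st2
        have hs1 : (cls (f (t+1)) i).card ≤ (cls (f t) i).card + 1 := by
          split_ifs at st1 <;> omega
        have hτ1 : τ ≤ t + 1 := by
          by_contra hc
          have : τ = t + 2 := by omega
          rw [this] at hτc; omega
        by_cases hw : ∃ w, LegalMove G (f (t+1)) w i ∧
            p * (U ∩ avV G (f (t+1)) i).card / 10 <
              (((U ∩ avV G (f (t+1)) i).filter fun u => G.Adj u w).card : ℝ)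
        · -- good move
          have hg := hB2 (t+1) (by omega) (by omega) τ hτ1 (by rw [← hd]; exact hτc)
          rw [← hd] at hg
          have hg := hg hw
          right; right; left
          refine ⟨τ, hτ, hτc, hsm, ?_⟩
          have hsub : U ∩ avV G (f (t+2)) i ⊆ (U ∩ avV G (f (t+1)) i).filter
              fun u => ¬ G.Adj u (mv (t+1)).1 := by
            intro u hu
            refine mem_filter.2 ⟨anti2 hu, fun hadj => ?_⟩
            have := mem_avV.1 (mem_inter.1 hu).2
            refine this.2 (mv (t+1)).1 hadj.symm ?_
            rw [show t + 2 = t + 1 + 1 by omega, R.step_eq (by omega), if_pos rfl, hd]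
          have hc1 := card_le_card hsub
          have hc2 := card_filter_add_card_filter_not (s := U ∩ avV G (f (t+1)) i)
            (fun u => G.Adj u (mv (t+1)).1)
          have hc1' : ((U ∩ avV G (f (t+2)) i).card : ℝ) ≤ ((U ∩ avV G (f (t+1)) i).filter
              fun u => ¬ G.Adj u (mv (t+1)).1).card := by exact_mod_cast hc1
          have hc2' : (((U ∩ avV G (f (t+1)) i).filter fun u => G.Adj u (mv (t+1)).1).card : ℝ) +
            ((U ∩ avV G (f (t+1)) i).filter fun u => ¬ G.Adj u (mv (t+1)).1).card =
            (U ∩ avV G (f (t+1)) i).card := by exact_mod_cast hc2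
          have hle : ((U ∩ avV G (f (t+2)) i).card : ℝ) ≤ β * (U ∩ avV G (f (t+1)) i).card := by
            rw [hβ]; linarith
          have hb1 : ((U ∩ avV G (f (t+1)) i).card : ℝ) ≤ b * β ^ (((cls (f t) i).card - t0) / 2) := by
            by_cases hτt : τ ≤ t
            · have h1 := hφ τ hτt hτc
              have : ((U ∩ avV G (f (t+1)) i).card : ℝ) ≤ (U ∩ avV G (f t) i).card := by
                exact_mod_cast card_le_card anti1
              linarith
            · have : τ = t + 1 := by omega
              have hz : ((cls (f t) i).card - t0) / 2 = 0 := by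
                rw [this] at hτc
                have : (cls (f t) i).card ≤ t0 := by rw [← hτc]; omega
                omega
              rw [hz, pow_zero, mul_one]
              exact_mod_cast (card_le_card inter_subset_left).trans (hU1 _ hτc)
          calc ((U ∩ avV G (f (t+2)) i).card : ℝ) ≤ β * (b * β ^ (((cls (f t) i).card - t0) / 2)) :=
                hle.trans (mul_le_mul_of_nonneg_left hb1 β0)
            _ = b * β ^ (((cls (f t) i).card - t0) / 2 + 1) := by rw [pow_succ]; ring
            _ ≤ _ := by
              refine mul_le_mul_of_nonneg_left (pow_le_pow_of_le_one β0 β1 ?_) (Nat.cast_nonneg _)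
              omega
        · -- exceptional
          right; left
          refine ⟨t+1, by omega, by omega, ?_⟩
          by_contra hbig
          push Not at hbig
          have hUb : (U ∩ avV G (f (t+1)) i).card ≤ b :=
            (card_le_card inter_subset_left).trans (hU1 _ hτc)
          have hWc : K ≤ (avV G (f (t+1)) i \ (U ∩ avV G (f (t+1)) i)).card := by
            have := card_sdiff_add_card_eq_card
              (inter_subset_right : U ∩ avV G (f (t+1)) i ⊆ avV G (f (t+1)) i)
            omega
          obtain ⟨W, hW, hWK⟩ := exists_subset_card_eq hWc
          have hWa : ∀ w ∈ W, w ∈ avV G (f (t+1)) i := fun w hw' => (Finset.mem_sdiff.1 (hW hw')).1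
          obtain ⟨w, hwW, hw2⟩ := hA2 (cls (f τ) i) (U ∩ avV G (f (t+1)) i) W hτc
            (hsm.le.trans (card_le_card anti2)) hUb hWK
            (disjoint_of_subset_right inter_subset_left (hU2 _ hτc).symm)
            (by rw [Finset.disjoint_left]
                intro x hx
                exact (avV_nonadj R hτ1 (by omega) i (hWa x hx)).1)
            (by rw [Finset.disjoint_left]
                intro x hx
                exact (Finset.mem_sdiff.1 (hW hx)).2)
            (fun w hw' => (avV_nonadj R hτ1 (by omega) i (hWa w hw')).2)
          exact hw ⟨w, mem_avV.1 (hWa w hwW), hw2⟩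
      · -- no move in color i
        have hc : i ≠ (mv t).2 := fun h => hd (hcd h)
        rw [if_neg hd] at st2
        rw [if_neg hc] at st1
        have hτt : τ ≤ t := by
          by_contra hc'
          have : τ = t + 1 ∨ τ = t + 2 := by omega
          rcases this with h | h <;> rw [h] at hτc <;> omega
        right; right; left
        refine ⟨τ, hτ, hτc, hsm, ?_⟩
        have h1 := hφ τ hτt hτc
        have h2 : ((U ∩ avV G (f (t+2)) i).card : ℝ) ≤ (U ∩ avV G (f t) i).card := by
          exact_mod_cast card_le_card (anti2.trans anti1)
        rw [st2, st1, add_zero, add_zero]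
        exact h2.trans h1
    have uniq : ∀ τ τ', τ ≤ t → τ' ≤ t → (cls (f τ) i).card = t0 → (cls (f τ') i).card = t0 →
        cls (f τ) i = cls (f τ') i := by
      intro τ τ' h1 h2 h3 h4
      rcases le_total τ τ' with h | h
      · exact eq_of_subset_of_card_le (R.cls_mono h (by omega) i) (by omega)
      · exact (eq_of_subset_of_card_le (R.cls_mono h (by omega) i) (by omega)).symm
    rcases ih with h | h | h | h
    · refine main (by omega) ?_
      intro τ hτ hτc
      rw [show ((cls (f t) i).card - t0) / 2 = 0 by omega, pow_zero, mul_one]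
      exact_mod_cast (card_le_card inter_subset_left).trans (hU1 _ hτc)
    · obtain ⟨t', h1, h2⟩ := h
      right; left; exact ⟨t', by omega, h2⟩
    · obtain ⟨τ, hτ, hτc, h1, h2⟩ := h
      refine main ?_ ?_
      · by_contra hcon
        push Not at hcon
        have h3 : (b:ℝ) * β ^ (((cls (f t) i).card - t0) / 2) ≤ b * β ^ r := by
          refine mul_le_mul_of_nonneg_left (pow_le_pow_of_le_one β0 β1 ?_) (Nat.cast_nonneg _)
          omega
        have h1' : (a:ℝ) < (Uf (cls (f τ) i) ∩ avV G (f t) i).card := by exact_mod_cast h1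
        linarith
      · intro τ' hτ' hτc'
        rw [← uniq τ τ' hτ hτ' hτc hτc']
        exact h2
    · obtain ⟨τ, hτ, hτc, h1⟩ := h
      right; right; right
      refine ⟨τ, by omega, hτc, le_trans (card_le_card ?_) h1⟩
      exact inter_subset_inter_left (clsav_anti R (by omega) hm i)

theorem breaker_core (R : Run G f mv T) {p h : ℝ} (hp0 : 0 ≤ p) (hp1 : p ≤ 1) (hh : 0 ≤ h)
    (hk : k ≤ Fintype.card V) (hc : Conc G (1 - p) h)
    (Uf : Finset V → Finset V) {t0 z a b r K s : ℕ} (hα : AlphaLT G s)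
    (hU3 : ∀ C : Finset V, C.card = t0 → ∀ I : Finset V, Disjoint I C →
      (∀ u ∈ C, ∀ w ∈ I, ¬ G.Adj u w) → G.IsIndepSet (I : Set V) → (I \ Uf C).card < z)
    (hr : b * (1 - p / 10) ^ r ≤ a) (m : ℕ) (hm : 2 * m ≤ T)
    (hinv : ∀ i, BInv G f Uf (1 - p / 10) t0 a b r K (2 * m) i)
    (E : ℝ) (hE0 : 0 ≤ E)
    (hE : h * (Fintype.card V + 1) < E * (((Fintype.card V : ℝ) - 2 * m) * (1 - p) ^ (t0 + 2 * r + 1) / 2 -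
      h * (t0 + 2 * r + 2) - (K + b)))
    (hfin : (k:ℝ) * (t0 + z + a + 2 * r + 2) + E * s < 2 * m) : False := by
  have q0 : 0 ≤ 1 - p := by linarith
  have q1 : 1 - p ≤ 1 := by linarith
  have β0 : 0 ≤ 1 - p / 10 := by linarith
  have β1 : 1 - p / 10 ≤ 1 := by linarith
  set ex : Fin k → Prop := fun i => ∃ t' ≤ 2 * m, (cls (f t') i).card ≤ t0 + 2 * r + 1 ∧
    (avV G (f t') i).card ≤ K + b with hex
  have hnon : ∀ i, ¬ ex i → (cls (f (2*m)) i).card ≤ t0 + z + a + 2 * r + 2 := by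
    intro i hi
    rcases hinv i with h | h | h | h
    · omega
    · exact absurd h hi
    · obtain ⟨τ, hτ, hτc, h1, h2⟩ := h
      by_contra hcon
      push Not at hcon
      have h3 : (b:ℝ) * (1 - p/10) ^ (((cls (f (2*m)) i).card - t0) / 2) ≤ b * (1-p/10) ^ r := by
        refine mul_le_mul_of_nonneg_left (pow_le_pow_of_le_one β0 β1 ?_) (Nat.cast_nonneg _)
        omega
      have h1' : (a:ℝ) < (Uf (cls (f τ) i) ∩ avV G (f (2*m)) i).card := by exact_mod_cast h1
      linarith
    · obtain ⟨τ, hτ, hτc, h1⟩ := h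
      obtain ⟨hd, hn⟩ := cls_nonadj R hτ hm i
      have h2 := hU3 _ hτc _ hd hn ((R.indep hm i).mono (by
        intro x hx; exact (Finset.mem_sdiff.1 (by exact_mod_cast hx)).1))
      have hsub : cls (f τ) i ⊆ cls (f (2*m)) i := R.cls_mono hτ hm i
      have h3 := card_sdiff_add_card_eq_card hsub
      have h4 := card_sdiff_add_card_inter (cls (f (2*m)) i \ cls (f τ) i) (Uf (cls (f τ) i))
      have h5 : ((cls (f (2*m)) i \ cls (f τ) i) ∩ (Uf (cls (f τ) i))).card ≤
          (Uf (cls (f τ) i) ∩ (cls (f (2*m)) i ∪ avV G (f (2*m)) i)).card := by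
        refine card_le_card fun x hx => ?_
        rw [mem_inter, Finset.mem_sdiff] at hx
        exact mem_inter.2 ⟨hx.2, mem_union_left _ hx.1.1⟩
      omega
  set I := univ.filter ex with hI
  have hI' : ∀ i, i ∈ I ↔ ex i := by intro i; simp [hI]
  have hch : ∀ i, ∃ t', i ∈ I → t' ≤ 2 * m ∧ (cls (f t') i).card ≤ t0 + 2 * r + 1 ∧
      (avV G (f t') i).card ≤ K + b := by
    intro i
    by_cases hi : i ∈ I
    · obtain ⟨t', h⟩ := (hI' i).1 hi
      exact ⟨t', fun _ => h⟩
    · exact ⟨0, fun h => absurd h hi⟩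
  choose θ hθ using hch
  -- restricted coloring
  set g : V → Option (Fin k) := fun v => (f (2*m) v).bind fun i => f (θ i ⊓ (2*m)) v with hg
  have hgi : ∀ i ∈ I, ∀ v, g v = some i ↔ f (θ i) v = some i := by
    intro i hi v
    have hθi := hθ i hi
    simp only [hg]
    constructor
    · intro hh'
      cases hv : f (2*m) v with
      | none => rw [hv] at hh'; simp at hh'
      | some j =>
        rw [hv] at hh'
        simp only [Option.bind_some] at hh'
        have := R.mono (min_le_right _ _) hm hh'
        rw [hv] at this
        have hji : j = i := by simpa using this
        subst hji
        rwa [min_eq_left hθi.1] at hh'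
    · intro hv
      rw [R.mono hθi.1 hm hv]
      simp only [Option.bind_some]
      rw [min_eq_left hθi.1]; exact hv
  set X := univ.filter fun v => f (2*m) v = none with hX
  have hXc : (X.card : ℝ) = Fintype.card V - 2 * m := by
    have h1 := card_filter_add_card_filter_not (s := (univ : Finset V)) (fun v => f (2*m) v = none)
    have h2 := R.card_dom hm
    rw [card_univ] at h1
    have : X.card + 2 * m = Fintype.card V := by
      change X.card + (univ.filter fun u => f (2*m) u ≠ none).card = _ at h1
      omega
    rw [← this]; push_cast; ring
  have hXn : ∀ v ∈ X, g v = none := by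
    intro v hv
    simp [hg, (mem_filter.1 hv).2]
  have hlow := (hc.restr hk g I X hXn).1
  have hcls : ∀ i ∈ I, cls g i = cls (f (θ i)) i := by
    intro i hi; ext v; simp [cls, hgi i hi v]
  have up : ∑ i ∈ I, ((X.filter fun v => LegalMove G g v i).card : ℝ) ≤ I.card * (K + b) := by
    have : ∑ i ∈ I, ((X.filter fun v => LegalMove G g v i).card : ℝ) ≤ ∑ i ∈ I, ((K:ℝ) + b) := by
      refine sum_le_sum fun i hi => ?_
      have h1 : (X.filter fun v => LegalMove G g v i) ⊆ avV G (f (θ i)) i := by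
        intro v hv
        rw [mem_filter] at hv
        rw [mem_avV]
        refine ⟨R.none_of (hθ i hi).1 hm (mem_filter.1 hv.1).2, fun u hu hcol => ?_⟩
        exact hv.2.2 u hu ((hgi i hi u).2 hcol)
      exact_mod_cast (card_le_card h1).trans (hθ i hi).2.2
    rwa [sum_const, nsmul_eq_mul] at this
  have lo1 : (I.card : ℝ) * (1 - p) ^ (t0 + 2 * r + 1) ≤ ∑ i ∈ I, (1 - p) ^ (cls g i).card := by
    have : ∑ i ∈ I, (1 - p) ^ (t0 + 2 * r + 1) ≤ ∑ i ∈ I, (1 - p) ^ (cls g i).card := by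
      refine sum_le_sum fun i hi => pow_le_pow_of_le_one q0 q1 ?_
      rw [hcls i hi]; exact (hθ i hi).2.1
    simpa using this
  have lo2 : ((∑ i ∈ I, (cls g i).card : ℕ) : ℝ) ≤ I.card * (t0 + 2 * r + 1) := by
    have : ∑ i ∈ I, (cls g i).card ≤ ∑ i ∈ I, (t0 + 2 * r + 1) := by
      refine sum_le_sum fun i hi => ?_
      rw [hcls i hi]; exact (hθ i hi).2.1
    rw [sum_const, smul_eq_mul] at this
    exact_mod_cast this
  have hX0 : (0:ℝ) ≤ X.card := Nat.cast_nonneg _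
  have hXle : (X.card : ℝ) ≤ Fintype.card V := by exact_mod_cast card_le_univ X
  have hIE : (I.card : ℝ) ≤ E := by
    by_contra hcon
    push Not at hcon
    set D := ((Fintype.card V : ℝ) - 2 * m) * (1 - p) ^ (t0 + 2 * r + 1) / 2 -
      h * (t0 + 2 * r + 2) - (K + b) with hD
    have hn0 : 0 ≤ h * ((Fintype.card V : ℝ) + 1) := by positivity
    have hDpos : 0 < D := by
      by_contra hneg
      push Not at hneg
      nlinarith
    have k1 : (X.card : ℝ) * ((I.card : ℝ) * (1 - p) ^ (t0 + 2 * r + 1)) ≤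
      X.card * ∑ i ∈ I, (1 - p) ^ (cls g i).card := mul_le_mul_of_nonneg_left lo1 hX0
    have k2 : h * ((X.card : ℝ) + (∑ i ∈ I, (cls g i).card : ℕ) + I.card + 1) ≤
        h * (Fintype.card V + 1) + I.card * (h * (t0 + 2 * r + 2)) := by
      calc _ ≤ h * ((Fintype.card V : ℝ) + I.card * (t0 + 2 * r + 1) + I.card + 1) := by gcongr
        _ = _ := by ring
    have k3 : (I.card : ℝ) * D ≤ h * (Fintype.card V + 1) := by
      rw [hD, ← hXc]
      nlinarith
    nlinarith
  have hsum := R.sum_cls hm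
  have hb : ∀ i, ((cls (f (2*m)) i).card : ℝ) ≤ (t0 + z + a + 2 * r + 2) + if i ∈ I then (s:ℝ) else 0 := by
    intro i
    split_ifs with hi
    · have := R.cls_lt hα hm i
      have : ((cls (f (2*m)) i).card : ℝ) ≤ s := by exact_mod_cast this.le
      have h0 : (0:ℝ) ≤ t0 + z + a + 2 * r + 2 := by positivity
      linarith
    · rw [add_zero]
      exact_mod_cast hnon i (fun h => hi ((hI' i).2 h))
  have htot : (2 * m : ℝ) ≤ k * (t0 + z + a + 2 * r + 2) + I.card * s := by
    have h1 : (2 * m : ℝ) = ∑ i, ((cls (f (2*m)) i).card : ℝ) := by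
      have : ((∑ i, (cls (f (2*m)) i).card : ℕ) : ℝ) = ((2 * m : ℕ) : ℝ) := by rw [hsum]
      push_cast at this; exact this.symm
    rw [h1]
    refine (sum_le_sum fun i _ => hb i).trans ?_
    rw [sum_add_distrib, ← sum_filter, sum_const, sum_const, filter_mem_eq_inter, univ_inter, card_univ,
      Fintype.card_fin, nsmul_eq_mul, nsmul_eq_mul]
  have : (I.card : ℝ) * s ≤ E * s := mul_le_mul_of_nonneg_right hIE (Nat.cast_nonneg _)
  linarith

end BreakerSec

open MeasureTheory Filter Finset

set_option linter.unusedSectionVars false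
set_option linter.unusedVariables false

section BreakerWinSec
open scoped Classical
variable {V : Type*} [Fintype V]

noncomputable def stSeq {k : ℕ} (σM : Strategy V k)
    (rule : Fin k → (Fin k → Finset V) → (V → Option (Fin k)) → V × Fin k) (t0 : ℕ) (c0 : Fin k) :
    ℕ → (V → Option (Fin k)) × Fin k × (Fin k → Finset V)
  | 0 => (fun _ => none, c0, fun _ => ∅)
  | t + 1 =>
    let S := stSeq σM rule t0 c0 t
    let m := if t % 2 = 0 then σM S.1 else rule S.2.1 S.2.2 S.1
    let g := Function.update S.1 m.1 (some m.2)
    (g, m.2, fun j => if (cls g j).card = t0 then cls g j else S.2.2 j)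

end BreakerWinSec

section BreakerWinSec2
variable {V : Type*} [Fintype V] [DecidableEq V]

lemma play_frozen {k : ℕ} (G : SimpleGraph V) (σM σB : Strategy V k) (t : ℕ)
    (h : ¬ ∃ v c, LegalMove G (play G σM σB t) v c) (s : ℕ) (hs : t ≤ s) :
    play G σM σB s = play G σM σB t := by
  induction s, hs using Nat.le_induction with
  | base => rfl
  | succ s hs ih =>
    rw [play]
    rw [← ih] at h
    simp only [if_neg h]
    exact ih

open scoped Classical in
theorem breaker_wins {V : Type*} [Fintype V] [hdec : DecidableEq V] (G : SimpleGraph V) (k : ℕ) {p h : ℝ} (hp0 : 0 ≤ p) (hp1 : p ≤ 1) (hh : 0 ≤ h)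
    (hk : k ≤ Fintype.card V) (hc : Conc G (1 - p) h)
    {t0 z a M r K s : ℕ} (ht0 : 1 ≤ t0) (hα : AlphaLT G s)
    (hA1 : PropA1 G t0 z M) (hA2 : PropA2 G p t0 a (M * z) K)
    (hr : ((M * z : ℕ) : ℝ) * (1 - p / 10) ^ r ≤ a) (m : ℕ) (hm : 2 * m ≤ Fintype.card V)
    (E : ℝ) (hE0 : 0 ≤ E)
    (hE : h * (Fintype.card V + 1) < E * (((Fintype.card V : ℝ) - 2 * m) * (1 - p) ^ (t0 + 2 * r + 1) / 2 -
      h * (t0 + 2 * r + 2) - (K + (M * z : ℕ))))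
    (hfin : (k:ℝ) * (t0 + z + a + 2 * r + 2) + E * s < 2 * m) : ¬ MakerWins G k := by
  obtain rfl : hdec = (fun a b => Classical.propDecidable (a = b)) := Subsingleton.elim _ _
  rintro ⟨σM, hM, hwin⟩
  have hUex : ∀ C : Finset V, ∃ U : Finset V, C.card = t0 → U.card ≤ M * z ∧ Disjoint U C ∧
      ∀ I : Finset V, Disjoint I C → (∀ u ∈ C, ∀ w ∈ I, ¬ G.Adj u w) → G.IsIndepSet (I : Set V) →
        (I \ U).card < z := by
    intro C
    by_cases hC : C.card = t0
    · obtain ⟨U, h1, h2, _, h4⟩ := exists_U G hA1 C hC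
      exact ⟨U, fun _ => ⟨h1, h2, h4⟩⟩
    · exact ⟨∅, fun h => absurd h hC⟩
  choose Uf hUf using hUex
  set c0 : Fin k := (σM fun _ => none).2 with hc0
  have hrule : ∀ (c : Fin k) (C0 : Fin k → Finset V) (g : V → Option (Fin k)), ∃ mm : V × Fin k,
      (∃ v c, LegalMove G g v c) → LegalMove G g mm.1 mm.2 ∧ (live G g c → mm.2 = c) ∧
      ((∃ w, LegalMove G g w mm.2 ∧ p * (Uf (C0 mm.2) ∩ avV G g mm.2).card / 10 <
        (((Uf (C0 mm.2) ∩ avV G g mm.2).filter fun u => G.Adj u w).card : ℝ)) →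
        p * (Uf (C0 mm.2) ∩ avV G g mm.2).card / 10 <
        (((Uf (C0 mm.2) ∩ avV G g mm.2).filter fun u => G.Adj u mm.1).card : ℝ)) := by
    intro c C0 g
    by_cases hex : ∃ v c, LegalMove G g v c
    · obtain ⟨j, hj, hjc⟩ : ∃ j, live G g j ∧ (live G g c → j = c) := by
        by_cases hl : live G g c
        · exact ⟨c, hl, fun _ => rfl⟩
        · obtain ⟨v, j, hv⟩ := hex
          exact ⟨j, ⟨v, hv⟩, fun h => absurd h hl⟩
      by_cases hw : ∃ w, LegalMove G g w j ∧ p * (Uf (C0 j) ∩ avV G g j).card / 10 <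
        (((Uf (C0 j) ∩ avV G g j).filter fun u => G.Adj u w).card : ℝ)
      · obtain ⟨w, h1, h2⟩ := hw
        exact ⟨(w, j), fun _ => ⟨h1, hjc, fun _ => h2⟩⟩
      · obtain ⟨v, hv⟩ := hj
        exact ⟨(v, j), fun _ => ⟨hv, hjc, fun h => absurd h hw⟩⟩
    · exact ⟨σM g, fun h => absurd h hex⟩
  choose rule hrule using hrule
  set st := stSeq σM rule t0 c0 with hst
  set σB : Strategy V k := fun g =>
    if (st (univ.filter fun u => g u ≠ none).card).1 = g then
      rule (st (univ.filter fun u => g u ≠ none).card).2.1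
        (st (univ.filter fun u => g u ≠ none).card).2.2 g
    else rule c0 (fun _ => ∅) g with hσB
  have hB : σB.IsLegal G := by
    intro g hg
    simp only [hσB]
    split_ifs
    · exact (hrule _ _ g hg).1
    · exact (hrule _ _ g hg).1
  have hnofreeze : ∀ t < Fintype.card V, ∃ v c, LegalMove G (play G σM σB t) v c := by
    intro t
    induction t using Nat.strong_induction_on with
    | _ t ih =>
      intro ht
      by_contra hfr
      have R := play_run G σM σB hM hB t (fun s hs => ih s hs (by omega))
      have hcd := R.card_dom le_rfl
      have hall : ∀ v, play G σM σB t v ≠ none := by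
        intro v
        rw [← play_frozen G σM σB t hfr _ ht.le]
        exact hwin σB hB v
      rw [filter_true_of_mem (fun u _ => hall u), card_univ] at hcd
      omega
  have R := play_run G σM σB hM hB _ hnofreeze
  set n := Fintype.card V with hn
  have hst1 : ∀ t, (st (t+1)).1 = Function.update (st t).1
      (if t % 2 = 0 then σM (st t).1 else rule (st t).2.1 (st t).2.2 (st t).1).1
      (some (if t % 2 = 0 then σM (st t).1 else rule (st t).2.1 (st t).2.2 (st t).1).2) := by
    intro t; rw [hst, stSeq]
  have hst2 : ∀ t, (st (t+1)).2.1 =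
      (if t % 2 = 0 then σM (st t).1 else rule (st t).2.1 (st t).2.2 (st t).1).2 := by
    intro t; rw [hst, stSeq]
  have hst3 : ∀ t, (st (t+1)).2.2 =
      fun j => if (cls (st (t+1)).1 j).card = t0 then cls (st (t+1)).1 j else (st t).2.2 j := by
    intro t; rw [hst, stSeq]
  have hσBt : ∀ t ≤ n, play G σM σB t = (st t).1 →
      σB (play G σM σB t) = rule (st t).2.1 (st t).2.2 (st t).1 := by
    intro t ht hpl
    have hcd := R.card_dom ht
    simp only [hσB]
    rw [← hσB, hcd, if_pos hpl.symm, hpl]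
  have hmvt : ∀ t ≤ n, play G σM σB t = (st t).1 → playMv G σM σB t =
      (if t % 2 = 0 then σM (st t).1 else rule (st t).2.1 (st t).2.2 (st t).1) := by
    intro t ht hpl
    unfold playMv
    rw [hσBt t ht hpl, hpl]
  have hplay : ∀ t ≤ n, play G σM σB t = (st t).1 := by
    intro t
    induction t with
    | zero => intro _; rfl
    | succ t ih =>
      intro ht
      have ih := ih (by omega)
      rw [R.step t (by omega), hst1, hmvt t (by omega) ih, ih]
  have hC0 : ∀ j, ∀ t ≤ n, ∀ τ ≤ t, (cls (play G σM σB τ) j).card = t0 →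
      (st t).2.2 j = cls (play G σM σB τ) j := by
    intro j t
    induction t with
    | zero =>
      intro _ τ hτ hc
      have : τ = 0 := by omega
      subst this
      simp [cls, play] at hc
      omega
    | succ t ih =>
      intro ht τ hτ hc
      rw [hst3, ← hplay (t+1) ht]
      simp only []
      split_ifs with hcc
      · exact (eq_of_subset_of_card_le (R.cls_mono hτ ht j) (by omega)).symm
      · have : τ ≠ t + 1 := by rintro rfl; exact hcc hc
        exact ih (by omega) τ (by omega) hc
  refine breaker_core R hp0 hp1 hh hk hc Uf hα (fun C hC => (hUf C hC).2.2) hr m hm ?_ E hE0 hE hfin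
  intro i
  refine BInv_all R hp0 hp1 Uf (fun C hC => (hUf C hC).1) (fun C hC => (hUf C hC).2.1) hA2 hr ?_ ?_ i m hm
  · intro t ht htn hl
    rw [hmvt (t+1) (by omega) (hplay _ (by omega)), if_neg (by omega)]
    have h2 := hst2 t
    rw [← hmvt t (by omega) (hplay _ (by omega))] at h2
    rw [← h2] at hl ⊢
    rw [hplay _ (by omega)] at hl
    refine (hrule _ _ _ ?_).2.1 hl
    obtain ⟨v, hv⟩ := hl
    exact ⟨v, _, hv⟩
  · intro t ht hodd τ hτ hτc
    have e := hmvt t (by omega) (hplay _ (by omega))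
    rw [if_neg (by omega)] at e
    have := (hrule (st t).2.1 (st t).2.2 (st t).1 (by
      rw [← hplay t (by omega)]; exact hnofreeze t ht)).2.2
    rw [← e, hC0 _ t (by omega) τ hτ hτc, ← hplay t (by omega)] at this
    exact this

end BreakerWinSec2

open MeasureTheory Filter Finset
set_option linter.unusedSectionVars false
set_option linter.unusedVariables false

section Asym

def Whp (p : ℕ → ℝ) (P : ∀ n, (EdgeIdx n → Bool) → Prop) : Prop :=
  Tendsto (fun n => Pr (p n) (fun ω => ¬ P n ω)) atTop (nhds 0)

lemma Whp.of_bound {p : ℕ → ℝ} (h0 : ∀ n, 0 ≤ p n) (h1 : ∀ n, p n ≤ 1)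
    {P : ∀ n, (EdgeIdx n → Bool) → Prop} {f : ℕ → ℝ} (hf : Tendsto f atTop (nhds 0))
    (h : ∀ᶠ n in atTop, Pr (p n) (fun ω => ¬ P n ω) ≤ f n) : Whp p P :=
  tendsto_of_tendsto_of_tendsto_of_le_of_le' tendsto_const_nhds hf
    (Eventually.of_forall fun n => Pr_nonneg (h0 n) (h1 n) _) h

lemma Whp.mono {p : ℕ → ℝ} (h0 : ∀ n, 0 ≤ p n) (h1 : ∀ n, p n ≤ 1)
    {P Q : ∀ n, (EdgeIdx n → Bool) → Prop} (hP : Whp p P)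
    (h : ∀ᶠ n in atTop, ∀ ω, P n ω → Q n ω) : Whp p Q := by
  refine Whp.of_bound h0 h1 hP ?_
  filter_upwards [h] with n hn
  exact Pr_mono (h0 n) (h1 n) (fun ω hω hP => hω (hn ω hP))

lemma Whp.and {p : ℕ → ℝ} (h0 : ∀ n, 0 ≤ p n) (h1 : ∀ n, p n ≤ 1)
    {P Q : ∀ n, (EdgeIdx n → Bool) → Prop} (hP : Whp p P) (hQ : Whp p Q) :
    Whp p (fun n ω => P n ω ∧ Q n ω) := by
  have := Tendsto.add hP hQ
  rw [add_zero] at this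
  refine Whp.of_bound h0 h1 this (Eventually.of_forall fun n => ?_)
  refine le_trans (Pr_mono (h0 n) (h1 n) (Q := fun ω => ¬ P n ω ∨ ¬ Q n ω) ?_)
    (Pr_or (h0 n) (h1 n) _ _)
  intro ω hω
  tauto

/-- powers of n written through exp -/
noncomputable def en (c : ℝ) (n : ℕ) : ℝ := Real.exp (c * Real.log n)

lemma en_pos (c n) : 0 < en c n := Real.exp_pos _
lemma en_add (a b : ℝ) (n : ℕ) : en (a + b) n = en a n * en b n := by
  unfold en; rw [← Real.exp_add]; ring_nf
lemma en_one {n : ℕ} (h : 1 ≤ n) : en 1 n = n := by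
  unfold en; rw [one_mul, Real.exp_log]; exact_mod_cast h
lemma en_mono {a b : ℝ} (h : a ≤ b) (n : ℕ) : en a n ≤ en b n := by
  unfold en
  apply Real.exp_le_exp.2
  exact mul_le_mul_of_nonneg_right h (Real.log_natCast_nonneg n)
lemma en_pow (a : ℝ) (n k : ℕ) : (en a n) ^ k = en (a * k) n := by
  unfold en; rw [← Real.exp_nat_mul]; ring_nf
lemma en_neg (a : ℝ) (n : ℕ) : en (-a) n = (en a n)⁻¹ := by
  unfold en; rw [← Real.exp_neg]; ring_nf
lemma en_zero (n : ℕ) : en 0 n = 1 := by simp [en]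

lemma log_tendsto : Tendsto (fun n : ℕ => Real.log n) atTop atTop :=
  Real.tendsto_log_atTop.comp tendsto_natCast_atTop_atTop

lemma en_tendsto {c : ℝ} (hc : 0 < c) : Tendsto (en c) atTop atTop := by
  unfold en
  exact Real.tendsto_exp_atTop.comp (log_tendsto.const_mul_atTop hc)

lemma en_tendsto_zero {c : ℝ} (hc : c < 0) : Tendsto (en c) atTop (nhds 0) := by
  have := (en_tendsto (c := -c) (by linarith)).inv_tendsto_atTop
  refine this.congr fun n => ?_
  simp [← en_neg]

structure Reg (η p : ℝ) (n : ℕ) (γ C L : ℝ) : Prop where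
  hη : 0 < η
  hη1 : η < 1
  hp : 0 < p
  hpη : p ≤ 1 - η
  hn : 2 ≤ n
  hL : L = Real.log n / (-Real.log (1 - p))
  hLpos : 0 < L
  CpL : C ≤ p * L
  CL : C ≤ L
  Cx : C ≤ Real.log n
  Lu : C * L ≤ en γ n
  xu : C * Real.log n ≤ en γ n
  Cu : C ≤ en γ n
  pu : en (-γ) n ≤ p
  qL : ∀ c : ℝ, (1 - p) ^ (c * L) = en (-c) n

noncomputable def LL (p : ℕ → ℝ) (n : ℕ) : ℝ := Real.log n / (-Real.log (1 - p n))

lemma log_sq_le (C : ℝ) {γ : ℝ} (hγ : 0 < γ) :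
    ∀ᶠ n : ℕ in atTop, C * Real.log n ≤ en γ n := by
  have h := (Real.isLittleO_pow_exp_atTop (n := 1)).comp_tendsto
    (log_tendsto.const_mul_atTop hγ)
  have h2 := h.bound (c := γ / (|C| + 1)) (by positivity)
  filter_upwards [h2] with n hn
  simp only [Function.comp, pow_one, Real.norm_eq_abs, Real.abs_exp] at hn
  have hx := Real.log_natCast_nonneg n
  rw [abs_of_nonneg (by positivity)] at hn
  unfold en
  rw [div_mul_eq_mul_div, le_div_iff₀ (by positivity), mul_assoc] at hn
  have := le_of_mul_le_mul_left hn hγ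
  nlinarith [le_abs_self C]

lemma reg_eventually {η : ℝ} (hη0 : 0 < η) (hη1 : η < 1) {p : ℕ → ℝ} (hp0 : ∀ n, 0 < p n)
    (hp1 : ∀ n, p n ≤ 1 - η)
    (hpbig : Tendsto (fun n => Real.log (1 / p n) / Real.log n) atTop (nhds 0))
    {γ : ℝ} (hγ : 0 < γ) (C : ℝ) :
    ∀ᶠ n in atTop, Reg η (p n) n γ C (LL p n) := by
  have e1 := hpbig.eventually (gt_mem_nhds (show (0:ℝ) < γ / 2 by linarith))
  have e2 := log_tendsto.eventually (eventually_ge_atTop ((|C| + 1) / η))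
  have e3 := log_sq_le (|C| + 1) (show 0 < γ / 2 by linarith)
  filter_upwards [e1, e2, e3, eventually_ge_atTop 2] with n h1 h2 h3 hn
  have hp := hp0 n
  have hpη := hp1 n
  have hq : η ≤ 1 - p n := by linarith
  have hxη : |C| + 1 ≤ η * Real.log n := by rwa [div_le_iff₀' hη0] at h2
  have hx : 0 < Real.log n := by
    have : 0 ≤ |C| := abs_nonneg C
    by_contra hh
    nlinarith
  have hCx : |C| + 1 ≤ Real.log n := by nlinarith
  have hl1 : p n ≤ -Real.log (1 - p n) := by
    have := Real.log_le_sub_one_of_pos (show 0 < 1 - p n by linarith)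
    linarith
  have hl2 : -Real.log (1 - p n) ≤ p n / η := by
    have := Real.one_sub_inv_le_log_of_pos (show 0 < 1 - p n by linarith)
    have h3 : (1 - p n)⁻¹ - 1 ≤ p n / η := by
      have : (1 - p n)⁻¹ - 1 = p n / (1 - p n) := by
        have : 1 - p n ≠ 0 := by linarith
        field_simp; ring
      rw [this]
      exact div_le_div_of_nonneg_left hp.le hη0 hq
    linarith
  have hl0 : 0 < -Real.log (1 - p n) := by linarith
  have hpL : |C| + 1 ≤ p n * LL p n := by
    have : η * Real.log n ≤ p n * LL p n := by
      unfold LL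
      rw [mul_div_assoc', le_div_iff₀ hl0]
      have : η * -Real.log (1 - p n) ≤ p n := by
        rwa [le_div_iff₀' hη0] at hl2
      nlinarith
    linarith
  have hL0 : 0 < LL p n := by unfold LL; positivity
  have hpu : en (-(γ/2)) n ≤ p n := by
    rw [div_lt_iff₀ hx, one_div, Real.log_inv] at h1
    unfold en
    rw [← Real.le_log_iff_exp_le hp]
    linarith
  have hxu : |C| + 1 ≤ |C| * Real.log n + Real.log n := by
    nlinarith [abs_nonneg C]
  have hm : en (γ/2) n ≤ en γ n := en_mono (by linarith) n
  have hpu2 : (p n)⁻¹ ≤ en (γ/2) n := by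
    rw [en_neg] at hpu
    exact inv_le_of_inv_le₀ (en_pos _ _) hpu
  refine ⟨hη0, hη1, hp, hpη, hn, rfl, hL0, by linarith [le_abs_self C], ?_, by linarith [le_abs_self C],
    ?_, ?_, ?_, ?_, ?_⟩
  · nlinarith [le_abs_self C]
  · have h4 : LL p n ≤ Real.log n * (p n)⁻¹ := by
      unfold LL
      rw [div_eq_mul_inv]
      exact mul_le_mul_of_nonneg_left (inv_anti₀ hp hl1) hx.le
    calc C * LL p n ≤ (|C| + 1) * LL p n := by nlinarith [le_abs_self C]
      _ ≤ (|C| + 1) * (Real.log n * (p n)⁻¹) := by gcongr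
      _ = ((|C| + 1) * Real.log n) * (p n)⁻¹ := by ring
      _ ≤ en (γ/2) n * en (γ/2) n := by gcongr; exact (en_pos _ _).le
      _ = en γ n := by rw [← en_add]; ring_nf
  · nlinarith [le_abs_self C]
  · nlinarith [le_abs_self C]
  · exact le_trans (en_mono (by linarith) n) hpu
  · intro c
    rw [Real.rpow_def_of_pos (by linarith)]
    unfold en LL
    congr 1
    have hne : Real.log (1 - p n) ≠ 0 := by linarith
    rw [div_neg]
    field_simp

namespace Reg
variable {η p : ℝ} {n : ℕ} {γ C L : ℝ}

lemma q0 (R : Reg η p n γ C L) : 0 < 1 - p := by linarith [R.hη, R.hpη]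
lemma qη (R : Reg η p n γ C L) : η ≤ 1 - p := by linarith [R.hη, R.hpη]
lemma q1 (R : Reg η p n γ C L) : 1 - p ≤ 1 := by linarith [R.hp]
lemma n1 (R : Reg η p n γ C L) : 1 ≤ n := by linarith [R.hn]
lemma n0 (R : Reg η p n γ C L) : (0:ℝ) < n := by have := R.hn; positivity
lemma e1 (R : Reg η p n γ C L) : en 1 n = n := en_one R.n1

lemma rpow_le (R : Reg η p n γ C L) {c s : ℝ} (h : c * L ≤ s) : (1 - p) ^ s ≤ en (-c) n := by
  rw [← R.qL c]
  exact Real.rpow_le_rpow_of_exponent_ge R.q0 R.q1 h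
lemma pow_le (R : Reg η p n γ C L) {c : ℝ} {s : ℕ} (h : c * L ≤ s) : (1 - p) ^ s ≤ en (-c) n := by
  rw [← Real.rpow_natCast]; exact R.rpow_le h
lemma le_rpow (R : Reg η p n γ C L) {c s : ℝ} (h : s ≤ c * L) : en (-c) n ≤ (1 - p) ^ s := by
  rw [← R.qL c]
  exact Real.rpow_le_rpow_of_exponent_ge R.q0 R.q1 h
lemma le_pow (R : Reg η p n γ C L) {c : ℝ} {s : ℕ} (h : (s:ℝ) ≤ c * L) : en (-c) n ≤ (1 - p) ^ s := by
  rw [← Real.rpow_natCast]; exact R.le_rpow h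
end Reg

end Asym

open MeasureTheory Filter Finset
set_option linter.unusedSectionVars false
set_option linter.unusedVariables false

section Chi

lemma en_le_one {c : ℝ} (h : c ≤ 0) (n : ℕ) : en c n ≤ 1 := by
  have := en_mono h n
  rwa [en_zero] at this
lemma one_le_en {c : ℝ} (h : 0 ≤ c) (n : ℕ) : 1 ≤ en c n := by
  have := en_mono h n
  rwa [en_zero] at this

lemma pow_choose_two {q : ℝ} (hq : 0 < q) (s : ℕ) :
    q ^ (s.choose 2) = (q ^ (((s:ℝ) - 1) / 2)) ^ s := by
  rw [← Real.rpow_natCast, ← Real.rpow_natCast, ← Real.rpow_mul hq.le, Nat.cast_choose_two]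
  congr 1; ring

structure PHyp (η : ℝ) (p : ℕ → ℝ) : Prop where
  hη0 : 0 < η
  hη1 : η < 1
  hp0 : ∀ n, 0 < p n
  hp1 : ∀ n, p n ≤ 1 - η
  hpbig : Tendsto (fun n => Real.log (1 / p n) / Real.log n) atTop (nhds 0)

variable {η : ℝ} {p : ℕ → ℝ}

lemma PHyp.h0 (H : PHyp η p) (n : ℕ) : 0 ≤ p n := (H.hp0 n).le
lemma PHyp.h1 (H : PHyp η p) (n : ℕ) : p n ≤ 1 := by linarith [H.hp1 n, H.hη0]
lemma PHyp.lt1 (H : PHyp η p) (n : ℕ) : p n < 1 := by linarith [H.hp1 n, H.hη0]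
lemma PHyp.reg (H : PHyp η p) {γ : ℝ} (hγ : 0 < γ) (C : ℝ) :
    ∀ᶠ n in atTop, Reg η (p n) n γ C (LL p n) :=
  reg_eventually H.hη0 H.hη1 H.hp0 H.hp1 H.hpbig hγ C

lemma alpha_whp (H : PHyp η p) {ε : ℝ} (hε : 0 < ε) :
    Whp p (fun n ω => AlphaLT (erGraph n ω) ⌈(2 + ε) * LL p n⌉₊) := by
  refine Whp.of_bound H.h0 H.h1 (en_tendsto_zero (c := -(ε/4)) (by linarith)) ?_
  filter_upwards [H.reg one_pos (2/ε + 1)] with n R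
  refine le_trans (alpha_prob (H.h0 n) (H.h1 n) _) ?_
  set L := LL p n
  set s := ⌈(2 + ε) * L⌉₊ with hs
  have hs1 : (2 + ε) * L ≤ s := Nat.le_ceil _
  have hεL : 2 ≤ ε * L := by
    have := R.CL
    rw [← div_le_iff₀' hε]; linarith
  have hs0 : s ≠ 0 := by
    have := R.hLpos
    have : (0:ℝ) < s := by nlinarith
    intro h; rw [h] at this; simp at this
  rw [pow_choose_two R.q0, ← mul_pow]
  have h1 : (1 - p n) ^ (((s:ℝ) - 1) / 2) ≤ en (-(1 + ε/4)) n := by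
    apply R.rpow_le
    nlinarith
  have h2 : (n:ℝ) * (1 - p n) ^ (((s:ℝ) - 1) / 2) ≤ en (-(ε/4)) n := by
    calc (n:ℝ) * (1 - p n) ^ (((s:ℝ) - 1) / 2) ≤ en 1 n * en (-(1 + ε/4)) n := by
          rw [R.e1]; gcongr
      _ = en (-(ε/4)) n := by rw [← en_add]; ring_nf
  have h3 : 0 ≤ (n:ℝ) * (1 - p n) ^ (((s:ℝ) - 1) / 2) := by
    have := R.q0; positivity
  calc _ ≤ (en (-(ε/4)) n) ^ s := pow_le_pow_left₀ h3 h2 s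
    _ ≤ (en (-(ε/4)) n) := by
      apply pow_le_of_le_one (en_pos _ _).le _ hs0
      rw [← en_zero n]; exact en_mono (by linarith) n

lemma chi_lower (H : PHyp η p) {ε : ℝ} (hε : 0 < ε) :
    Whp p (fun n ω => (n:ℝ) / (2 * LL p n) ≤ (1 + ε) * ((erGraph n ω).chromaticNumber.toNat : ℝ)) := by
  refine Whp.mono H.h0 H.h1 (alpha_whp H hε) ?_
  filter_upwards [H.reg one_pos (1/ε)] with n R ω hω
  have h := alpha_chrom _ _ hω
  rw [Fintype.card_fin] at h
  have h' : (n:ℝ) ≤ ((erGraph n ω).chromaticNumber.toNat : ℝ) * (⌈(2 + ε) * LL p n⌉₊ : ℝ) := by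
    exact_mod_cast h
  have hL := R.hLpos
  have h2 := Nat.ceil_lt_add_one (a := (2 + ε) * LL p n) (by positivity)
  have h3 : 1 ≤ ε * LL p n := by
    have := R.CL
    rwa [div_le_iff₀' hε] at this
  rw [div_le_iff₀ (by positivity)]
  calc (n:ℝ) ≤ _ := h'
    _ ≤ ((erGraph n ω).chromaticNumber.toNat : ℝ) * ((2 + 2 * ε) * LL p n) := by
      gcongr; linarith
    _ = _ := by ring

lemma phi_bound (H : PHyp η p) {ε γ : ℝ} (hε : 0 < ε) (hε1 : ε ≤ 1) (hγ : 0 < γ)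
    (hγε : γ ≤ ε / 16) :
    ∀ᶠ n in atTop, 2 ≤ ⌈(2 - ε) * LL p n⌉₊ ∧ ⌈(2 - ε) * LL p n⌉₊ ≤ ⌈en (1 - γ) n⌉₊ ∧
      0 < Phi (1 - p n) ⌈en (1 - γ) n⌉₊ ⌈(2 - ε) * LL p n⌉₊ ∧
      Phi (1 - p n) ⌈en (1 - γ) n⌉₊ ⌈(2 - ε) * LL p n⌉₊ ≤ en (-(3/2)) n := by
  set i0 := ⌈12 / ε⌉₊ with hi0
  have hi0' : 12 / ε ≤ i0 := Nat.le_ceil _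
  filter_upwards [H.reg hγ 4, H.reg hγ ((η ^ (i0 ^ 2))⁻¹)] with n R R2
  set L := LL p n
  set s := ⌈(2 - ε) * L⌉₊ with hs
  set m := ⌈en (1 - γ) n⌉₊ with hm
  have hL4 : 4 ≤ L := R.CL
  have hs1 : (2 - ε) * L ≤ s := Nat.le_ceil _
  have hs2 : (s:ℝ) < (2 - ε) * L + 1 := Nat.ceil_lt_add_one (by nlinarith)
  have hs3 : (s:ℝ) + 1 ≤ 4 * L := by nlinarith
  have hs4 : (s:ℝ) + 1 ≤ en γ n := hs3.trans R.Lu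
  have hm1 : en (1 - γ) n ≤ m := Nat.le_ceil _
  have hm0 : (0:ℝ) < m := (en_pos _ _).trans_le hm1
  have h2s : 2 ≤ s := by
    have : (2:ℝ) ≤ s := by nlinarith
    exact_mod_cast this
  have hs0 : (0:ℝ) < s := by have : 0 < s := by omega
                             exact_mod_cast this
  have hq := R.q0
  have hb0 : 0 < (s:ℝ)^2/m := by positivity
  have hb : (s:ℝ)^2/m ≤ en (3 * γ - 1) n := by
    rw [div_le_iff₀ hm0]
    calc (s:ℝ)^2 ≤ (en γ n)^2 := by gcongr; linarith
      _ = en (3 * γ - 1) n * en (1 - γ) n := by rw [en_pow, ← en_add]; push_cast; ring_nf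
      _ ≤ _ := by gcongr; exact (en_pos _ _).le
  have hb1 : (s:ℝ)^2/m ≤ 1 := hb.trans (en_le_one (by linarith) n)
  have hterm : ∀ i ∈ (range (s+1)).filter (2 ≤ ·),
      ((s:ℝ)^2/m)^i*((1 - p n)^(i.choose 2))⁻¹ ≤ en (7 * γ - 2) n := by
    intro i hi
    rw [Finset.mem_filter, Finset.mem_range] at hi
    obtain ⟨his, hi2⟩ := hi
    by_cases hii : i0 ≤ i
    · have e1 : en (-(1 - ε/2)) n ≤ (1 - p n) ^ (((i:ℝ) - 1) / 2) := by
        apply R.le_rpow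
        have : (i:ℝ) ≤ s := by exact_mod_cast Nat.lt_succ_iff.1 his
        nlinarith
      rw [pow_choose_two hq, ← inv_pow, ← mul_pow]
      have e2 : (s:ℝ)^2/m * ((1 - p n) ^ (((i:ℝ) - 1) / 2))⁻¹ ≤ en (-(ε/4)) n := by
        calc _ ≤ en (3 * γ - 1) n * (en (-(1 - ε/2)) n)⁻¹ := by
              gcongr
              · exact (en_pos _ _).le
              · exact en_pos _ _
          _ = en (3 * γ - ε / 2) n := by rw [← en_neg, ← en_add]; ring_nf
          _ ≤ _ := en_mono (by linarith) n
      calc _ ≤ (en (-(ε/4)) n) ^ i := by gcongr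
        _ = en (-(ε/4) * i) n := en_pow _ _ _
        _ ≤ en (7 * γ - 2) n := by
          apply en_mono
          have : (i0:ℝ) ≤ i := by exact_mod_cast hii
          have : 12 ≤ ε * i := by
            rw [← div_le_iff₀' hε]; linarith
          linarith
    · push Not at hii
      have e1 : ((s:ℝ)^2/m)^i ≤ ((s:ℝ)^2/m)^2 := pow_le_pow_of_le_one hb0.le hb1 hi2
      have e2 : η ^ (i0 ^ 2) ≤ (1 - p n) ^ (i.choose 2) := by
        calc η ^ (i0 ^ 2) ≤ η ^ (i.choose 2) := by
              apply pow_le_pow_of_le_one H.hη0.le H.hη1.le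
              calc i.choose 2 ≤ i ^ 2 := Nat.choose_le_pow i 2
                _ ≤ i0 ^ 2 := Nat.pow_le_pow_left hii.le 2
          _ ≤ _ := pow_le_pow_left₀ H.hη0.le R.qη _
      have hη := H.hη0
      calc _ ≤ ((s:ℝ)^2/m)^2 * (η ^ (i0 ^ 2))⁻¹ := by gcongr
        _ ≤ (en (3 * γ - 1) n)^2 * en γ n := by
          gcongr
          exact R2.Cu
        _ = en (7 * γ - 2) n := by rw [en_pow, ← en_add]; push_cast; ring_nf
  refine ⟨h2s, ?_, ?_, ?_⟩
  · have : (s:ℝ) ≤ m := by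
      have := en_mono (show γ ≤ 1 - γ by linarith) n
      linarith
    exact_mod_cast this
  · unfold Phi
    apply Finset.sum_pos
    · intro i hi; positivity
    · exact ⟨2, by rw [Finset.mem_filter, Finset.mem_range]; omega⟩
  · unfold Phi
    calc _ ≤ ((range (s+1)).filter (2 ≤ ·)).card • en (7 * γ - 2) n := Finset.sum_le_card_nsmul _ _ _ hterm
      _ = (((range (s+1)).filter (2 ≤ ·)).card : ℝ) * en (7 * γ - 2) n := nsmul_eq_mul _ _
      _ ≤ en γ n * en (7 * γ - 2) n := by
        gcongr
        · exact (en_pos _ _).le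
        · have : ((range (s+1)).filter (2 ≤ ·)).card ≤ s + 1 := by
            simpa using Finset.card_filter_le (range (s+1)) (2 ≤ ·)
          have : (((range (s+1)).filter (2 ≤ ·)).card : ℝ) ≤ s + 1 := by exact_mod_cast this
          linarith
      _ = en (8 * γ - 2) n := by rw [← en_add]; ring_nf
      _ ≤ _ := en_mono (by linarith) n

lemma D_whp (H : PHyp η p) {ε γ : ℝ} (hε : 0 < ε) (hε1 : ε ≤ 1) (hγ : 0 < γ)
    (hγε : γ ≤ ε / 16) :
    Whp p (fun n ω => PropD (erGraph n ω) ⌈en (1 - γ) n⌉₊ ⌈(2 - ε) * LL p n⌉₊) := by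
  have ht : Tendsto (fun n : ℕ => Real.exp (-(n:ℝ))) atTop (nhds 0) :=
    Real.tendsto_exp_neg_atTop_nhds_zero.comp tendsto_natCast_atTop_atTop
  refine Whp.of_bound H.h0 H.h1 ht ?_
  filter_upwards [phi_bound H hε hε1 hγ hγε, H.reg (show (0:ℝ) < 1/2 by norm_num) 8] with n h R
  obtain ⟨h2, hsm, hP0, hP⟩ := h
  refine le_trans (D_prob (H.h0 n) (H.lt1 n) _ _ h2 hsm) ?_
  have e1 : (2:ℝ) ^ n ≤ Real.exp n := by
    rw [← Real.exp_one_pow]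
    have := Real.add_one_le_exp (1:ℝ)
    exact pow_le_pow_left₀ (by norm_num) (by linarith) n
  have e2 : 2 * (n:ℝ) ≤ 1 / (4 * Phi (1 - p n) ⌈en (1 - γ) n⌉₊ ⌈(2 - ε) * LL p n⌉₊) := by
    rw [le_div_iff₀ (by positivity)]
    calc _ ≤ 2 * en 1 n * (4 * en (-(3/2)) n) := by rw [R.e1]; gcongr
      _ = 8 * en (-(1/2)) n := by
        rw [show (-(1/2) : ℝ) = 1 + -(3/2) by norm_num, en_add]; ring
      _ ≤ 1 := by
        rw [en_neg, mul_inv_le_iff₀ (en_pos _ _)]; linarith [R.Cu]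
  calc _ ≤ Real.exp n * Real.exp (-(2 * n)) := by gcongr
    _ = Real.exp (-n) := by rw [← Real.exp_add]; ring_nf

lemma chi_upper (H : PHyp η p) {ε : ℝ} (hε : 0 < ε) (hε1 : ε ≤ 1) :
    Whp p (fun n ω => ((erGraph n ω).chromaticNumber.toNat : ℝ) ≤ (1 + 2 * ε) * ((n:ℝ) / (2 * LL p n))) := by
  have hγ : 0 < ε / 16 := by linarith
  refine Whp.mono H.h0 H.h1 (D_whp H hε hε1 hγ le_rfl) ?_
  filter_upwards [phi_bound H hε hε1 hγ le_rfl, H.reg hγ (4/ε)] with n h R ω hω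
  obtain ⟨h2, hsm, hP0, hP⟩ := h
  have hc := D_chrom _ _ _ (by omega) hsm hω
  rw [Fintype.card_fin] at hc
  set s := ⌈(2 - ε) * LL p n⌉₊
  set m := ⌈en (1 - ε/16) n⌉₊
  have hL := R.hLpos
  have hs1 : (2 - ε) * LL p n ≤ s := Nat.le_ceil _
  have hs0 : 0 < (2 - ε) * LL p n := by nlinarith
  have hm : (m:ℝ) < en (1 - ε/16) n + 1 := Nat.ceil_lt_add_one (en_pos _ _).le
  have hc' : ((erGraph n ω).chromaticNumber.toNat : ℝ) ≤ (n:ℝ) / s + m := by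
    have h1 : ((n / s : ℕ) : ℝ) ≤ (n:ℝ) / s := Nat.cast_div_le
    have h2 : ((erGraph n ω).chromaticNumber.toNat : ℝ) ≤ ((n / s : ℕ) : ℝ) + m := by exact_mod_cast hc
    linarith
  have h1 : (n:ℝ) / s ≤ (1 + ε) * ((n:ℝ) / (2 * LL p n)) := by
    calc (n:ℝ) / s ≤ n / ((2 - ε) * LL p n) := by gcongr
      _ ≤ _ := by
        have h2e : 0 < 2 - ε := by linarith
        rw [mul_div_assoc', div_le_div_iff₀ hs0 (by positivity)]
        have hn := R.n0
        have : 0 ≤ (n:ℝ) * LL p n * (ε * (1 - ε)) := by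
          have : 0 ≤ 1 - ε := by linarith
          positivity
        nlinarith
  have hone : 1 ≤ en (1 - ε/16) n := one_le_en (by linarith) n
  have h3 : (m:ℝ) ≤ ε * ((n:ℝ) / (2 * LL p n)) := by
    rw [mul_div_assoc', le_div_iff₀ (by positivity)]
    have h4 : 4 * LL p n ≤ ε * en (ε/16) n := by
      have := R.Lu
      rw [div_mul_eq_mul_div, div_le_iff₀' hε] at this
      exact this
    calc (m:ℝ) * (2 * LL p n) ≤ (2 * en (1 - ε/16) n) * (2 * LL p n) := by
          gcongr; linarith
      _ = en (1 - ε/16) n * (4 * LL p n) := by ring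
      _ ≤ en (1 - ε/16) n * (ε * en (ε/16) n) := by
          gcongr
      _ = ε * en (1 - ε/16 + ε/16) n := by rw [en_add]; ring
      _ = ε * n := by rw [sub_add_cancel, R.e1]
  linarith

end Chi

open MeasureTheory Filter Finset
set_option linter.unusedSectionVars false
set_option linter.unusedVariables false

section MakerAsym
variable {η : ℝ} {p : ℕ → ℝ}

lemma conc_whp (H : PHyp η p) :
    Whp p (fun n ω => Conc (erGraph n ω) (1 - p n) (3 * Real.log n)) := by
  refine Whp.of_bound H.h0 H.h1 (en_tendsto_zero (c := -1) (by linarith)) ?_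
  filter_upwards [H.reg one_pos (4 * Real.exp 3)] with n R
  refine le_trans (conc_prob (H.h0 n) (H.h1 n) R.n1) ?_
  have hn := R.n0
  have h1 : (1:ℝ) ≤ n := by exact_mod_cast R.n1
  have h2 := R.Cu
  rw [R.e1] at h2
  rw [en_neg, R.e1, div_le_iff₀ (by positivity)]
  have : (n:ℝ)⁻¹ * n ^ 3 = n * n := by field_simp
  rw [this]
  nlinarith [Real.exp_pos 3]

lemma exp_le_one_sub {y : ℝ} (h0 : 0 ≤ y) (h1 : y ≤ 1/2) : Real.exp (-(2 * y)) ≤ 1 - y := by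
  have hy : 0 < 1 - y := by linarith
  rw [← Real.le_log_iff_exp_le hy]
  have := Real.one_sub_inv_le_log_of_pos hy
  have h2 : (1 - y)⁻¹ ≤ 1 + 2 * y := by
    rw [inv_le_iff_one_le_mul₀ hy]
    nlinarith
  linarith

set_option maxHeartbeats 4000000 in
lemma maker_num {ε p : ℝ} {n : ℕ} {L : ℝ} (hε : 0 < ε) (hε1 : ε ≤ 1)
    (R : Reg η p n (ε/100) (1200 / ε + 4 * Real.exp (384 / ε)) L)
    {k J Q s : ℕ} (hk : k = ⌊(1 + ε) * n / L⌋₊) (hJ : J = ⌈en (1 - ε/6) n⌉₊)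
    (hQ : Q = ⌈ε / 12 * L⌉₊) (hs : s = ⌈(2 + 1) * L⌉₊) :
    k ≤ n ∧ 1 ≤ J ∧ 4 * J ≤ k ∧ 4 ≤ Q ∧
    (∀ l < s, ∀ μ : ℝ, (k:ℝ) * (1 - p)^((n:ℝ)/k) ≤ μ →
      ((1-4/(Q:ℝ))^s*(k*(Q-4:ℝ))-3)/(l+Q)*(1 - p)^(l+Q) ≤ μ →
      (3 * Real.log n)*(n+k+J+2)/(J+1)+(8*J*(1 - p)^l+(3 * Real.log n)*(6+4*s))*(2+Real.log J) < μ/2) := by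
  obtain ⟨γ, hγ⟩ : ∃ γ, γ = ε / 100 := ⟨_, rfl⟩
  rw [← hγ] at R
  have hγ0 : 0 < γ := by rw [hγ]; positivity
  obtain ⟨B, hB⟩ : ∃ B, B = Real.exp (384 / ε) := ⟨_, rfl⟩
  rw [← hB] at R
  have hB0 : 0 < B := hB ▸ Real.exp_pos _
  have h1200 : 1200 ≤ 1200 / ε := by rw [le_div_iff₀ hε]; nlinarith
  have hC : 1200 / ε ≤ 1200 / ε + 4 * B := by linarith
  have hL := R.hLpos
  have hq := R.q0
  have hn := R.n0
  have hx : 1200 ≤ Real.log n := by linarith [R.Cx]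
  have hL1 : 1200 ≤ L := by linarith [R.CL]
  have hεL : 1200 ≤ ε * L := by rw [← div_le_iff₀' hε]; linarith [R.CL]
  have hu : 1200 ≤ en γ n := by linarith [R.Cu]
  have hxu : 1200 * Real.log n ≤ en γ n := le_trans (by gcongr; linarith) R.xu
  have hLu : 1200 * L ≤ en γ n := le_trans (by gcongr; linarith) R.Lu
  have hLu2 : 1200 * L ≤ ε * en γ n := by
    have : 1200 / ε * L ≤ en γ n := le_trans (by gcongr) R.Lu
    rwa [div_mul_eq_mul_div, div_le_iff₀' hε] at this
  have hun : en γ n ≤ n := by rw [← R.e1]; exact en_mono (by linarith) n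
  have hnL : en (1 - γ) n ≤ n / L := by
    rw [le_div_iff₀ hL]
    calc en (1 - γ) n * L ≤ en (1 - γ) n * en γ n := by
          gcongr
          · exact (en_pos _ _).le
          · linarith
      _ = n := by rw [← en_add, sub_add_cancel, R.e1]
  -- k
  have hk1 : (k:ℝ) ≤ (1 + ε) * n / L := by rw [hk]; exact Nat.floor_le (by positivity)
  have hk2 : (1 + ε) * n / L < k + 1 := by rw [hk]; exact Nat.lt_floor_add_one _
  have hk3 : (1 + ε/2) * n / L ≤ k := by
    have h1 : 1 ≤ (ε/2) * n / L := by
      rw [le_div_iff₀ hL]; nlinarith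
    have h2 : (1 + ε) * n / L = (1 + ε/2) * n / L + (ε/2) * n / L := by ring
    linarith
  have hk4 : (n:ℝ) / L ≤ k := by
    refine le_trans ?_ hk3
    gcongr
    nlinarith
  have hk5 : en (1 - γ) n ≤ k := hnL.trans hk4
  have hk0 : (0:ℝ) < k := (en_pos _ _).trans_le hk5
  have hkn : (k:ℝ) ≤ n := by
    refine hk1.trans ?_
    rw [div_le_iff₀ hL]; nlinarith
  -- J
  have hJ1 : en (1 - ε/6) n ≤ J := by rw [hJ]; exact Nat.le_ceil _
  have hJ2 : (J:ℝ) ≤ 2 * en (1 - ε/6) n := by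
    have h1 : (J:ℝ) < en (1 - ε/6) n + 1 := by rw [hJ]; exact Nat.ceil_lt_add_one (en_pos _ _).le
    have h2 : 1 ≤ en (1 - ε/6) n := one_le_en (by linarith) n
    linarith
  have hJ0 : (0:ℝ) < J := (en_pos _ _).trans_le hJ1
  have hJk : 4 * (J:ℝ) ≤ k := by
    calc 4 * (J:ℝ) ≤ en γ n * en (1 - ε/6) n := by nlinarith [en_pos (1 - ε/6) n]
      _ = en (γ + (1 - ε/6)) n := by rw [en_add]
      _ ≤ en (1 - γ) n := en_mono (by linarith) n
      _ ≤ k := hk5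
  -- Q
  have hQ1 : ε / 12 * L ≤ Q := by rw [hQ]; exact Nat.le_ceil _
  have hQ2 : (Q:ℝ) < ε / 12 * L + 1 := by rw [hQ]; exact Nat.ceil_lt_add_one (by positivity)
  have hQ3 : (8:ℝ) ≤ Q := by linarith
  have hQ4 : (Q:ℝ) ≤ (ε/12 + γ) * L := by rw [hγ]; linarith
  -- s
  have hs1 : (s:ℝ) ≤ 4 * L := by
    have : (s:ℝ) < (2 + 1) * L + 1 := by rw [hs]; exact Nat.ceil_lt_add_one (by positivity)
    linarith
  have hlogJ : Real.log J ≤ Real.log n := Real.log_le_log hJ0 (by linarith)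
  have hlogJ0 : 0 ≤ Real.log J := Real.log_natCast_nonneg J
  refine ⟨by exact_mod_cast hkn, by exact_mod_cast hJ0, by exact_mod_cast hJk, ?_, ?_⟩
  · have : (4:ℝ) ≤ Q := by linarith
    exact_mod_cast this
  intro l hl μ hμ1 hμ2
  have hl' : (l:ℝ) ≤ s := by exact_mod_cast hl.le
  have hμA : en (ε/3 - γ) n ≤ μ := by
    refine le_trans ?_ hμ1
    have h1 : en (-(1/(1 + ε/2))) n ≤ (1 - p)^((n:ℝ)/k) := by
      apply R.le_rpow
      rw [div_le_iff₀ hk0]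
      calc (n:ℝ) = 1/(1 + ε/2) * L * ((1 + ε/2) * n / L) := by field_simp
        _ ≤ _ := by gcongr
    have h2 : 1/(1 + ε/2) ≤ 1 - ε/3 := by
      rw [div_le_iff₀ (by linarith)]
      have := mul_nonneg hε.le (sub_nonneg.2 hε1)
      linarith
    calc en (ε/3 - γ) n ≤ en ((1 - γ) + -(1/(1 + ε/2))) n := en_mono (by linarith) n
      _ = en (1 - γ) n * en (-(1/(1 + ε/2))) n := en_add _ _ _
      _ ≤ _ := by
        gcongr
        exact (en_pos _ _).le
  have hμ0 : 0 < μ := (en_pos _ _).trans_le hμA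
  have hql : 0 < (1 - p)^l := pow_pos hq l
  have hlog3 : 2 + Real.log J ≤ en γ n := by linarith
  have T1 : 16 * ((3 * Real.log n)*(n+k+J+2)/(J+1)) ≤ μ := by
    refine le_trans ?_ hμA
    rw [mul_div_assoc', div_le_iff₀ (by linarith)]
    have hn2 : (2:ℝ) ≤ n := by exact_mod_cast R.hn
    calc 16 * (3 * Real.log n * (n + k + J + 2)) ≤ 16 * (3 * Real.log n * (5 * n)) := by
          gcongr; linarith
      _ = (240 * Real.log n) * n := by ring
      _ ≤ en γ n * en 1 n := by rw [R.e1]; gcongr; linarith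
      _ = en (γ + 1) n := by rw [en_add]
      _ ≤ en ((ε/3 - γ) + (1 - ε/6)) n := en_mono (by linarith) n
      _ = en (ε/3 - γ) n * en (1 - ε/6) n := en_add _ _ _
      _ ≤ en (ε/3 - γ) n * (J + 1) := by
        gcongr
        · exact (en_pos _ _).le
        · linarith
  have T3 : 16 * ((3 * Real.log n)*(6+4*s)*(2+Real.log J)) ≤ μ := by
    refine le_trans ?_ hμA
    calc 16 * ((3 * Real.log n)*(6+4*s)*(2+Real.log J)) = (48 * Real.log n)*(6+4*s)*(2+Real.log J) := by ring
      _ ≤ en γ n * en γ n * en γ n := by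
        have a1 : 48 * Real.log n ≤ en γ n := by linarith
        have a2 : 6+4*(s:ℝ) ≤ en γ n := by linarith
        have := en_pos γ n
        gcongr
      _ = en (γ + γ + γ) n := by rw [en_add, en_add]
      _ ≤ _ := en_mono (by linarith) n
  have hX : en (1 - 2 * γ) n ≤ (1-4/(Q:ℝ))^s*(k*(Q-4:ℝ))-3 := by
    have a1 : B⁻¹ ≤ (1-4/(Q:ℝ))^s := by
      have b1 : Real.exp (-(2 * (4/(Q:ℝ)))) ≤ 1 - 4/(Q:ℝ) := by
        apply exp_le_one_sub (by positivity)
        rw [div_le_iff₀ (by linarith)]; linarith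
      calc B⁻¹ = Real.exp (-(384/ε)) := by rw [hB, Real.exp_neg]
        _ ≤ Real.exp (s * -(2 * (4/(Q:ℝ)))) := by
          apply Real.exp_le_exp.2
          have : (s:ℝ) / Q ≤ 48 / ε := by
            rw [div_le_div_iff₀ (by linarith) hε]
            have := mul_le_mul_of_nonneg_right hs1 hε.le
            linarith
          have h2 : (s:ℝ) * -(2 * (4/(Q:ℝ))) = -(8 * (s / Q)) := by ring
          have h3 : 384/ε = 8 * (48/ε) := by ring
          rw [h2, h3]; linarith
        _ = (Real.exp (-(2 * (4/(Q:ℝ)))))^s := Real.exp_nat_mul _ _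
        _ ≤ _ := by gcongr
    have a2 : 4 * B ≤ en γ n := by
      have : 0 < 1200 / ε := by positivity
      linarith [R.Cu]
    have a3 : 4 * en (1 - 2*γ) n ≤ B⁻¹ * k := by
      rw [inv_mul_eq_div, le_div_iff₀ hB0]
      calc 4 * en (1 - 2*γ) n * B = en (1 - 2*γ) n * (4 * B) := by ring
        _ ≤ en (1 - 2*γ) n * en γ n := by gcongr; exact (en_pos _ _).le
        _ = en (1 - γ) n := by rw [← en_add]; ring_nf
        _ ≤ k := hk5
    have a4 : B⁻¹ * k ≤ (1-4/(Q:ℝ))^s*(k*(Q-4:ℝ)) := by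
      have : (k:ℝ) ≤ k*(Q-4:ℝ) := le_mul_of_one_le_right hk0.le (by linarith)
      have := inv_pos.2 hB0
      gcongr
      linarith
    have a5 : 1 ≤ en (1 - 2*γ) n := one_le_en (by linarith) n
    linarith
  have T2 : 16 * (8*J*(1 - p)^l*(2+Real.log J)) ≤ μ := by
    refine le_trans ?_ hμ2
    have a1 : en (-(ε/12 + γ)) n ≤ (1 - p)^Q := R.le_pow hQ4
    have a2 : (l:ℝ) + Q ≤ en γ n := by
      have : ε * L ≤ L := mul_le_of_le_one_left hL.le hε1
      linarith
    have a3 : en (1 - 2*γ) n * (en γ n)⁻¹ ≤ ((1-4/(Q:ℝ))^s*(k*(Q-4:ℝ))-3)/(l+Q) := by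
      rw [← div_eq_mul_inv]
      have := en_pos (1 - 2*γ) n
      have hlQ : (0:ℝ) < l + Q := by positivity
      gcongr
      linarith
    calc 16 * (8*J*(1 - p)^l*(2+Real.log J)) ≤ 16 * (8*(2 * en (1 - ε/6) n)*(1 - p)^l*en γ n) := by
          have := en_pos (1 - ε/6) n
          gcongr
      _ = 256 * (en (1 - ε/6) n * en γ n * (1 - p)^l) := by ring
      _ ≤ en γ n * (en (1 - ε/6) n * en γ n * (1 - p)^l) := by
          have := en_pos (1 - ε/6) n
          have := en_pos γ n
          gcongr; linarith
      _ = en (γ + (1 - ε/6) + γ) n * (1 - p)^l := by rw [en_add, en_add]; ring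
      _ ≤ en ((1 - 2*γ) + (-γ) + -(ε/12 + γ)) n * (1 - p)^l := by
          gcongr
          exact en_mono (by linarith) n
      _ = (en (1 - 2*γ) n * (en γ n)⁻¹) * ((1 - p)^l * en (-(ε/12 + γ)) n) := by
          rw [en_add, en_add, en_neg γ]; ring
      _ ≤ _ := by
          rw [pow_add]
          have := en_pos (1 - 2*γ) n
          have := en_pos γ n
          have := en_pos (-(ε/12 + γ)) n
          gcongr
          exact le_trans (by positivity) a3
  have : (8*J*(1 - p)^l+(3 * Real.log n)*(6+4*s))*(2+Real.log J)
    = 8*J*(1 - p)^l*(2+Real.log J) + (3 * Real.log n)*(6+4*s)*(2+Real.log J) := by ring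
  rw [this]
  linarith

lemma maker_whp (H : PHyp η p) {ε : ℝ} (hε : 0 < ε) (hε1 : ε ≤ 1) :
    Whp p (fun n ω => MakerWins (erGraph n ω) ⌊(1 + ε) * n / LL p n⌋₊) := by
  refine Whp.mono H.h0 H.h1 (Whp.and H.h0 H.h1 (conc_whp H) (alpha_whp H one_pos)) ?_
  have hγ : 0 < ε / 100 := by linarith
  filter_upwards [H.reg hγ (1200 / ε + 4 * Real.exp (384 / ε))] with n R ω hω
  obtain ⟨hc, hα⟩ := hω
  obtain ⟨h1, h2, h3, h4, h5⟩ := maker_num hε hε1 R rfl rfl rfl rfl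
  refine maker_wins (erGraph n ω) _ R.q0 R.q1 ?_ hc ?_ hα _ _ h2 h3 h4 ?_
  · have := Real.log_natCast_nonneg n
    positivity
  · rwa [Fintype.card_fin]
  · rwa [Fintype.card_fin]

end MakerAsym

open MeasureTheory Filter Finset
set_option linter.unusedSectionVars false
set_option linter.unusedVariables false

section BreakerAsym
variable {η : ℝ}

lemma Reg.pL {p : ℝ} {n : ℕ} {γ C L : ℝ} (R : Reg η p n γ C L) : η * Real.log n ≤ p * L := by
  have hη := R.hη
  have hp := R.hp
  have hq := R.q0
  have hq2 := R.qη
  have hx := Real.log_natCast_nonneg n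
  have hl1 : p ≤ -Real.log (1 - p) := by
    have := Real.log_le_sub_one_of_pos hq
    linarith
  have hl0 : 0 < -Real.log (1 - p) := by linarith
  have h2 : η * -Real.log (1 - p) ≤ p := by
    have h3 := Real.one_sub_inv_le_log_of_pos hq
    have h4 : -Real.log (1 - p) ≤ p / (1 - p) := by
      have : (1 - p)⁻¹ - 1 = p / (1 - p) := by field_simp; ring
      linarith
    rw [le_div_iff₀ hq] at h4
    nlinarith
  rw [R.hL, mul_div_assoc', le_div_iff₀ hl0]
  nlinarith

structure BPar (δ η : ℝ) (M : ℕ) (p : ℝ) (n : ℕ) (L : ℝ) (t0 z a r K m s : ℕ) : Prop where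
  ht0 : t0 = ⌈(1 - δ) * L⌉₊
  hz : z = ⌈4 * δ * L⌉₊
  ha : a = ⌈4 * δ / η * L⌉₊
  hr : r = ⌈10 * Real.log (2 * M) / p⌉₊
  hK : K = ⌈((t0:ℝ) + (M * z : ℕ) + 2) / δ⌉₊
  hm : m = ⌊(1 - δ) * n / 2⌋₊
  hs : s = ⌈(2 + 1) * L⌉₊

structure BFacts (δ η : ℝ) (M : ℕ) (p : ℝ) (n : ℕ) (L : ℝ) (t0 z a r K m s : ℕ) : Prop where
  t1 : (1 - δ) * L ≤ t0
  t2 : (t0:ℝ) ≤ (1 - δ) * L + 1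
  z1 : 4 * δ * L ≤ z
  z2 : (z:ℝ) ≤ 4 * δ * L + 1
  a1 : 4 * δ / η * L ≤ a
  a2 : (a:ℝ) ≤ 4 * δ / η * L + 1
  r1 : 10 * Real.log (2 * M) / p ≤ r
  r2 : 2 * (r:ℝ) + 4 ≤ δ / 2 * L
  K1 : (t0:ℝ) + (M * z : ℕ) + 2 ≤ δ * K
  K2 : (K:ℝ) + (M * z : ℕ) ≤ (4 + 10 * M) / δ * L
  m1 : 2 * (m:ℝ) ≤ (1 - δ) * n
  m2 : (1 - δ) * n ≤ 2 * m + 2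
  s2 : (s:ℝ) ≤ 4 * L

noncomputable def BC (δ : ℝ) (M : ℕ) : ℝ := 1000 / δ + 80 * Real.log (2 * M) / δ + (4 + 10 * M) / δ

lemma BPar.facts {δ p : ℝ} {M n : ℕ} {L : ℝ} {t0 z a r K m s : ℕ}
    (P : BPar δ η M p n L t0 z a r K m s) (hδ : 0 < δ) (hδ1 : δ ≤ 1/16) (hM : 1 ≤ M)
    (R : Reg η p n (δ/100) (BC δ M) L) : BFacts δ η M p n L t0 z a r K m s ∧
    1000 ≤ δ * L ∧ 1000 ≤ δ * en (δ/100) n ∧ 1000 * Real.log n ≤ en (δ/100) n ∧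
    1000 * L ≤ en (δ/100) n ∧ (4 + 10 * M) / δ * L ≤ en (δ/100) n := by
  have hL := R.hLpos
  have hη := R.hη
  have hp := R.hp
  have hn := R.n0
  have hM' : (1:ℝ) ≤ M := by exact_mod_cast hM
  have hlog : 0 ≤ Real.log (2 * M) := Real.log_nonneg (by linarith)
  have c1 : 1000 / δ ≤ BC δ M := by
    unfold BC
    have : 0 ≤ 80 * Real.log (2 * M) / δ := by positivity
    have : 0 ≤ (4 + 10 * (M:ℝ)) / δ := by positivity
    linarith
  have c2 : 80 * Real.log (2 * M) / δ ≤ BC δ M := by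
    unfold BC
    have : 0 ≤ 1000 / δ := by positivity
    have : 0 ≤ (4 + 10 * (M:ℝ)) / δ := by positivity
    linarith
  have c3 : (4 + 10 * M) / δ ≤ BC δ M := by
    unfold BC
    have : 0 ≤ 1000 / δ := by positivity
    have : 0 ≤ 80 * Real.log (2 * M) / δ := by positivity
    linarith
  have c4 : 1000 ≤ BC δ M := by
    refine le_trans ?_ c1
    rw [le_div_iff₀ hδ]; linarith
  have hx := Real.log_natCast_nonneg n
  have hδL : 1000 ≤ δ * L := by rw [← div_le_iff₀' hδ]; exact c1.trans R.CL
  have hL1 : 1000 ≤ L := c4.trans R.CL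
  refine ⟨?_, hδL, ?_, ?_, ?_, ?_⟩
  · have hz2 : (z:ℝ) ≤ 4 * δ * L + 1 := by rw [P.hz]; exact (Nat.ceil_lt_add_one (by positivity)).le
    have ht2 : (t0:ℝ) ≤ (1 - δ) * L + 1 := by
      rw [P.ht0]; exact (Nat.ceil_lt_add_one (mul_nonneg (by linarith) hL.le)).le
    refine ⟨?_, ht2, ?_, hz2, ?_, ?_, ?_, ?_, ?_, ?_, ?_, ?_, ?_⟩
    · rw [P.ht0]; exact Nat.le_ceil _
    · rw [P.hz]; exact Nat.le_ceil _
    · rw [P.ha]; exact Nat.le_ceil _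
    · rw [P.ha]; exact (Nat.ceil_lt_add_one (by positivity)).le
    · rw [P.hr]; exact Nat.le_ceil _
    · have h1 : (r:ℝ) ≤ 10 * Real.log (2 * M) / p + 1 := by
        rw [P.hr]; exact (Nat.ceil_lt_add_one (by positivity)).le
      have h2 : 10 * Real.log (2 * M) / p ≤ δ / 8 * L := by
        have := c2.trans R.CpL
        rw [div_le_iff₀ hδ] at this
        rw [div_le_iff₀ hp]
        linarith
      linarith
    · have : ((t0:ℝ) + (M * z : ℕ) + 2) / δ ≤ K := by rw [P.hK]; exact Nat.le_ceil _
      rwa [div_le_iff₀' hδ] at this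
    · have h1 : (K:ℝ) ≤ ((t0:ℝ) + (M * z : ℕ) + 2) / δ + 1 := by
        rw [P.hK]; exact (Nat.ceil_lt_add_one (by positivity)).le
      have h2 : ((M * z : ℕ) : ℝ) ≤ 5 * M * L := by
        push_cast
        have : (z:ℝ) ≤ 5 * L := by
          have : δ * L ≤ L := mul_le_of_le_one_left hL.le (by linarith)
          linarith
        calc (M:ℝ) * z ≤ M * (5 * L) := by gcongr
          _ = _ := by ring
      have h3 : (t0:ℝ) + (M * z : ℕ) + 2 ≤ (2 + 5 * M) * L := by linarith
      have h4 : ((t0:ℝ) + (M * z : ℕ) + 2) / δ ≤ (2 + 5 * M) * L / δ := by gcongr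
      have h5 : 5 * M * L ≤ 5 * M * L / δ := le_div_self (by positivity) hδ (by linarith)
      have h6 : L ≤ L / δ := le_div_self hL.le hδ (by linarith)
      have h7 : (4 + 10 * M) / δ * L = (2 + 5 * M) * L / δ + 5 * M * L / δ + 2 * (L / δ) := by ring
      rw [h7]; linarith
    · have : (m:ℝ) ≤ (1 - δ) * n / 2 := by
        rw [P.hm]; exact Nat.floor_le (div_nonneg (mul_nonneg (by linarith) hn.le) (by norm_num))
      linarith
    · have : (1 - δ) * n / 2 < m + 1 := by rw [P.hm]; exact Nat.lt_floor_add_one _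
      linarith
    · have : (s:ℝ) < (2 + 1) * L + 1 := by rw [P.hs]; exact Nat.ceil_lt_add_one (by positivity)
      linarith
  · rw [← div_le_iff₀' hδ]; exact c1.trans R.Cu
  · exact le_trans (by gcongr) R.xu
  · exact le_trans (by gcongr) R.Lu
  · exact le_trans (by gcongr) R.Lu

lemma brk_A1 {δ p : ℝ} {M n : ℕ} {L : ℝ} {t0 z a r K m s : ℕ}
    (P : BPar δ η M p n L t0 z a r K m s) (hδ : 0 < δ) (hδ1 : δ ≤ 1/16) (hM : 1 ≤ M)
    (hM2 : 1 ≤ δ ^ 2 * M)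
    (R : Reg η p n (δ/100) (BC δ M) L) :
    (n:ℝ)^t0*((n:ℝ)^z*(1-p)^(z*t0+z.choose 2))^M ≤ en (-1) n := by
  obtain ⟨F, hδL, -, -, -, -⟩ := P.facts hδ hδ1 hM R
  have hq := R.q0
  have hn := R.n0
  have hL := R.hLpos
  have e1 : (1-p)^(z*t0+z.choose 2) = ((1-p)^((t0:ℝ) + ((z:ℝ)-1)/2))^z := by
    rw [pow_add, pow_choose_two hq, Real.rpow_add hq, mul_pow, Real.rpow_natCast, ← pow_mul, mul_comm z]
  rw [e1, ← mul_pow, ← pow_mul]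
  have e2 : (1-p)^((t0:ℝ) + ((z:ℝ)-1)/2) ≤ en (-(1 + δ/2)) n := by
    apply R.rpow_le
    have := F.t1; have := F.z1
    linarith
  have e3 : (n:ℝ) * (1-p)^((t0:ℝ) + ((z:ℝ)-1)/2) ≤ en (-(δ/2)) n := by
    calc _ ≤ en 1 n * en (-(1 + δ/2)) n := by rw [R.e1]; gcongr
      _ = _ := by rw [← en_add]; ring_nf
  calc _ ≤ (en 1 n)^t0 * (en (-(δ/2)) n)^(z*M) := by
        rw [R.e1]; gcongr
    _ = en (1 * t0 + -(δ/2) * (z * M : ℕ)) n := by rw [en_pow, en_pow, en_add]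
    _ ≤ en (-1) n := by
      apply en_mono
      push_cast
      have h1 : 2 * L ≤ δ/2 * (z * M) := by
        calc 2 * L ≤ 2 * L * (δ^2 * M) := le_mul_of_one_le_right (by positivity) hM2
          _ = δ/2 * ((4 * δ * L) * M) := by ring
          _ ≤ _ := by gcongr; exact F.z1
      have h2 := F.t2
      have h3 : δ * L ≤ L := mul_le_of_le_one_left hL.le (by linarith)
      linarith

lemma brk_A2 {δ p : ℝ} {M n : ℕ} {L : ℝ} {t0 z a r K m s : ℕ}
    (P : BPar δ η M p n L t0 z a r K m s) (hδ : 0 < δ) (hδ1 : δ ≤ 1/16) (hM : 1 ≤ M)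
    (R : Reg η p n (δ/100) (BC δ M) L) :
    (((M * z : ℕ):ℝ)+1)*(n:ℝ)^(t0+M*z)*((n:ℝ)*((1-p)^t0*Real.exp (-(p*a/2))))^K ≤ en (-1) n := by
  obtain ⟨F, hδL, -, -, hLu, hKu⟩ := P.facts hδ hδ1 hM R
  have hq := R.q0
  have hn := R.n0
  have hL := R.hLpos
  have hη := R.hη
  have hp := R.hp
  have e1 : (1-p)^t0 ≤ en (-(1-δ)) n := R.pow_le F.t1
  have e2 : Real.exp (-(p*a/2)) ≤ en (-(2 * δ)) n := by
    unfold en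
    apply Real.exp_le_exp.2
    have h1 := R.pL
    have h2 : p * (4 * δ / η * L) ≤ p * a := by gcongr; exact F.a1
    have h3 : 4 * δ * Real.log n ≤ p * (4 * δ / η * L) := by
      calc 4 * δ * Real.log n = 4 * δ / η * (η * Real.log n) := by field_simp
        _ ≤ 4 * δ / η * (p * L) := by gcongr
        _ = _ := by ring
    linarith
  have e3 : (n:ℝ)*((1-p)^t0*Real.exp (-(p*a/2))) ≤ en (-δ) n := by
    calc _ ≤ en 1 n * (en (-(1-δ)) n * en (-(2 * δ)) n) := by
          rw [R.e1]
          have := en_pos (-(1-δ)) n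
          gcongr
      _ = _ := by rw [← en_add, ← en_add]; ring_nf
  have e4 : ((M * z : ℕ):ℝ)+1 ≤ en 1 n := by
    have h1 := F.K2
    have h2 := en_mono (show δ/100 ≤ 1 by linarith) n
    have h3 : (1:ℝ) ≤ K := by
      have := F.K1
      by_contra hh
      push Not at hh
      have h5 : δ * K ≤ 1 := by nlinarith
      have : (0:ℝ) ≤ t0 := by positivity
      have : (0:ℝ) ≤ (M * z : ℕ) := by positivity
      linarith
    linarith
  calc _ ≤ en 1 n * (en 1 n)^(t0+M*z) * (en (-δ) n)^K := by
        have := en_pos 1 n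
        gcongr
        rw [R.e1]
    _ = en (1 + 1 * (t0 + M*z : ℕ) + -δ * K) n := by rw [en_pow, en_pow, en_add, en_add]
    _ ≤ en (-1) n := by
      apply en_mono
      have := F.K1
      push_cast at this ⊢
      linarith

lemma brk_hr {δ p : ℝ} {M n : ℕ} {L : ℝ} {t0 z a r K m s : ℕ}
    (P : BPar δ η M p n L t0 z a r K m s) (hδ : 0 < δ) (hδ1 : δ ≤ 1/16) (hM : 1 ≤ M)
    (R : Reg η p n (δ/100) (BC δ M) L) :
    ((M*z:ℕ):ℝ)*(1-p/10)^r ≤ a := by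
  obtain ⟨F, hδL, -, -, -, -⟩ := P.facts hδ hδ1 hM R
  have hL := R.hLpos
  have hη := R.hη
  have hη1 := R.hη1
  have hp := R.hp
  have hp1 := R.q0
  have hM' : (1:ℝ) ≤ M := by exact_mod_cast hM
  have e1 : (1-p/10)^r ≤ (2 * (M:ℝ))⁻¹ := by
    calc (1-p/10)^r ≤ (Real.exp (-(p/10)))^r := by
          apply pow_le_pow_left₀ (by linarith)
          have := Real.add_one_le_exp (-(p/10))
          linarith
      _ = Real.exp (r * -(p/10)) := (Real.exp_nat_mul _ _).symm
      _ ≤ Real.exp (-Real.log (2 * M)) := by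
          apply Real.exp_le_exp.2
          have := F.r1
          rw [div_le_iff₀ hp] at this
          linarith
      _ = _ := by rw [Real.exp_neg, Real.exp_log (by linarith)]
  calc ((M*z:ℕ):ℝ)*(1-p/10)^r ≤ ((M*z:ℕ):ℝ) * (2 * (M:ℝ))⁻¹ := by gcongr
    _ = z / 2 := by push_cast; field_simp
    _ ≤ 4 * δ * L := by have := F.z2; linarith
    _ ≤ 4 * δ / η * L := by
      gcongr
      exact le_div_self (by positivity) hη hη1.le
    _ ≤ a := F.a1

lemma brk_hE {δ p : ℝ} {M n : ℕ} {L : ℝ} {t0 z a r K m s : ℕ}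
    (P : BPar δ η M p n L t0 z a r K m s) (hδ : 0 < δ) (hδ1 : δ ≤ 1/16) (hM : 1 ≤ M)
    (R : Reg η p n (δ/100) (BC δ M) L) :
    (3 * Real.log n)*(n+1) < en (1 - δ/4) n*(((n:ℝ)-2*m)*(1-p)^(t0+2*r+1)/2
      - (3 * Real.log n)*(t0+2*r+2) - (K+(M*z:ℕ))) := by
  obtain ⟨F, hδL, hδu, hxu, hLu, hKu⟩ := P.facts hδ hδ1 hM R
  have hL := R.hLpos
  have hn := R.n0
  have hx : 0 < Real.log n := Real.log_pos (by exact_mod_cast R.hn)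
  obtain ⟨γ, hγ⟩ : ∃ γ, γ = δ / 100 := ⟨_, rfl⟩
  rw [← hγ] at hδu hxu hLu hKu
  have ht2 := F.t2
  have hr2 := F.r2
  have h1 : en (-(1 - δ/2)) n ≤ (1-p)^(t0+2*r+1) := by
    apply R.le_pow
    push_cast
    linarith
  have h2 : 3 * en (δ/2 - γ) n ≤ ((n:ℝ)-2*m)*(1-p)^(t0+2*r+1)/2 := by
    have h3 : δ * n ≤ (n:ℝ) - 2 * m := by have := F.m1; linarith
    calc 3 * en (δ/2 - γ) n ≤ (δ * en γ n / 2) * en (δ/2 - γ) n := by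
          have := en_pos (δ/2 - γ) n
          gcongr; linarith
      _ = (δ * (en 1 n * en (-(1 - δ/2)) n)) / 2 := by
          rw [← en_add]
          have : en γ n * en (δ/2 - γ) n = en (1 + -(1 - δ/2)) n := by
            rw [← en_add]; ring_nf
          rw [← this]; ring
      _ = (δ * n) * en (-(1 - δ/2)) n / 2 := by rw [R.e1]; ring
      _ ≤ _ := by
          have := en_pos (-(1 - δ/2)) n
          gcongr
          exact le_trans (by positivity) h3
  have h4 : (3 * Real.log n)*(t0+2*r+2) ≤ en (δ/2 - γ) n := by
    have a1 : 3 * Real.log n ≤ en γ n := by linarith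
    have a2 : (t0:ℝ)+2*r+2 ≤ en γ n := by linarith
    calc _ ≤ en γ n * en γ n := by
          have := en_pos γ n
          gcongr
      _ = en (γ + γ) n := (en_add _ _ _).symm
      _ ≤ _ := en_mono (by linarith) n
  have h5 : (K:ℝ)+(M*z:ℕ) ≤ en (δ/2 - γ) n := by
    have := F.K2
    have h := en_mono (show γ ≤ δ/2 - γ by linarith) n
    linarith
  calc (3 * Real.log n)*(n+1) < 1000 * Real.log n * n := by
        have : (1:ℝ) ≤ n := by exact_mod_cast R.n1
        have := mul_le_mul_of_nonneg_left this hx.le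
        have := mul_pos hx hn
        linarith
    _ ≤ en γ n * en 1 n := by rw [R.e1]; gcongr
    _ = en (γ + 1) n := (en_add _ _ _).symm
    _ ≤ en (1 - δ/4 + (δ/2 - γ)) n := en_mono (by linarith) n
    _ = en (1 - δ/4) n * en (δ/2 - γ) n := en_add _ _ _
    _ ≤ _ := by
      have := en_pos (1 - δ/4) n
      gcongr
      linarith

lemma brk_hfin {δ ε p : ℝ} {M n : ℕ} {L : ℝ} {t0 z a r K m s : ℕ}
    (P : BPar δ η M p n L t0 z a r K m s) (hδ : 0 < δ) (hδ1 : δ ≤ 1/16) (hM : 1 ≤ M)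
    (hε : 0 < ε) (hε1 : ε ≤ 1) (hδε : δ = ε * η / 16)
    (R : Reg η p n (δ/100) (BC δ M) L) {k : ℕ} (hk : (k:ℝ) ≤ (1 - ε) * n / L) :
    (k:ℝ)*(t0+z+a+2*r+2)+en (1 - δ/4) n*s < 2*m := by
  obtain ⟨F, hδL, hδu, hxu, hLu, hKu⟩ := P.facts hδ hδ1 hM R
  have hL := R.hLpos
  have hn := R.n0
  have hη := R.hη
  have hη1 := R.hη1
  obtain ⟨γ, hγ⟩ : ∃ γ, γ = δ / 100 := ⟨_, rfl⟩
  rw [← hγ] at hδu hxu hLu hKu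
  have hδε2 : δ ≤ ε / 16 := by rw [hδε]; have := mul_le_of_le_one_right hε.le hη1.le; linarith
  have h1 : (t0:ℝ)+z+a+2*r+2 ≤ (1 + ε/2) * L := by
    have h2 : 4 * δ / η * L = ε / 4 * L := by rw [hδε]; field_simp; ring
    have h3 := F.t2
    have h4 := F.z2
    have h5 := F.a2
    have h6 := F.r2
    rw [h2] at h5
    have h7 : δ * L ≤ ε / 16 * L := by gcongr
    linarith
  have h2 : (k:ℝ)*(t0+z+a+2*r+2) ≤ (1 - ε/2) * n := by
    calc (k:ℝ)*(t0+z+a+2*r+2) ≤ (1 - ε) * n / L * ((1 + ε/2) * L) := by gcongr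
      _ = (1 - ε) * (1 + ε/2) * n := by field_simp
      _ ≤ (1 - ε/2) * n := by
        gcongr
        have := mul_pos hε hε
        linarith
  have h3 : en (1 - δ/4) n*s ≤ ε / 8 * n := by
    have e1 : en (2*γ) n * (1000 * L) ≤ ε * en (δ/4) n := by
      calc en (2*γ) n * (1000 * L) ≤ en (2*γ) n * en γ n := by
            have := en_pos (2*γ) n
            gcongr
        _ = 1 * en (3*γ) n := by rw [← en_add, one_mul]; ring_nf
        _ ≤ (ε * en γ n) * en (3*γ) n := by
            have := en_pos (3*γ) n
            have := mul_le_mul_of_nonneg_right hδε2 (en_pos γ n).le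
            gcongr; linarith
        _ = ε * en (4*γ) n := by rw [mul_assoc, ← en_add]; ring_nf
        _ ≤ _ := by gcongr; exact en_mono (by linarith) n
    have e2 : 1000 * L ≤ ε * en (δ/4) n := by
      refine le_trans ?_ e1
      exact le_mul_of_one_le_left (by positivity) (one_le_en (by linarith) n)
    have e3 : (s:ℝ) ≤ ε / 8 * en (δ/4) n := by have := F.s2; linarith
    calc en (1 - δ/4) n*s ≤ en (1 - δ/4) n*(ε / 8 * en (δ/4) n) := by
          have := en_pos (1 - δ/4) n
          gcongr
      _ = ε / 8 * (en (1 - δ/4) n * en (δ/4) n) := by ring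
      _ = ε / 8 * n := by rw [← en_add, sub_add_cancel, R.e1]
  have h4 : 2 < ε / 16 * n := by
    have h5 := en_mono (show γ ≤ 1 by linarith) n
    rw [R.e1] at h5
    have h6 : δ * en γ n ≤ ε / 16 * n := by
      have := en_pos γ n
      gcongr
    linarith
  have h5 := F.m2
  have h6 : δ * n ≤ ε / 16 * n := by gcongr
  linarith

lemma breaker_whp {p : ℕ → ℝ} (H : PHyp η p) {ε : ℝ} (hε : 0 < ε) (hε1 : ε ≤ 1) :
    Whp p (fun n ω => ∀ k : ℕ, (k:ℝ) ≤ (1 - ε) * n / LL p n → ¬ MakerWins (erGraph n ω) k) := by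
  have hη := H.hη0
  have hη1 := H.hη1
  obtain ⟨δ, hδε⟩ : ∃ δ, δ = ε * η / 16 := ⟨_, rfl⟩
  have hδ : 0 < δ := by rw [hδε]; positivity
  have hδ1 : δ ≤ 1/16 := by
    rw [hδε]
    have := mul_le_of_le_one_right hε.le hη1.le
    linarith
  obtain ⟨M, hM0⟩ := exists_nat_ge (1 / δ^2)
  have hM2 : 1 ≤ δ^2 * M := by rwa [div_le_iff₀' (by positivity)] at hM0
  have hM : 1 ≤ M := by
    rcases Nat.eq_zero_or_pos M with h | h
    · rw [h] at hM2; simp at hM2; linarith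
    · exact h
  have hγ : 0 < δ / 100 := by linarith
  let t0 : ℕ → ℕ := fun n => ⌈(1 - δ) * LL p n⌉₊
  let z : ℕ → ℕ := fun n => ⌈4 * δ * LL p n⌉₊
  let a : ℕ → ℕ := fun n => ⌈4 * δ / η * LL p n⌉₊
  let r : ℕ → ℕ := fun n => ⌈10 * Real.log (2 * M) / p n⌉₊
  let K : ℕ → ℕ := fun n => ⌈((t0 n:ℝ) + (M * z n : ℕ) + 2) / δ⌉₊
  let m : ℕ → ℕ := fun n => ⌊(1 - δ) * n / 2⌋₊
  let s : ℕ → ℕ := fun n => ⌈(2 + 1) * LL p n⌉₊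
  have BP : ∀ n, BPar δ η M (p n) n (LL p n) (t0 n) (z n) (a n) (r n) (K n) (m n) (s n) :=
    fun n => ⟨rfl, rfl, rfl, rfl, rfl, rfl, rfl⟩
  have hR := H.reg hγ (BC δ M)
  have hA1 : Whp p (fun n ω => PropA1 (erGraph n ω) (t0 n) (z n) M) := by
    refine Whp.of_bound H.h0 H.h1 (en_tendsto_zero (c := -1) (by linarith)) ?_
    filter_upwards [hR] with n R
    exact (A1_prob (H.h0 n) (H.h1 n) _ _ _).trans (brk_A1 (BP n) hδ hδ1 hM hM2 R)
  have hA2 : Whp p (fun n ω => PropA2 (erGraph n ω) (p n) (t0 n) (a n) (M * z n) (K n)) := by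
    refine Whp.of_bound H.h0 H.h1 (en_tendsto_zero (c := -1) (by linarith)) ?_
    filter_upwards [hR] with n R
    exact (A2_prob (H.h0 n) (H.h1 n) R.n1 _ _ _ _).trans (brk_A2 (BP n) hδ hδ1 hM R)
  refine Whp.mono H.h0 H.h1 (Whp.and H.h0 H.h1 (Whp.and H.h0 H.h1 (conc_whp H) (alpha_whp H one_pos))
    (Whp.and H.h0 H.h1 hA1 hA2)) ?_
  filter_upwards [hR] with n R ω hω
  intro k hk
  obtain ⟨⟨hc, hα⟩, hA1, hA2⟩ := hω
  obtain ⟨F, hδL, -, -, -, -⟩ := (BP n).facts hδ hδ1 hM R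
  have hL := R.hLpos
  have hn := R.n0
  refine breaker_wins (erGraph n ω) k (H.h0 n) (H.h1 n) ?_ ?_ hc ?_ hα hA1 hA2
    (brk_hr (BP n) hδ hδ1 hM R) (m n) ?_ (en (1 - δ/4) n) (en_pos _ _).le ?_
    (brk_hfin (BP n) hδ hδ1 hM hε hε1 hδε R hk)
  · have := Real.log_natCast_nonneg n
    positivity
  · rw [Fintype.card_fin]
    have : (k:ℝ) ≤ n := by
      refine hk.trans ?_
      rw [div_le_iff₀ hL]
      have h1 : 1 ≤ LL p n := by
        have := mul_le_of_le_one_left hL.le (show δ ≤ 1 by linarith)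
        linarith
      have := le_mul_of_one_le_right hn.le h1
      have := mul_pos hε hn
      linarith
    exact_mod_cast this
  · have h1 : (0:ℝ) < t0 n := by
      refine lt_of_lt_of_le ?_ F.t1
      exact mul_pos (by linarith) hL
    exact_mod_cast h1
  · rw [Fintype.card_fin]
    have h1 : 2 * (m n : ℝ) ≤ n := by
      have := F.m1
      have := mul_pos hδ hn
      linarith
    exact_mod_cast h1
  · rw [Fintype.card_fin]
    exact brk_hE (BP n) hδ hδ1 hM R

end BreakerAsym

open MeasureTheory Filter Finset
set_option linter.unusedSectionVars false
set_option linter.unusedVariables false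

section FinalAsm

lemma final_alg {e y g c : ℝ} (he : 0 < e) (he1 : e ≤ 1/8) (hy : 0 ≤ y) (hc : 0 ≤ c)
    (h1 : (1 - e) * y ≤ g) (h2 : g ≤ (1 + e) * y) (h3 : y / 2 ≤ (1 + e) * c)
    (h4 : c ≤ (1 + 2 * e) * (y / 2)) : (2 - 8 * e) * c ≤ g ∧ g ≤ (2 + 8 * e) * c := by
  constructor
  · calc (2 - 8 * e) * c ≤ (2 - 8 * e) * ((1 + 2 * e) * (y / 2)) := by
          apply mul_le_mul_of_nonneg_left h4; linarith
      _ = (1 - 2 * e - 8 * e ^ 2) * y := by ring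
      _ ≤ (1 - e) * y := by
          apply mul_le_mul_of_nonneg_right _ hy
          nlinarith
      _ ≤ g := h1
  · calc g ≤ (1 + e) * y := h2
      _ = (2 * (1 + e)) * (y / 2) := by ring
      _ ≤ (2 * (1 + e)) * ((1 + e) * c) := by
          apply mul_le_mul_of_nonneg_left h3; linarith
      _ = (2 + 4 * e + 2 * e ^ 2) * c := by ring
      _ ≤ (2 + 8 * e) * c := by
          apply mul_le_mul_of_nonneg_right _ hc
          nlinarith

end FinalAsm

theorem game_chromatic_number_asymptotics_whp
    (η : ℝ) (hη0 : 0 < η) (hη1 : η < 1)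
    (p : ℕ → ℝ) (hp0 : ∀ n, 0 < p n) (hp1 : ∀ n, p n ≤ 1 - η)
    (hpbig : Tendsto (fun n => Real.log (1 / p n) / Real.log n) atTop (nhds 0))
    (ε : ℝ) (hε : 0 < ε) :
    Tendsto
      (fun n =>
        erMeasure n (p n) {ω : EdgeIdx n → Bool |
          ((1 - ε) * n / (Real.log (n * p n) / Real.log (1 / (1 - p n))) ≤ (gameChromaticNumber (erGraph n ω) : ℝ) ∧
            (gameChromaticNumber (erGraph n ω) : ℝ) ≤ (1 + ε) * n / (Real.log (n * p n) / Real.log (1 / (1 - p n)))) ∧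
          ((2 - ε) * ((erGraph n ω).chromaticNumber.toNat : ℝ) ≤ (gameChromaticNumber (erGraph n ω) : ℝ) ∧
            (gameChromaticNumber (erGraph n ω) : ℝ) ≤ (2 + ε) * ((erGraph n ω).chromaticNumber.toNat : ℝ))})
      atTop (nhds 1) := by
  have H : PHyp η p := ⟨hη0, hη1, hp0, hp1, hpbig⟩
  obtain ⟨e, he⟩ : ∃ e, e = min ε 1 / 8 := ⟨_, rfl⟩
  have he0 : 0 < e := by rw [he]; have := lt_min hε one_pos; linarith
  have he1 : e ≤ 1/8 := by rw [he]; have := min_le_right ε 1; linarith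
  have heε : 8 * e ≤ ε := by rw [he]; have := min_le_left ε 1; linarith
  have hW : Whp p (fun n ω => ω ∈ {ω : EdgeIdx n → Bool |
          ((1 - ε) * n / (Real.log (n * p n) / Real.log (1 / (1 - p n))) ≤ (gameChromaticNumber (erGraph n ω) : ℝ) ∧
            (gameChromaticNumber (erGraph n ω) : ℝ) ≤ (1 + ε) * n / (Real.log (n * p n) / Real.log (1 / (1 - p n)))) ∧
          ((2 - ε) * ((erGraph n ω).chromaticNumber.toNat : ℝ) ≤ (gameChromaticNumber (erGraph n ω) : ℝ) ∧
            (gameChromaticNumber (erGraph n ω) : ℝ) ≤ (2 + ε) * ((erGraph n ω).chromaticNumber.toNat : ℝ))}) := by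
    refine Whp.mono H.h0 H.h1
      (Whp.and H.h0 H.h1
        (Whp.and H.h0 H.h1 (maker_whp H he0 (by linarith)) (breaker_whp H he0 (by linarith)))
        (Whp.and H.h0 H.h1 (chi_lower H he0) (chi_upper H he0 (by linarith)))) ?_
    filter_upwards [H.reg one_pos 1, hpbig.eventually (gt_mem_nhds he0)] with n R hθ ω hω
    obtain ⟨⟨hmk, hbr⟩, hcl, hcu⟩ := hω
    have hL := R.hLpos
    have hn := R.n0
    have hp := hp0 n
    have hx : 0 < Real.log n := Real.log_pos (by exact_mod_cast R.hn)
    obtain ⟨g, hg⟩ : ∃ g : ℕ, g = gameChromaticNumber (erGraph n ω) := ⟨_, rfl⟩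
    obtain ⟨c, hc⟩ : ∃ c : ℕ, c = (erGraph n ω).chromaticNumber.toNat := ⟨_, rfl⟩
    have hgm : MakerWins (erGraph n ω) g := by
      rw [hg]
      exact Nat.sInf_mem (s := {k | MakerWins (erGraph n ω) k}) ⟨_, hmk⟩
    have hg2 : (g:ℝ) ≤ (1 + e) * n / LL p n := by
      have h1 : g ≤ ⌊(1 + e) * n / LL p n⌋₊ := by
        rw [hg]
        exact Nat.sInf_le hmk
      calc (g:ℝ) ≤ (⌊(1 + e) * n / LL p n⌋₊ : ℝ) := by exact_mod_cast h1
        _ ≤ _ := Nat.floor_le (by positivity)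
    have hg1 : (1 - e) * n / LL p n ≤ g := by
      by_contra hh
      push Not at hh
      exact hbr g hh.le hgm
    rw [← hg, ← hc]
    rw [← hc] at hcl hcu
    obtain ⟨y, hy⟩ : ∃ y : ℝ, y = n / LL p n := ⟨_, rfl⟩
    have hy0 : 0 < y := by rw [hy]; positivity
    rw [mul_div_assoc, ← hy] at hg1 hg2
    have hy2 : (n:ℝ) / (2 * LL p n) = y / 2 := by rw [hy]; field_simp
    rw [hy2] at hcl hcu
    obtain ⟨f1, f2⟩ := final_alg he0 he1 hy0.le (Nat.cast_nonneg c) hg1 hg2 hcl hcu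
    have hc0 : (0:ℝ) ≤ c := Nat.cast_nonneg c
    -- the logarithm to base b
    obtain ⟨ℓ, hℓ⟩ : ∃ ℓ : ℝ, ℓ = Real.log (n * p n) / Real.log (1 / (1 - p n)) := ⟨_, rfl⟩
    rw [← hℓ]
    have hlam : 0 < -Real.log (1 - p n) := by
      have := Real.log_neg R.q0 (by linarith)
      linarith
    have hθ0 : Real.log (1 / p n) = -Real.log (p n) := by rw [one_div, Real.log_inv]
    have hlp : Real.log (p n) ≤ 0 := Real.log_nonpos hp.le (H.h1 n)
    have hℓe : ℓ = (Real.log n + Real.log (p n)) / (-Real.log (1 - p n)) := by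
      rw [hℓ, Real.log_mul hn.ne' hp.ne', one_div, Real.log_inv]
    have hl1 : ℓ ≤ LL p n := by
      rw [hℓe]; unfold LL
      gcongr
      linarith
    have hl2 : (1 - e) * LL p n ≤ ℓ := by
      rw [hℓe]; unfold LL
      rw [mul_div_assoc']
      gcongr
      rw [hθ0, div_lt_iff₀ hx] at hθ
      linarith
    have hl0 : 0 < ℓ := lt_of_lt_of_le (mul_pos (by linarith) hL) hl2
    have y1 : y ≤ n / ℓ := by rw [hy]; gcongr
    have y2 : (1 - e) * (n / ℓ) ≤ y := by
      rw [hy, mul_div_assoc', div_le_div_iff₀ hl0 hL]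
      have := mul_le_mul_of_nonneg_left hl2 hn.le
      linarith
    have y0 : 0 < (n:ℝ) / ℓ := by positivity
    refine ⟨⟨?_, ?_⟩, ?_, ?_⟩
    · rw [mul_div_assoc]
      calc (1 - ε) * (n / ℓ) ≤ ((1 - e) * (1 - e)) * (n / ℓ) := by
            apply mul_le_mul_of_nonneg_right _ y0.le
            nlinarith
        _ = (1 - e) * ((1 - e) * (n / ℓ)) := by ring
        _ ≤ (1 - e) * y := by apply mul_le_mul_of_nonneg_left y2; linarith
        _ ≤ g := hg1
    · rw [mul_div_assoc]
      calc (g:ℝ) ≤ (1 + e) * y := hg2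
        _ ≤ (1 + ε) * (n / ℓ) := by gcongr; linarith
    · calc _ ≤ (2 - 8 * e) * (c:ℝ) := by gcongr
        _ ≤ _ := f1
    · calc _ ≤ _ := f2
        _ ≤ (2 + ε) * (c:ℝ) := by gcongr
  have hT := hW.const_sub 1
  rw [sub_zero] at hT
  have hT2 := (ENNReal.continuous_ofReal.tendsto 1).comp hT
  rw [ENNReal.ofReal_one] at hT2
  refine hT2.congr fun n => ?_
  rw [erMeasure_eq n (H.h0 n) (H.h1 n)]
  simp only [Function.comp]
  rw [Pr_not]
  congr 1
  ring
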